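/- (Equality propagation in the LBT for d > 4.) Let d > 4, s ≥ 0, n ≥ d+s+1, and let P ∈ P(d,n,s). If f_i(P) equals the lower bound φ_i(d,n,s) for some 1 ≤ i ≤ d−1, where φ_i(d,n,s) = C(d,i)·n − C(d+1,i+1)·i for 1 ≤ i ≤ d−3, φ_{d−2}(d,n,s) = C(d,d−2)·n − C(d+1,d−1)·(d−2) − s, and φ_{d−1}(d,n,s) = (d−1)·n − (d+1)(d−2) − s, then f_i(P) = φ_i(d,n,s) for all 0 ≤ i ≤ d−1 (with φ_0(d,n,s) = n). -/

import Mathlib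

open Finset

namespace ASP

noncomputable section

/-- The dot product of two vectors in `ℝ^d`. -/
def dotp {d : ℕ} (x y : Fin d → ℝ) : ℝ := ∑ i, x i * y i

/-- `F` is a face of the polytope `P ⊆ ℝ^d`: the intersection of `P` with a supporting
hyperplane, together with the empty face and `P` itself. -/
def IsFaceOf {d : ℕ} (P F : Set (Fin d → ℝ)) : Prop :=
  F = ∅ ∨ F = P ∨
    ∃ (b : Fin d → ℝ) (c : ℝ), b ≠ 0 ∧ (∀ x ∈ P, dotp b x ≤ c) ∧
      F = {x ∈ P | dotp b x = c}

/-- The dimension of a subset of `ℝ^d`: the dimension of its affine span. -/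
def polyDim {d : ℕ} (S : Set (Fin d → ℝ)) : ℕ :=
  Module.finrank ℝ (affineSpan ℝ S).direction

/-- A polytope: the convex hull of a finite point set. -/
def IsPolytope {d : ℕ} (P : Set (Fin d → ℝ)) : Prop :=
  ∃ V : Finset (Fin d → ℝ), P = convexHull ℝ (V : Set (Fin d → ℝ))

/-- The vertex set of a polytope: its set of extreme points. -/
def verts {d : ℕ} (P : Set (Fin d → ℝ)) : Set (Fin d → ℝ) :=
  Set.extremePoints ℝ P

/-- `fVec P i` is the number of `i`-dimensional (nonempty) faces of `P`. -/
def fVec {d : ℕ} (P : Set (Fin d → ℝ)) (i : ℕ) : ℕ :=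
  {F : Set (Fin d → ℝ) | IsFaceOf P F ∧ F.Nonempty ∧ polyDim F = i}.ncard

/-- A facet of a `d`-polytope in `ℝ^d`: a `(d-1)`-dimensional face. -/
def IsFacetOf {d : ℕ} (P F : Set (Fin d → ℝ)) : Prop :=
  IsFaceOf P F ∧ F.Nonempty ∧ polyDim F = d - 1

/-- `(P, F)` is an ASP-pair: `P` is a `d`-polytope, `F` is a facet of `P`, and every facet
of `P` other than `F` is a simplex (i.e. has exactly `d` vertices). -/
def IsASPPair {d : ℕ} (P F : Set (Fin d → ℝ)) : Prop :=
  IsPolytope P ∧ polyDim P = d ∧ IsFacetOf P F ∧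
    ∀ G, IsFacetOf P G → G ≠ F → (verts G).ncard = d

/-- `P ∈ 𝒫(d,n,s)`: `P` is a `d`-polytope with `n` vertices such that `(P,F)` is an
ASP-pair where the facet `F` has `d + s` vertices. -/
def MemASP (d n s : ℕ) (P : Set (Fin d → ℝ)) : Prop :=
  (verts P).ncard = n ∧ ∃ F, IsASPPair P F ∧ (verts F).ncard = d + s

/-- `fBall P i` is `f_{i-1}(P')` of the simplicial ball `P' = ∂P - {F}` consisting of all
proper faces of `P` except its (unique non-simplex) facet `F`; the index is shifted by one,
so `fBall P 0 = f_{-1} = 1` counts the empty face, and at the top dimension the facet `F`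
is discarded. -/
def fBall {d : ℕ} (P : Set (Fin d → ℝ)) (i : ℕ) : ℤ :=
  if i = 0 then 1
  else if i = d then (fVec P (d - 1) : ℤ) - 1
  else if d < i then 0
  else (fVec P (i - 1) : ℤ)

/-- `hBall P k` is `h_k(P')` of the `(d-1)`-dimensional ball `P' = ∂P - {F}`, defined by
`h_k = ∑_{i=0}^{k} (-1)^{k-i} C(d-i, k-i) f_{i-1}(P')`, extended by `0` outside `0 ≤ k ≤ d`. -/
def hBall {d : ℕ} (P : Set (Fin d → ℝ)) (k : ℤ) : ℤ :=
  if 0 ≤ k ∧ k ≤ (d : ℤ) then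
    ∑ i ∈ Finset.range (k.toNat + 1),
      (-1) ^ (k.toNat - i) * ((d - i).choose (k.toNat - i) : ℤ) * fBall P i
  else 0

/-- `fBd m Q i` is `f_{i-1}(∂Q)` of the boundary complex of an `m`-polytope `Q ⊆ ℝ^d`
(a complex of dimension `m - 1`); the index is shifted by one. -/
def fBd {d : ℕ} (m : ℕ) (Q : Set (Fin d → ℝ)) (i : ℕ) : ℤ :=
  if i = 0 then 1 else if m + 1 ≤ i then 0 else (fVec Q (i - 1) : ℤ)

/-- `hBd m Q k` is `h_k(∂Q)` for the boundary complex of an `m`-polytope `Q ⊆ ℝ^d`, defined by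
`h_k = ∑_{i=0}^{k} (-1)^{k-i} C(m-i, k-i) f_{i-1}(∂Q)`, extended by `0` outside `0 ≤ k ≤ m`. -/
def hBd {d : ℕ} (m : ℕ) (Q : Set (Fin d → ℝ)) (k : ℤ) : ℤ :=
  if 0 ≤ k ∧ k ≤ (m : ℤ) then
    ∑ i ∈ Finset.range (k.toNat + 1),
      (-1) ^ (k.toNat - i) * ((m - i).choose (k.toNat - i) : ℤ) * fBd m Q i
  else 0

/-- `gBd m Q k = g_k(∂Q) = h_k(∂Q) - h_{k-1}(∂Q)`. -/
def gBd {d : ℕ} (m : ℕ) (Q : Set (Fin d → ℝ)) (k : ℤ) : ℤ :=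
  hBd m Q k - hBd m Q (k - 1)

/-- The function `p(t) = (n-1)^{(t-1)(d-1)} · t(t+1)⋯(t+d+s-1)` (real exponentiation of the
positive base `n-1`) used to define the almost cyclic polytope. -/
def acp (d n s : ℕ) (t : ℝ) : ℝ :=
  ((n : ℝ) - 1) ^ ((t - 1) * ((d : ℝ) - 1)) * ∏ l ∈ Finset.range (d + s), (t + l)

/-- The curve `y(t) = (t, t², …, t^{d-1}, p(t)) ∈ ℝ^d`. -/
def acy (d n s : ℕ) (t : ℝ) : Fin d → ℝ :=
  fun i => if (i : ℕ) + 1 = d then acp d n s t else t ^ ((i : ℕ) + 1)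

/-- The parameter values `t_i = -s - d + i` for `i = 1, …, n` (here `0`-indexed:
`acT d s j = t_{j+1}`). -/
def acT (d s j : ℕ) : ℝ := (j : ℝ) + 1 - s - d

/-- The `n` points `y(t_1), …, y(t_n)` on the curve `y` (`0`-indexed). -/
def acPoint (d n s : ℕ) (j : Fin n) : Fin d → ℝ := acy d n s (acT d s (j : ℕ))

/-- The almost cyclic polytope `C(d,n,s) = conv{y(t_1), …, y(t_n)}`. -/
def acPolytope (d n s : ℕ) : Set (Fin d → ℝ) :=
  convexHull ℝ (Set.range (acPoint d n s))

/-- The non-simplex facet `F = conv{y(t_1), …, y(t_{d+s})}` of the almost cyclic polytope. -/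
def acFacet (d n s : ℕ) : Set (Fin d → ℝ) :=
  convexHull ℝ (acPoint d n s '' {j : Fin n | (j : ℕ) < d + s})

/-- The generalized moment curve
`x(t) = (t, t², …, t^{d-r}, p_1(t), …, p_r(t)) ∈ ℝ^d`. -/
def gmc (d r : ℕ) (p : Fin r → ℝ → ℝ) (t : ℝ) : Fin d → ℝ :=
  fun i =>
    if h : (i : ℕ) < d - r then t ^ ((i : ℕ) + 1)
    else p ⟨(i : ℕ) - (d - r), by have h2 := i.2; omega⟩ t

/-- A polytope is `k`-neighborly if each subset of at most `k` of its vertices is the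
vertex set of a face. -/
def IsNeighborly {d : ℕ} (k : ℕ) (P : Set (Fin d → ℝ)) : Prop :=
  ∀ S : Finset (Fin d → ℝ), (S : Set (Fin d → ℝ)) ⊆ verts P → S.card ≤ k →
    ∃ G : Set (Fin d → ℝ), IsFaceOf P G ∧ verts G = (S : Set (Fin d → ℝ))

/-- The point `y` is beyond the facet `F` of the polytope `P`: for every supporting
hyperplane of `P` cutting out a facet, `y` is strictly on the outer side if the facet is `F`,
and strictly on the inner side otherwise. -/
def IsBeyond {d : ℕ} (P F : Set (Fin d → ℝ)) (y : Fin d → ℝ) : Prop :=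
  ∀ (b : Fin d → ℝ) (c : ℝ), b ≠ 0 → (∀ x ∈ P, dotp b x ≤ c) →
    IsFacetOf P {x ∈ P | dotp b x = c} →
      (({x ∈ P | dotp b x = c} = F → c < dotp b y) ∧
       ({x ∈ P | dotp b x = c} ≠ F → dotp b y < c))

/-- The lower bound `φ_i(d,n,s)` of the LBT for almost simplicial polytopes,
with `φ_0(d,n,s) = n`. -/
def phi (d n s i : ℕ) : ℤ :=
  if i = 0 then (n : ℤ)
  else if i ≤ d - 3 then (d.choose i : ℤ) * n - ((d + 1).choose (i + 1) : ℤ) * i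
  else if i = d - 2 then
    (d.choose (d - 2) : ℤ) * n - ((d + 1).choose (d - 1) : ℤ) * ((d : ℤ) - 2) - s
  else ((d : ℤ) - 1) * n - ((d : ℤ) + 1) * ((d : ℤ) - 2) - s

section Core
open scoped Classical
set_option linter.all false
variable {V : Type} [Fintype V]

/-- combinatorial faces -/
def Fc (W : Submodule ℝ (V → ℝ)) (X A : Finset V) : Prop :=
  A ⊆ X ∧ ∃ w ∈ W, (∀ x ∈ X, 0 ≤ w x) ∧ (∀ x ∈ X, w x = 0 ↔ x ∈ A)

/-- functionals vanishing on `A` -/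
def van (W : Submodule ℝ (V → ℝ)) (A : Finset V) : Submodule ℝ (V → ℝ) where
  carrier := {w | w ∈ W ∧ ∀ x ∈ A, w x = 0}
  add_mem' := by
    rintro a b ⟨ha, ha'⟩ ⟨hb, hb'⟩
    exact ⟨W.add_mem ha hb, fun x hx => by simp [ha' x hx, hb' x hx]⟩
  zero_mem' := ⟨W.zero_mem, fun x _ => rfl⟩
  smul_mem' := by
    rintro c a ⟨ha, ha'⟩
    exact ⟨W.smul_mem c ha, fun x hx => by simp [ha' x hx]⟩

theorem mem_van {W : Submodule ℝ (V → ℝ)} {A : Finset V} {w : V → ℝ} :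
    w ∈ van W A ↔ w ∈ W ∧ ∀ x ∈ A, w x = 0 := Iff.rfl

theorem van_le (W : Submodule ℝ (V → ℝ)) (A : Finset V) : van W A ≤ W := fun _ h => h.1

structure Poly (W : Submodule ℝ (V → ℝ)) (X : Finset V) : Prop where
  pt : Fc W X ∅
  vx : ∀ x ∈ X, Fc W X {x}
  inj : ∀ w ∈ W, (∀ x ∈ X, w x = 0) → w = 0

def nb (W : Submodule ℝ (V → ℝ)) (X : Finset V) (v : V) : Finset V :=
  X.filter (fun j => j ≠ v ∧ Fc W X {v, j})

theorem mem_nb {W : Submodule ℝ (V → ℝ)} {X : Finset V} {v j : V} :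
    j ∈ nb W X v ↔ j ∈ X ∧ j ≠ v ∧ Fc W X {v, j} := by simp [nb]

theorem nb_symm {W : Submodule ℝ (V → ℝ)} {X : Finset V} {v j : V} (h : j ∈ nb W X v) :
    v ∈ nb W X j := by
  rw [mem_nb] at *
  refine ⟨h.2.2.1 (by simp), h.2.1.symm, ?_⟩
  rw [Finset.pair_comm]; exact h.2.2

theorem exists_bigM (X : Finset V) (w l : V → ℝ) :
    ∃ M : ℝ, 0 < M ∧ ∀ x ∈ X, 0 < l x → 0 < w x + M * l x := by
  refine ⟨1 + ∑ x ∈ X, |w x| / |l x|, ?_, ?_⟩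
  · have : 0 ≤ ∑ x ∈ X, |w x| / |l x| := Finset.sum_nonneg (fun x _ => by positivity)
    linarith
  · intro x hx hl
    have h1 : |w x| / |l x| ≤ ∑ x ∈ X, |w x| / |l x| :=
      Finset.single_le_sum (f := fun x => |w x| / |l x|) (fun y _ => by positivity) hx
    rw [abs_of_pos hl] at h1
    have h2 : |w x| ≤ (∑ x ∈ X, |w x| / |l x|) * l x := by
      rw [div_le_iff₀ hl] at h1; exact h1
    have := neg_abs_le (w x)
    nlinarith

theorem Fc.pos {W : Submodule ℝ (V → ℝ)} {X A : Finset V} (h : Fc W X A) :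
    ∃ l ∈ W, (∀ x ∈ X, 0 ≤ l x) ∧ (∀ x ∈ A, l x = 0) ∧ (∀ x ∈ X, x ∉ A → 0 < l x) := by
  obtain ⟨hA, l, hl, h0, h1⟩ := h
  refine ⟨l, hl, h0, fun x hx => (h1 x (hA hx)).2 hx, fun x hx hxA => ?_⟩
  exact lt_of_le_of_ne (h0 x hx) (fun h => hxA ((h1 x hx).1 h.symm))

theorem Fc.mk' {W : Submodule ℝ (V → ℝ)} {X A : Finset V} (hA : A ⊆ X) (l : V → ℝ) (hl : l ∈ W)
    (h0 : ∀ x ∈ A, l x = 0) (h1 : ∀ x ∈ X, x ∉ A → 0 < l x) : Fc W X A := by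
  refine ⟨hA, l, hl, fun x hx => ?_, fun x hx => ⟨fun h => ?_, h0 x⟩⟩
  · by_cases hxA : x ∈ A
    · exact (h0 x hxA).ge
    · exact (h1 x hx hxA).le
  · by_contra hxA
    exact (h1 x hx hxA).ne' h

/-- sub-face lemma -/
theorem Fc.sub {W : Submodule ℝ (V → ℝ)} {X A B : Finset V} (h : Fc W X A) (hB : B ⊆ A)
    (w : V → ℝ) (hw : w ∈ W) (h0 : ∀ x ∈ B, w x = 0) (h1 : ∀ x ∈ A, x ∉ B → 0 < w x) :
    Fc W X B := by
  obtain ⟨l, hl, l0, l1, l2⟩ := h.pos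
  obtain ⟨M, hM, hM'⟩ := exists_bigM X w l
  refine Fc.mk' (hB.trans h.1) (w + M • l) (W.add_mem hw (W.smul_mem _ hl)) ?_ ?_
  · intro x hx; simp [h0 x hx, l1 x (hB hx)]
  · intro x hx hxB
    by_cases hxA : x ∈ A
    · simp [l1 x hxA, h1 x hxA hxB]
    · have := hM' x hx (l2 x hx hxA); simpa using this

/-- A face is determined by its vanishing functionals. -/
theorem Fc.mem_iff {W : Submodule ℝ (V → ℝ)} {X A : Finset V} (h : Fc W X A) {x : V} (hx : x ∈ X) :
    x ∈ A ↔ ∀ w ∈ van W A, w x = 0 := by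
  refine ⟨fun hxA w hw => hw.2 x hxA, fun hh => ?_⟩
  obtain ⟨hA, l, hl, h0, h1⟩ := h
  exact (h1 x hx).1 (hh l ⟨hl, fun y hy => (h1 y (hA hy)).2 hy⟩)

theorem Fc.eq_of_van {W : Submodule ℝ (V → ℝ)} {X A B : Finset V} (h : Fc W X A) (h' : Fc W X B)
    (hv : van W A = van W B) : A = B := by
  ext x
  constructor
  · intro hx
    rw [h'.mem_iff (h.1 hx), ← hv, ← h.mem_iff (h.1 hx)]; exact hx
  · intro hx
    rw [h.mem_iff (h'.1 hx), hv, ← h'.mem_iff (h'.1 hx)]; exact hx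

theorem van_anti {W : Submodule ℝ (V → ℝ)} {A B : Finset V} (h : A ⊆ B) : van W B ≤ van W A :=
  fun _ hw => ⟨hw.1, fun x hx => hw.2 x (h hx)⟩

/-- minimal ratio -/
theorem exists_min_ratio (S : Finset V) (hS : S.Nonempty) (w u : V → ℝ) (hu : ∀ x ∈ S, 0 < u x) :
    ∃ m : ℝ, (∃ x ∈ S, w x = m * u x) ∧ ∀ x ∈ S, m * u x ≤ w x := by
  obtain ⟨y, hy, hy'⟩ := Finset.exists_min_image S (fun x => w x / u x) hS
  refine ⟨w y / u y, ⟨y, hy, ?_⟩, fun x hx => ?_⟩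
  · have := (hu y hy).ne'
    field_simp
  · have := hy' x hx
    rw [le_div_iff₀ (hu x hx)] at this
    exact this

/-- The neighbours generate. -/
theorem Poly.neighbor {W : Submodule ℝ (V → ℝ)} {X : Finset V} (hP : Poly W X) {v : V} (hv : v ∈ X)
    {w : V → ℝ} (hw : w ∈ W) (hwv : w v = 0) (hn : ∀ j ∈ nb W X v, 0 ≤ w j) :
    ∀ x ∈ X, 0 ≤ w x := by
  by_contra hcon
  push Not at hcon
  obtain ⟨x0, hx0, hx0'⟩ := hcon
  obtain ⟨u, hu, u0, u1, u2⟩ := (hP.vx v hv).pos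
  have uv : u v = 0 := u1 v (by simp)
  have u2' : ∀ x ∈ X, x ≠ v → 0 < u x := fun x hx hxv => u2 x hx (by simpa using hxv)
  -- the family of bad faces
  let Bad : Finset (Finset V) := X.powerset.filter (fun A => v ∈ A ∧ A ≠ {v} ∧ Fc W X A ∧
    ∀ x ∈ A, x ≠ v → w x < 0)
  -- production of smaller faces
  have prod : ∀ A, v ∈ A → A ≠ {v} → Fc W X A → ∀ w1 ∈ W, w1 v = 0 →
      ∃ m : ℝ, (∃ x ∈ A, x ≠ v ∧ w1 x = m * u x) ∧ (∀ x ∈ A, m * u x ≤ w1 x) ∧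
      Fc W X (A.filter (fun x => w1 x = m * u x)) := by
    intro A hvA hAv hA w1 hw1 hw1v
    have hne : (A.erase v).Nonempty := by
      by_contra h
      rw [Finset.not_nonempty_iff_eq_empty] at h
      apply hAv
      rw [← Finset.insert_erase hvA, h]; rfl
    obtain ⟨m, ⟨x, hx, hxm⟩, hm⟩ := exists_min_ratio (A.erase v) hne w1 u
      (fun x hx => u2' x (hA.1 (Finset.mem_of_mem_erase hx)) (Finset.ne_of_mem_erase hx))
    have hm' : ∀ x ∈ A, m * u x ≤ w1 x := by
      intro x hx
      by_cases hxv : x = v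
      · subst hxv; simp [uv, hw1v]
      · exact hm x (Finset.mem_erase.2 ⟨hxv, hx⟩)
    refine ⟨m, ⟨x, Finset.mem_of_mem_erase hx, Finset.ne_of_mem_erase hx, hxm⟩, hm', ?_⟩
    refine hA.sub (Finset.filter_subset _ _) (w1 - m • u) (W.sub_mem hw1 (W.smul_mem _ hu)) ?_ ?_
    · intro x hx
      rw [Finset.mem_filter] at hx
      simp [hx.2]
    · intro x hx hxn
      have h1 : w1 x ≠ m * u x := fun h => hxn (Finset.mem_filter.2 ⟨hx, h⟩)
      have h2 := lt_of_le_of_ne (hm' x hx) h1.symm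
      simp; linarith
  have hXf : Fc W X X := ⟨subset_rfl, 0, W.zero_mem, by simp, by simp⟩
  have hx0v : x0 ≠ v := by rintro rfl; linarith
  have hBne : Bad.Nonempty := by
    obtain ⟨m, ⟨x, hx, hxv, hxm⟩, hm, hF⟩ := prod X hv (by
      intro h; rw [h] at hx0; simp at hx0; exact hx0v hx0) hXf w hw hwv
    have hmneg : m < 0 := by
      have := hm x0 hx0
      have := u2' x0 hx0 hx0v
      nlinarith
    refine ⟨_, Finset.mem_filter.2 ⟨Finset.mem_powerset.2 (Finset.filter_subset _ X),
      ?_, ?_, hF, ?_⟩⟩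
    · simp [hv, uv, hwv]
    · intro h
      have : x ∈ ({v} : Finset V) := by rw [← h]; simp [hx, hxm]
      simp at this; exact hxv this
    · intro y hy hyv
      rw [Finset.mem_filter] at hy
      rw [hy.2]
      have := u2' y hy.1 hyv
      nlinarith
  obtain ⟨A, hA, hAmin⟩ := Finset.exists_min_image Bad Finset.card hBne
  obtain ⟨_, hvA, hAv, hAF, hAneg⟩ := Finset.mem_filter.1 hA
  have hconst : ∀ w1 ∈ W, w1 v = 0 → ∃ m : ℝ, ∀ x ∈ A, w1 x = m * u x := by
    intro w1 hw1 hw1v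
    obtain ⟨m, ⟨x, hx, hxv, hxm⟩, hm, hF⟩ := prod A hvA hAv hAF w1 hw1 hw1v
    refine ⟨m, ?_⟩
    have hle := hAmin (A.filter (fun x => w1 x = m * u x)) (Finset.mem_filter.2
      ⟨Finset.mem_powerset.2 hF.1, by simp [hvA, uv, hw1v], ?_, hF, ?_⟩)
    · have := Finset.eq_of_subset_of_card_le (Finset.filter_subset _ _) hle
      intro y hy
      rw [← this] at hy
      exact (Finset.mem_filter.1 hy).2
    · intro h
      have : x ∈ ({v} : Finset V) := by rw [← h]; simp [hx, hxm]
      simp at this; exact hxv this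
    · intro y hy hyv
      exact hAneg y (Finset.mem_filter.1 hy).1 hyv
  -- pick an element
  obtain ⟨x, hx, hxv⟩ : ∃ x ∈ A, x ≠ v := by
    by_contra h
    push Not at h
    apply hAv
    ext y
    simp only [Finset.mem_singleton]
    exact ⟨h y, fun h => h ▸ hvA⟩
  have hApair : A = {v, x} := by
    ext y
    simp only [Finset.mem_insert, Finset.mem_singleton]
    refine ⟨fun hy => ?_, fun h => by rcases h with rfl | rfl <;> assumption⟩
    by_contra hcon
    push Not at hcon
    obtain ⟨hyv, hyx⟩ := hcon
    obtain ⟨t, ht, -, t1, t2⟩ := (hP.vx x (hAF.1 hx)).pos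
    obtain ⟨t', ht', -, t1', t2'⟩ := (hP.vx y (hAF.1 hy)).pos
    have a1 := t2 v hv (by simpa using hxv.symm)
    have a2 := t2 y (hAF.1 hy) (by simpa using hyx)
    have a3 := t2' v hv (by simpa using hyv.symm)
    have a4 := t2' x (hAF.1 hx) (by simpa using Ne.symm hyx)
    have a5 := t1 x (by simp)
    have a6 := t1' y (by simp)
    obtain ⟨m, hm⟩ := hconst (t' v • t - t v • t')
      (W.sub_mem (W.smul_mem _ ht) (W.smul_mem _ ht')) (by simp; ring)
    have e1 := hm x hx
    have e2 := hm y hy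
    simp [a5, a6] at e1 e2
    have b1 := u2' x (hAF.1 hx) hxv
    have b2 := u2' y (hAF.1 hy) hyv
    have c1 : m * u x < 0 := by rw [← e1]; nlinarith
    have c2 : 0 < m * u y := by rw [← e2]; positivity
    have : m < 0 := by nlinarith
    nlinarith
  have : x ∈ nb W X v := mem_nb.2 ⟨hAF.1 hx, hxv, hApair ▸ hAF⟩
  exact absurd (hn x this) (not_le.2 (hAneg x hx hxv))

theorem Poly.neighbor_face {W : Submodule ℝ (V → ℝ)} {X A : Finset V} (hP : Poly W X) {v : V}
    (hA : Fc W X A) (hv : v ∈ A)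
    {w : V → ℝ} (hw : w ∈ W) (hwv : w v = 0) (hn : ∀ j ∈ nb W X v, j ∈ A → 0 ≤ w j) :
    ∀ x ∈ A, 0 ≤ w x := by
  obtain ⟨l, hl, l0, l1, l2⟩ := hA.pos
  obtain ⟨M, hM, hM'⟩ := exists_bigM X w l
  have := hP.neighbor (hA.1 hv) (w := w + M • l) (W.add_mem hw (W.smul_mem _ hl))
    (by simp [hwv, l1 v hv]) (by
      intro j hj
      have hjX := (mem_nb.1 hj).1
      by_cases hjA : j ∈ A
      · simp [l1 j hjA, hn j hj hjA]
      · have := hM' j hjX (l2 j hjX hjA)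
        simpa using this.le)
  intro x hx
  have := this x (hA.1 hx)
  simpa [l1 x hx] using this

theorem Poly.neighbor_zero {W : Submodule ℝ (V → ℝ)} {X A : Finset V} (hP : Poly W X) {v : V}
    (hA : Fc W X A) (hv : v ∈ A)
    {w : V → ℝ} (hw : w ∈ W) (hwv : w v = 0) (hn : ∀ j ∈ nb W X v, j ∈ A → w j = 0) :
    ∀ x ∈ A, w x = 0 := by
  intro x hx
  have h1 := hP.neighbor_face hA hv hw hwv (fun j hj hjA => (hn j hj hjA).ge) x hx
  have h2 := hP.neighbor_face hA hv (w := -w) (W.neg_mem hw) (by simp [hwv])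
    (fun j hj hjA => by simp [hn j hj hjA]) x hx
  simp at h2
  linarith

theorem Fc.self {W : Submodule ℝ (V → ℝ)} {X : Finset V} : Fc W X X :=
  ⟨subset_rfl, 0, W.zero_mem, by simp, by simp⟩

/-- vertex figure -/
theorem Poly.link {W : Submodule ℝ (V → ℝ)} {X : Finset V} (hP : Poly W X) {v : V} (hv : v ∈ X) :
    Poly (van W {v}) (nb W X v) := by
  refine ⟨?_, ?_, ?_⟩
  · obtain ⟨l, hl, l0, l1, l2⟩ := (hP.vx v hv).pos
    refine Fc.mk' (by simp) l ⟨hl, l1⟩ (by simp) ?_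
    intro x hx _
    rw [mem_nb] at hx
    exact l2 x hx.1 (by simpa using hx.2.1)
  · intro j hj
    have hj' := mem_nb.1 hj
    obtain ⟨l, hl, l0, l1, l2⟩ := hj'.2.2.pos
    refine Fc.mk' (by simpa using hj) l ⟨hl, fun x hx => l1 x (by simp at hx; simp [hx])⟩
      (fun x hx => l1 x (by simp at hx; simp [hx])) ?_
    intro x hx hxj
    rw [mem_nb] at hx
    exact l2 x hx.1 (by simp at hxj; simp [hxj, hx.2.1])
  · intro w hw h0
    apply hP.inj w hw.1
    exact hP.neighbor_zero Fc.self hv hw.1 (hw.2 v (by simp)) (fun j hj _ => h0 j hj)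

theorem van_link {W : Submodule ℝ (V → ℝ)} {X A : Finset V} (hP : Poly W X) {v : V}
    (hA : Fc W X A) (hv : v ∈ A) : van (van W {v}) (A ∩ nb W X v) = van W A := by
  ext w
  constructor
  · rintro ⟨⟨hw, hwv⟩, h⟩
    exact ⟨hw, hP.neighbor_zero hA hv hw (hwv v (by simp))
      (fun j hj hjA => h j (Finset.mem_inter.2 ⟨hjA, hj⟩))⟩
  · rintro ⟨hw, h⟩
    exact ⟨⟨hw, fun x hx => h x (by simp at hx; simpa [hx] using hv)⟩,
      fun x hx => h x (Finset.mem_inter.1 hx).1⟩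

theorem fc_link_of {W : Submodule ℝ (V → ℝ)} {X A : Finset V} {v : V}
    (hA : Fc W X A) (hv : v ∈ A) : Fc (van W {v}) (nb W X v) (A ∩ nb W X v) := by
  obtain ⟨l, hl, l0, l1, l2⟩ := hA.pos
  refine Fc.mk' Finset.inter_subset_right l ⟨hl, fun x hx => l1 x (by simp at hx; simpa [hx] using hv)⟩
    (fun x hx => l1 x (Finset.mem_inter.1 hx).1) ?_
  intro x hx hxA
  exact l2 x (mem_nb.1 hx).1 (fun h => hxA (Finset.mem_inter.2 ⟨h, hx⟩))

theorem fc_link_iff {W : Submodule ℝ (V → ℝ)} {X B : Finset V} (hP : Poly W X) {v : V}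
    (hv : v ∈ X) : Fc (van W {v}) (nb W X v) B ↔
      ∃ A, v ∈ A ∧ Fc W X A ∧ B = A ∩ nb W X v := by
  constructor
  · intro h
    obtain ⟨l, hl, l0, l1, l2⟩ := h.pos
    have h0 := hP.neighbor hv hl.1 (hl.2 v (by simp)) l0
    refine ⟨X.filter (fun x => l x = 0), ?_, ⟨Finset.filter_subset _ _, l, hl.1, h0, ?_⟩, ?_⟩
    · simp [hv, hl.2 v]
    · intro x hx; simp [hx]
    · ext x
      simp only [Finset.mem_inter, Finset.mem_filter]
      constructor
      · intro hx
        exact ⟨⟨(mem_nb.1 (h.1 hx)).1, l1 x hx⟩, h.1 hx⟩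
      · rintro ⟨⟨hx, hlx⟩, hxn⟩
        by_contra hxB
        exact (l2 x hxn hxB).ne' hlx
  · rintro ⟨A, hvA, hA, rfl⟩
    exact fc_link_of hA hvA

theorem link_inj {W : Submodule ℝ (V → ℝ)} {X A A' : Finset V} (hP : Poly W X) {v : V}
    (hA : Fc W X A) (hv : v ∈ A) (hA' : Fc W X A') (hv' : v ∈ A')
    (h : A ∩ nb W X v = A' ∩ nb W X v) : A = A' := by
  apply hA.eq_of_van hA'
  rw [← van_link hP hA hv, ← van_link hP hA' hv', h]

end Core

section Core2
open scoped Classical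
set_option linter.all false
variable {V : Type} [Fintype V]

theorem exists_coef {ι M : Type} [Fintype ι] [AddCommGroup M] [Module ℝ M] (T : M →ₗ[ℝ] (ι → ℝ))
    (h : LinearMap.range T ≠ ⊤) : ∃ c : ι → ℝ, c ≠ 0 ∧ ∀ m, ∑ i, c i * T m i = 0 := by
  obtain ⟨f, hf, hle⟩ := Submodule.exists_le_ker_of_lt_top _ (lt_top_iff_ne_top.2 h)
  have key : ∀ x : ι → ℝ, f x = ∑ i, f (Pi.single i 1) * x i := by
    intro x
    conv_lhs => rw [LinearMap.pi_apply_eq_sum_univ f x]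
    refine Finset.sum_congr rfl (fun i _ => ?_)
    rw [smul_eq_mul, mul_comm]
    congr 2
    funext j
    simp [Pi.single_apply, eq_comm]
  refine ⟨fun i => f (Pi.single i 1), ?_, ?_⟩
  · intro h0
    apply hf
    ext x
    have : ∀ i, f (Pi.single i 1) = 0 := fun i => congrFun h0 i
    simp [this]
  · intro m
    rw [← key]
    exact hle ⟨m, rfl⟩

/-- restriction -/
def resL (W : Submodule ℝ (V → ℝ)) (A : Finset V) : W →ₗ[ℝ] (A → ℝ) where
  toFun w := fun a => w.1 a
  map_add' := fun _ _ => rfl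
  map_smul' := fun _ _ => rfl

theorem finrank_van_eq (W : Submodule ℝ (V → ℝ)) (A : Finset V) :
    Module.finrank ℝ (van W A) = Module.finrank ℝ (LinearMap.ker (resL W A)) := by
  have : (LinearMap.ker (resL W A)).map W.subtype = van W A := by
    ext w
    simp only [Submodule.mem_map, LinearMap.mem_ker, Submodule.subtype_apply]
    constructor
    · rintro ⟨y, hy, rfl⟩
      exact ⟨y.2, fun x hx => congrFun hy ⟨x, hx⟩⟩
    · rintro ⟨hw, h⟩
      exact ⟨⟨w, hw⟩, funext fun x => h x x.2, rfl⟩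
  rw [← this]
  exact Submodule.finrank_map_subtype_eq _ _

theorem finrank_van_add (W : Submodule ℝ (V → ℝ)) (A : Finset V) :
    Module.finrank ℝ (LinearMap.range (resL W A)) + Module.finrank ℝ (van W A)
      = Module.finrank ℝ W := by
  rw [finrank_van_eq]; exact LinearMap.finrank_range_add_finrank_ker _

def Ind (W : Submodule ℝ (V → ℝ)) (A : Finset V) : Prop :=
  ∀ c : V → ℝ, (∀ w ∈ W, ∑ x ∈ A, c x * w x = 0) → ∀ x ∈ A, c x = 0

theorem Ind.surj {W : Submodule ℝ (V → ℝ)} {A : Finset V} (h : Ind W A) :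
    LinearMap.range (resL W A) = ⊤ := by
  by_contra hne
  obtain ⟨c, hc, h0⟩ := exists_coef _ hne
  apply hc
  have := h (fun x => if hx : x ∈ A then c ⟨x, hx⟩ else 0) (by
    intro w hw
    rw [← h0 ⟨w, hw⟩, ← Finset.sum_coe_sort]
    refine Finset.sum_congr rfl (fun i _ => ?_)
    simp [resL])
  funext i
  have := this i i.2
  simpa using this

theorem Ind.finrank {W : Submodule ℝ (V → ℝ)} {A : Finset V} (h : Ind W A) :
    Module.finrank ℝ (van W A) + A.card = Module.finrank ℝ W := by
  rw [← finrank_van_add W A, h.surj, finrank_top, Module.finrank_fintype_fun_eq_card,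
    Fintype.card_coe, add_comm]

theorem Ind.interp {W : Submodule ℝ (V → ℝ)} {A : Finset V} (h : Ind W A) (g : V → ℝ) :
    ∃ w ∈ W, ∀ x ∈ A, w x = g x := by
  have : (fun x : A => g x) ∈ LinearMap.range (resL W A) := by rw [h.surj]; trivial
  obtain ⟨w, hw⟩ := this
  exact ⟨w.1, w.2, fun x hx => congrFun hw ⟨x, hx⟩⟩

theorem finrank_le_card (W : Submodule ℝ (V → ℝ)) (A : Finset V) :
    Module.finrank ℝ W ≤ Module.finrank ℝ (van W A) + A.card := by
  rw [← finrank_van_add W A, add_comm]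
  have := Submodule.finrank_le (LinearMap.range (resL W A))
  rw [Module.finrank_fintype_fun_eq_card, Fintype.card_coe] at this
  omega

theorem ind_of_finrank {W : Submodule ℝ (V → ℝ)} {A : Finset V}
    (h : Module.finrank ℝ (van W A) + A.card = Module.finrank ℝ W) : Ind W A := by
  have hs : LinearMap.range (resL W A) = ⊤ := by
    apply Submodule.eq_top_of_finrank_eq
    rw [Module.finrank_fintype_fun_eq_card, Fintype.card_coe]
    have := finrank_van_add W A
    omega
  intro c hc x hx
  have : (Pi.single ⟨x, hx⟩ 1 : A → ℝ) ∈ LinearMap.range (resL W A) := by rw [hs]; trivial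
  obtain ⟨w, hw⟩ := this
  have h1 := hc w.1 w.2
  have h2 : ∀ y ∈ A, w.1 y = if y = x then 1 else 0 := by
    intro y hy
    have := congrFun hw ⟨y, hy⟩
    simp only [resL, LinearMap.coe_mk, AddHom.coe_mk] at this
    rw [this, Pi.single_apply]
    simp
  rw [Finset.sum_congr rfl (fun y hy => by rw [h2 y hy])] at h1
  simpa [hx] using h1

theorem Ind.mono {W : Submodule ℝ (V → ℝ)} {A B : Finset V} (h : Ind W A) (hB : B ⊆ A) :
    Ind W B := by
  intro c hc x hx
  have := h (fun y => if y ∈ B then c y else 0) (by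
    intro w hw
    refine Eq.trans ?_ (hc w hw)
    simp only [ite_mul, zero_mul]
    rw [← Finset.sum_filter]
    congr 1
    ext y
    simp only [Finset.mem_filter]
    exact ⟨fun h => h.2, fun h => ⟨hB h, h⟩⟩) x (hB hx)
  simpa [hx] using this

theorem tri {a b c p q r s t u : ℝ} (hp : 0 < p) (hq : 0 < q) (hr : 0 < r) (hs : 0 < s)
    (ht : 0 < t) (hu : 0 < u) (h1 : b * p + c * q = 0) (h2 : a * r + c * s = 0)
    (h3 : a * t + b * u = 0) : a = 0 ∧ b = 0 ∧ c = 0 := by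
  have ha : a = 0 := by
    rcases lt_trichotomy a 0 with h | h | h
    · have : 0 < c := by by_contra hc; nlinarith [mul_neg_of_neg_of_pos h hr]
      have : 0 < b := by by_contra hc; nlinarith [mul_neg_of_neg_of_pos h ht]
      nlinarith [mul_pos ‹0 < c› hq, mul_pos ‹0 < b› hp]
    · exact h
    · have : c < 0 := by by_contra hc; nlinarith [mul_pos h hr]
      have : b < 0 := by by_contra hc; nlinarith [mul_pos h ht]
      nlinarith [mul_neg_of_neg_of_pos ‹c < 0› hq, mul_neg_of_neg_of_pos ‹b < 0› hp]
  subst ha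
  simp only [zero_mul, zero_add] at h2 h3
  exact ⟨rfl, (mul_eq_zero.1 h3).resolve_right hu.ne', (mul_eq_zero.1 h2).resolve_right hs.ne'⟩

theorem Poly.ind3 {W : Submodule ℝ (V → ℝ)} {X S : Finset V} (hP : Poly W X) (hS : S ⊆ X)
    (hc : S.card ≤ 3) : Ind W S := by
  have vf : ∀ x ∈ X, ∃ l ∈ W, l x = 0 ∧ ∀ y ∈ X, y ≠ x → 0 < l y := by
    intro x hx
    obtain ⟨l, hl, l0, l1, l2⟩ := (hP.vx x hx).pos
    exact ⟨l, hl, l1 x (by simp), fun y hy hyx => l2 y hy (by simpa using hyx)⟩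
  obtain ⟨l, hl, -, -, l2⟩ := hP.pt.pos
  intro c hc0
  have hcases : S.card = 0 ∨ S.card = 1 ∨ S.card = 2 ∨ S.card = 3 := by omega
  rcases hcases with h | h | h | h
  · rw [Finset.card_eq_zero] at h; subst h; simp
  · obtain ⟨x, rfl⟩ := Finset.card_eq_one.1 h
    have := hc0 l hl
    have hx := l2 x (hS (by simp)) (by simp)
    simp at this ⊢
    exact this.resolve_right hx.ne'
  · obtain ⟨x, y, hxy, rfl⟩ := Finset.card_eq_two.1 h
    have hx : x ∈ X := hS (by simp)
    have hy : y ∈ X := hS (by simp)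
    obtain ⟨l1, m1, a1, b1⟩ := vf x hx
    obtain ⟨l2, m2, a2, b2⟩ := vf y hy
    have e1 := hc0 l1 m1
    have e2 := hc0 l2 m2
    rw [Finset.sum_pair hxy] at e1 e2
    simp only [a1, a2, mul_zero, zero_add, add_zero] at e1 e2
    have := b1 y hy hxy.symm
    have := b2 x hx hxy
    intro z hz
    simp at hz
    rcases hz with rfl | rfl
    · exact (mul_eq_zero.1 e2).resolve_right this.ne'
    · exact (mul_eq_zero.1 e1).resolve_right (b1 _ hy hxy.symm).ne'
  · obtain ⟨x, y, z, hxy, hxz, hyz, rfl⟩ := Finset.card_eq_three.1 h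
    have hx : x ∈ X := hS (by simp)
    have hy : y ∈ X := hS (by simp)
    have hz : z ∈ X := hS (by simp)
    obtain ⟨l1, m1, a1, b1⟩ := vf x hx
    obtain ⟨l2, m2, a2, b2⟩ := vf y hy
    obtain ⟨l3, m3, a3, b3⟩ := vf z hz
    have e1 := hc0 l1 m1
    have e2 := hc0 l2 m2
    have e3 := hc0 l3 m3
    have hs : ∀ g : V → ℝ, ∑ w ∈ ({x, y, z} : Finset V), g w = g x + g y + g z := by
      intro g
      rw [Finset.sum_insert (by simp [hxy, hxz]), Finset.sum_pair hyz]; ring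
    rw [hs] at e1 e2 e3
    simp only [a1, a2, a3, mul_zero, zero_add, add_zero] at e1 e2 e3
    obtain ⟨r1, r2, r3⟩ := tri (b1 y hy hxy.symm) (b1 z hz hxz.symm) (b2 x hx hxy)
      (b2 z hz hyz.symm) (b3 x hx hxz) (b3 y hy hyz) e1 e2 e3
    intro w hw
    simp at hw
    rcases hw with rfl | rfl | rfl <;> assumption

theorem Poly.finrank_van1 {W : Submodule ℝ (V → ℝ)} {X : Finset V} (hP : Poly W X) {v : V}
    (hv : v ∈ X) : Module.finrank ℝ (van W {v}) + 1 = Module.finrank ℝ W := by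
  have := (hP.ind3 (S := {v}) (by simpa using hv) (by simp)).finrank
  simpa using this

theorem Poly.finrank_van2 {W : Submodule ℝ (V → ℝ)} {X : Finset V} (hP : Poly W X) {v j : V}
    (hv : v ∈ X) (hj : j ∈ X) (hne : v ≠ j) :
    Module.finrank ℝ (van W {v, j}) + 2 = Module.finrank ℝ W := by
  have hc : ({v, j} : Finset V).card = 2 := Finset.card_pair hne
  have := (hP.ind3 (S := {v, j}) (by intro x hx; simp at hx; rcases hx with rfl | rfl <;> assumption)
    (by omega)).finrank
  rwa [hc] at this

def Fct (W : Submodule ℝ (V → ℝ)) (X G : Finset V) : Prop :=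
  Fc W X G ∧ Module.finrank ℝ (van W G) = 1

theorem Fct.ne {W : Submodule ℝ (V → ℝ)} {X G : Finset V} (hP : Poly W X) (h : Fct W X G) :
    G ≠ X := by
  rintro rfl
  have : van W G = ⊥ := by
    rw [eq_bot_iff]
    intro w hw
    exact hP.inj w hw.1 hw.2
  have h2 := h.2
  rw [this, finrank_bot] at h2
  omega

/-- the facet functional -/
theorem Fct.fn {W : Submodule ℝ (V → ℝ)} {X G : Finset V} (hP : Poly W X) (h : Fct W X G) :
    ∃ l ∈ W, (∀ x ∈ X, 0 ≤ l x) ∧ (∀ x ∈ G, l x = 0) ∧ (∀ x ∈ X, x ∉ G → 0 < l x) ∧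
      ∀ w ∈ van W G, ∃ c : ℝ, w = c • l := by
  obtain ⟨l, hl, l0, l1, l2⟩ := h.1.pos
  refine ⟨l, hl, l0, l1, l2, fun w hw => ?_⟩
  obtain ⟨x, hx, hxG⟩ : ∃ x ∈ X, x ∉ G := by
    by_contra hcon
    push Not at hcon
    exact h.ne hP (Finset.Subset.antisymm h.1.1 hcon)
  have hne : (⟨l, hl, l1⟩ : van W G) ≠ 0 := by
    intro h0
    have := l2 x hx hxG
    have h3 : l = 0 := congrArg Subtype.val h0
    rw [h3] at this; simp at this
  obtain ⟨c, hc⟩ := (finrank_eq_one_iff_of_nonzero' _ hne).1 h.2 ⟨w, hw⟩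
  exact ⟨c, (congrArg Subtype.val hc).symm⟩

theorem Fct.eq_of_sub {W : Submodule ℝ (V → ℝ)} {X G G' : Finset V} (h : Fct W X G)
    (h' : Fct W X G') (hs : G ⊆ G') : G = G' := by
  apply h.1.eq_of_van h'.1
  exact (Submodule.eq_of_le_of_finrank_eq (van_anti hs) (by rw [h.2, h'.2])).symm

theorem ratioFace {W : Submodule ℝ (V → ℝ)} {X A : Finset V} {u w : V → ℝ} (hA : A ⊆ X)
    (hAX : A ≠ X) (hu : u ∈ W) (u1 : ∀ x ∈ A, u x = 0) (u2 : ∀ x ∈ X, x ∉ A → 0 < u x)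
    (hw : w ∈ van W A) : ∃ m : ℝ, (∀ x ∈ X, m * u x ≤ w x) ∧ (∃ x ∈ X, x ∉ A ∧ w x = m * u x) ∧
      A ⊆ X.filter (fun x => w x = m * u x) ∧ Fc W X (X.filter (fun x => w x = m * u x)) := by
  have hne : (X \ A).Nonempty := by
    rw [Finset.sdiff_nonempty]
    exact fun h => hAX (Finset.Subset.antisymm hA h)
  obtain ⟨m, ⟨x, hx, hxm⟩, hm⟩ := exists_min_ratio (X \ A) hne w u
    (fun x hx => u2 x (Finset.mem_sdiff.1 hx).1 (Finset.mem_sdiff.1 hx).2)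
  have hm' : ∀ x ∈ X, m * u x ≤ w x := by
    intro x hx
    by_cases hxA : x ∈ A
    · simp [u1 x hxA, hw.2 x hxA]
    · exact hm x (Finset.mem_sdiff.2 ⟨hx, hxA⟩)
  refine ⟨m, hm', ⟨x, (Finset.mem_sdiff.1 hx).1, (Finset.mem_sdiff.1 hx).2, hxm⟩, ?_, ?_⟩
  · intro y hy
    simp [hA hy, u1 y hy, hw.2 y hy]
  · refine Fc.mk' (Finset.filter_subset _ _) (w - m • u) (W.sub_mem hw.1 (W.smul_mem _ hu)) ?_ ?_
    · intro y hy
      rw [Finset.mem_filter] at hy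
      simp [hy.2]
    · intro y hy hyn
      have h1 : w y ≠ m * u y := fun h => hyn (Finset.mem_filter.2 ⟨hy, h⟩)
      have h2 := lt_of_le_of_ne (hm' y hy) h1.symm
      simp; linarith

theorem exists_notMem_span {S : Submodule ℝ (V → ℝ)} (u : V → ℝ) (h : 2 ≤ Module.finrank ℝ S) :
    ∃ w ∈ S, ∀ c : ℝ, w ≠ c • u := by
  by_contra hcon
  push Not at hcon
  have : S ≤ Submodule.span ℝ {u} := by
    intro w hw
    obtain ⟨c, hc⟩ := hcon w hw
    rw [Submodule.mem_span_singleton]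
    exact ⟨c, hc.symm⟩
  have h1 := Submodule.finrank_mono this
  have h2 := finrank_span_le_card (R := ℝ) ({u} : Set (V → ℝ))
  simp at h2
  omega

theorem span2 {S : Submodule ℝ (V → ℝ)} {u w : V → ℝ} (h : Module.finrank ℝ S = 2) (hu : u ∈ S)
    (hw : w ∈ S) (hu0 : u ≠ 0) (hne : ∀ c : ℝ, w ≠ c • u) : ∀ g ∈ S, ∃ a b : ℝ, g = a • u + b • w := by
  have h1 : Submodule.span ℝ {u} < Submodule.span ℝ {u, w} := by
    refine lt_of_le_of_ne (Submodule.span_mono (by simp)) ?_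
    intro heq
    have : w ∈ Submodule.span ℝ {u} := by rw [heq]; exact Submodule.subset_span (by simp)
    obtain ⟨c, hc⟩ := Submodule.mem_span_singleton.1 this
    exact hne c hc.symm
  have h2 : Submodule.span ℝ {u, w} ≤ S := by
    rw [Submodule.span_le]
    rintro x (rfl | rfl) <;> assumption
  have h3 := Submodule.finrank_lt_finrank_of_lt h1
  rw [finrank_span_singleton hu0] at h3
  have h4 := Submodule.finrank_mono h2
  have h5 := Submodule.eq_of_le_of_finrank_eq h2 (by omega)
  intro g hg
  rw [← h5, Submodule.mem_span_pair] at hg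
  obtain ⟨a, b, hab⟩ := hg
  exact ⟨a, b, hab.symm⟩

theorem Poly.exists_facet {W : Submodule ℝ (V → ℝ)} {X A : Finset V} (hP : Poly W X)
    (hA : Fc W X A) (hAX : A ≠ X) : ∃ G, A ⊆ G ∧ Fct W X G := by
  obtain ⟨G, hG, hmax⟩ := Finset.exists_max_image
    (X.powerset.filter (fun G => A ⊆ G ∧ Fc W X G ∧ G ≠ X)) Finset.card
    ⟨A, by simp [hA.1, hA, hAX]⟩
  obtain ⟨hGX, hAG, hGF, hGne⟩ := Finset.mem_filter.1 hG
  refine ⟨G, hAG, hGF, ?_⟩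
  obtain ⟨u, hu, u0, u1, u2⟩ := hGF.pos
  obtain ⟨x, hx, hxG⟩ : ∃ x ∈ X, x ∉ G := by
    by_contra hcon
    push Not at hcon
    exact hGne (Finset.Subset.antisymm hGF.1 hcon)
  have hun : u ≠ 0 := by
    intro h; have := u2 x hx hxG; simp [h] at this
  have h1 : 1 ≤ Module.finrank ℝ (van W G) := by
    have : Nontrivial (van W G) := ⟨⟨⟨u, hu, u1⟩, 0, fun h => hun (congrArg Subtype.val h)⟩⟩
    exact Module.finrank_pos
  by_contra hne
  obtain ⟨w, hw, hwc⟩ := exists_notMem_span u (S := van W G) (by omega)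
  obtain ⟨m, hm, ⟨y, hy, hyG, hym⟩, hsub, hF⟩ := ratioFace hGF.1 hGne hu u1 u2 hw
  have := hmax _ (Finset.mem_filter.2 ⟨Finset.mem_powerset.2 hF.1, hAG.trans hsub, hF, ?_⟩)
  · have heq := Finset.eq_of_subset_of_card_le hsub this
    exact hyG (by rw [heq]; simp [hy, hym])
  · intro heq
    apply hwc m
    have := hP.inj (w - m • u) (W.sub_mem hw.1 (W.smul_mem _ hu)) (by
      intro z hz
      rw [← heq] at hz
      simp [(Finset.mem_filter.1 hz).2])
    exact sub_eq_zero.1 this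

theorem Poly.exists_facet_ne {W : Submodule ℝ (V → ℝ)} {X A F : Finset V} (hP : Poly W X)
    (hA : Fc W X A) (hAX : A ≠ X) (hF : Fct W X F) (hAF : A ≠ F) :
    ∃ G, A ⊆ G ∧ Fct W X G ∧ G ≠ F := by
  by_cases hsub : A ⊆ F
  · obtain ⟨u, hu, u0, u1, u2⟩ := hA.pos
    obtain ⟨l, hl, l0, l1, l2⟩ := hF.1.pos
    obtain ⟨m, hm, ⟨y, hy, hyG, hym⟩, hsub', hF'⟩ := ratioFace hA.1 hAX hu u1 u2
      (w := -l) ⟨W.neg_mem hl, fun x hx => by simp [l1 x (hsub hx)]⟩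
    obtain ⟨x, hx, hxF⟩ : ∃ x ∈ X, x ∉ F := by
      by_contra hcon
      push Not at hcon
      exact hF.ne hP (Finset.Subset.antisymm hF.1.1 hcon)
    obtain ⟨z, hz, hzA⟩ : ∃ z ∈ F, z ∉ A := by
      by_contra hcon
      push Not at hcon
      exact hAF (Finset.Subset.antisymm hsub hcon)
    have hmneg : m < 0 := by
      have h1 := hm x hx
      have h2 := l2 x hx hxF
      have h3 := u2 x hx (fun h => hxF (hsub h))
      simp at h1
      by_contra hm0
      nlinarith
    obtain ⟨G, hG, hG'⟩ := hP.exists_facet hF' (by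
      intro h
      rw [← h] at hF
      have := hF.1.1 hz
      have := (Finset.mem_filter.1 this).2
      have h3 := u2 z (hF'.1 (hF.1.1 hz)) hzA
      simp [l1 z hz] at this
      rcases this with h | h
      · exact hmneg.ne h
      · exact h3.ne' h)
    refine ⟨G, hsub'.trans hG, hG', ?_⟩
    rintro rfl
    have h3 := l1 y (hG (by simp [hy]; simpa using hym))
    have h4 := u2 y hy hyG
    simp [h3] at hym
    rcases hym with h | h
    · exact hmneg.ne h
    · exact h4.ne' h
  · obtain ⟨G, hG, hG'⟩ := hP.exists_facet hA hAX
    exact ⟨G, hG, hG', by rintro rfl; exact hsub hG⟩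

theorem Poly.two_facets {W : Submodule ℝ (V → ℝ)} {X A : Finset V} (hP : Poly W X)
    (hA : Fc W X A) (h2 : Module.finrank ℝ (van W A) = 2) :
    ∃ G1 G2, G1 ≠ G2 ∧ ∀ G, (A ⊆ G ∧ Fct W X G) ↔ (G = G1 ∨ G = G2) := by
  have hAX : A ≠ X := by
    rintro rfl
    have : van W A = ⊥ := by
      rw [eq_bot_iff]
      intro w hw
      exact hP.inj w hw.1 hw.2
    rw [this, finrank_bot] at h2
    omega
  have hnf : ¬ Fct W X A := fun h => by have := h.2; omega
  obtain ⟨G1, hG1, hG1'⟩ := hP.exists_facet hA hAX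
  obtain ⟨G2, hG2, hG2', hne⟩ := hP.exists_facet_ne hA hAX hG1' (by rintro rfl; exact hnf hG1')
  refine ⟨G1, G2, hne.symm, fun G => ⟨?_, by rintro (rfl | rfl) <;> exact ⟨by assumption, by assumption⟩⟩⟩
  rintro ⟨hG, hG'⟩
  -- two facets above A meet in A
  have meet : ∀ G G', A ⊆ G → Fct W X G → A ⊆ G' → Fct W X G' → G ≠ G' → ∀ x ∈ G, x ∈ G' → x ∈ A := by
    intro G G' hG hGF hG' hGF' hne x hx hx'
    by_contra hxA
    obtain ⟨u, hu, u0, u1, u2⟩ := hA.pos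
    obtain ⟨l, hl, l0, l1, l2, l3⟩ := hGF.fn hP
    obtain ⟨l', hl', l0', l1', l2', l3'⟩ := hGF'.fn hP
    have hxX := hGF.1.1 hx
    have hux := u2 x hxX hxA
    have hl0 : l ≠ 0 := by
      rintro rfl
      exact hGF.ne hP (Finset.Subset.antisymm hGF.1.1 (fun y hy => by
        by_contra hyG; simpa using l2 y hy hyG))
    have hs := span2 h2 (u := l) (w := u) ⟨hl, fun y hy => l1 y (hG hy)⟩ ⟨hu, u1⟩ hl0 (by
      rintro c rfl
      simp [l1 x hx] at hux) l' ⟨hl', fun y hy => l1' y (hG' hy)⟩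
    obtain ⟨a, b, hab⟩ := hs
    have : b = 0 := by
      have := congrFun hab x
      simp [l1 x hx, l1' x hx'] at this
      exact this.resolve_right hux.ne'
    subst this
    apply hne
    apply hGF.eq_of_sub hGF'
    intro y hy
    by_contra hyG
    have := l2' y (hGF.1.1 hy) hyG
    rw [hab] at this
    simp [l1 y hy] at this
  by_contra hcon
  push Not at hcon
  obtain ⟨l, hl, l0, l1, l2, l3⟩ := hG'.fn hP
  obtain ⟨k, hk, k0, k1, k2, k3⟩ := hG1'.fn hP
  obtain ⟨j, hj, j0, j1, j2, j3⟩ := hG2'.fn hP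
  have pick : ∀ G, A ⊆ G → Fct W X G → ∃ x ∈ G, x ∉ A := by
    intro G hG hGF
    by_contra h
    push Not at h
    have := Finset.Subset.antisymm hG h
    rw [← this] at hGF
    exact hnf hGF
  obtain ⟨x, hx, hxA⟩ := pick G hG hG'
  obtain ⟨y, hy, hyA⟩ := pick G1 hG1 hG1'
  obtain ⟨z, hz, hzA⟩ := pick G2 hG2 hG2'
  have nx1 : x ∉ G1 := fun h => hxA (meet G G1 hG hG' hG1 hG1' hcon.1 x hx h)
  have nx2 : x ∉ G2 := fun h => hxA (meet G G2 hG hG' hG2 hG2' hcon.2 x hx h)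
  have ny : y ∉ G := fun h => hyA (meet G G1 hG hG' hG1 hG1' hcon.1 y h hy)
  have ny2 : y ∉ G2 := fun h => hyA (meet G1 G2 hG1 hG1' hG2 hG2' hne.symm y hy h)
  have nz : z ∉ G := fun h => hzA (meet G G2 hG hG' hG2 hG2' hcon.2 z h hz)
  have nz1 : z ∉ G1 := fun h => hzA (meet G1 G2 hG1 hG1' hG2 hG2' hne.symm z h hz)
  have xX := hG'.1.1 hx
  have yX := hG1'.1.1 hy
  have zX := hG2'.1.1 hz
  have hl0 : l ≠ 0 := by rintro rfl; simpa using l2 y yX ny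
  obtain ⟨a, b, hab⟩ := span2 h2 (u := l) (w := k) ⟨hl, fun y hy => l1 y (hG hy)⟩
    ⟨hk, fun y hy => k1 y (hG1 hy)⟩ hl0 (by
      rintro c rfl
      have := k2 x xX nx1
      simp [l1 x hx] at this) j ⟨hj, fun y hy => j1 y (hG2 hy)⟩
  have ex := congrFun hab x
  have ey := congrFun hab y
  have ez := congrFun hab z
  simp [l1 x hx] at ex
  simp [k1 y hy] at ey
  simp [j1 z hz] at ez
  have p1 := j2 x xX nx2
  have p2 := j2 y yX ny2
  have p3 := l2 z zX nz
  have p4 := k2 z zX nz1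
  have p5 := l2 y yX ny
  have p6 := k2 x xX nx1
  have : 0 < b := by by_contra h; nlinarith
  have : 0 < a := by by_contra h; nlinarith
  nlinarith [mul_pos ‹0 < b› p4, mul_pos ‹0 < a› p3]

theorem Fc.of_ind {W : Submodule ℝ (V → ℝ)} {X G B : Finset V} (hG : Fc W X G) (hI : Ind W G)
    (hB : B ⊆ G) : Fc W X B := by
  obtain ⟨w, hw, h⟩ := hI.interp (fun x => if x ∈ B then 0 else 1)
  exact hG.sub hB w hw (fun x hx => by simp [h x (hB hx), hx])
    (fun x hx hxB => by simp [h x hx, hxB])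

/-- Connectivity of the graph of vertices not on `F`. -/
theorem Poly.conn {W : Submodule ℝ (V → ℝ)} {X F : Finset V} (hP : Poly W X) (hF : Fc W X F)
    (R : V → Prop)
    (hR : ∀ x ∈ X, x ∉ F → ∀ j ∈ nb W X x, j ∉ F → (R x ↔ R j)) :
    ∀ x ∈ X, x ∉ F → ∀ z ∈ X, z ∉ F → (R x ↔ R z) := by
  intro x hx hxF z hz hzF
  obtain ⟨l, hl, l0, l1, l2⟩ := hF.pos
  obtain ⟨t, ht, t0, t1, t2⟩ := (hP.vx z hz).pos
  have tz := t1 z (by simp)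
  have lz := l2 z hz hzF
  by_contra hcon
  set B := X.filter (fun y => y ∉ F ∧ ¬ (R y ↔ R z)) with hB
  -- maximise l / (t + l)
  have upos : ∀ y ∈ B, 0 < t y + l y := by
    intro y hy
    rw [hB, Finset.mem_filter] at hy
    have := l2 y hy.1 hy.2.1
    have := t0 y hy.1
    linarith
  obtain ⟨m, ⟨y, hy, hym⟩, hmax⟩ := exists_min_ratio B ⟨x, by simp [hB, hx, hxF, hcon]⟩ (-l)
    (t + l) upos
  have hy' := Finset.mem_filter.1 (hB ▸ hy)
  obtain ⟨hyX, hyF, hyR⟩ := hy'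
  have hyz : y ≠ z := by rintro rfl; simp at hyR
  have ty := t2 y hyX (by simpa using hyz)
  have ly := l2 y hyX hyF
  simp only [Pi.neg_apply, Pi.add_apply] at hym hmax
  have hm1 : -1 < m := by by_contra h; nlinarith
  have hm0 : m < 0 := by by_contra h; nlinarith
  -- neighbour with larger ratio
  obtain ⟨j, hj, hjneg⟩ : ∃ j ∈ nb W X y, (-l - m • (t + l)) j < 0 := by
    by_contra h
    push Not at h
    have := hP.neighbor hyX (w := -l - m • (t + l))
      (W.sub_mem (W.neg_mem hl) (W.smul_mem _ (W.add_mem ht hl))) (by simp; linarith) h z hz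
    simp [tz] at this
    nlinarith
  have hjX := (mem_nb.1 hj).1
  simp at hjneg
  have hjF : j ∉ F := by
    intro h
    have := l1 j h
    have := t0 j hjX
    nlinarith
  have h1 := hR y hyX hyF j hj hjF
  have hjB : j ∈ B := by
    rw [hB, Finset.mem_filter]
    exact ⟨hjX, hjF, by rw [← h1]; exact hyR⟩
  have := hmax j hjB
  linarith

theorem Poly.nb_outside {W : Submodule ℝ (V → ℝ)} {X F : Finset V} (hP : Poly W X) (hF : Fc W X F)
    (hFX : F ≠ X) {x : V} (hx : x ∈ F) : ∃ j ∈ nb W X x, j ∉ F := by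
  obtain ⟨l, hl, l0, l1, l2⟩ := hF.pos
  by_contra h
  push Not at h
  have := hP.neighbor (hF.1 hx) (w := -l) (W.neg_mem hl) (by simp [l1 x hx]) (fun j hj => by
    simp [l1 j (h j hj)])
  apply hFX
  apply Finset.Subset.antisymm hF.1
  intro y hy
  by_contra hyF
  have h1 := this y hy
  have h2 := l2 y hy hyF
  simp at h1
  linarith

end Core2

section Core3
open scoped Classical
set_option linter.all false
variable {V : Type} [Fintype V]

def facets (W : Submodule ℝ (V → ℝ)) (X : Finset V) : Finset (Finset V) :=
  X.powerset.filter (Fct W X)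

theorem mem_facets {W : Submodule ℝ (V → ℝ)} {X G : Finset V} : G ∈ facets W X ↔ Fct W X G := by
  simp only [facets, Finset.mem_filter, Finset.mem_powerset]
  exact ⟨fun h => h.2, fun h => ⟨h.1.1, h⟩⟩

def chg (σ : V → Prop) (g : Finset V) : Prop := ∃ j ∈ g, ∃ k ∈ g, σ j ∧ ¬ σ k

theorem not_chg {σ : V → Prop} {g : Finset V} : ¬ chg σ g ↔ ∀ j ∈ g, ∀ k ∈ g, (σ j ↔ σ k) := by
  unfold chg
  push Not
  constructor
  · intro h j hj k hk
    exact ⟨h j hj k hk, h k hk j hj⟩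
  · intro h j hj k hk
    exact (h j hj k hk).1

theorem Poly.fct2 {W : Submodule ℝ (V → ℝ)} {X g : Finset V} (hP : Poly W X)
    (h3 : Module.finrank ℝ W = 3) (hg : Fct W X g) : g.card = 2 := by
  have h1 := hg.2
  by_cases hc : g.card ≤ 3
  · have := (hP.ind3 hg.1.1 hc).finrank
    omega
  · obtain ⟨S, hS, hSc⟩ := Finset.exists_subset_card_eq (s := g) (n := 3) (by omega)
    have h2 := (hP.ind3 (hS.trans hg.1.1) hSc.le).finrank
    have h3 := Submodule.finrank_mono (van_anti (W := W) hS)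
    omega

theorem Poly.deg2 {W : Submodule ℝ (V → ℝ)} {X : Finset V} (hP : Poly W X)
    (h3 : Module.finrank ℝ W = 3) {j : V} (hj : j ∈ X) :
    ((facets W X).filter (fun g => j ∈ g)).card = 2 := by
  obtain ⟨G1, G2, hne, h⟩ := hP.two_facets (hP.vx j hj) (by have := hP.finrank_van1 hj; omega)
  have : (facets W X).filter (fun g => j ∈ g) = {G1, G2} := by
    ext g
    simp only [Finset.mem_filter, mem_facets, Finset.mem_insert, Finset.mem_singleton]
    rw [← h g]
    simp [and_comm]
  rw [this, Finset.card_pair hne]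

theorem double_count (S : Finset (Finset V)) (Y : Finset V) (hS : ∀ g ∈ S, g ⊆ Y) (p : V → Finset V → Prop) :
    ∑ g ∈ S, (g.filter (fun j => p j g)).card
      = ∑ j ∈ Y, (S.filter (fun g => j ∈ g ∧ p j g)).card := by
  have := Finset.sum_card_bipartiteAbove_eq_sum_card_bipartiteBelow (s := S) (t := Y)
    (fun g j => j ∈ g ∧ p j g)
  refine Eq.trans ?_ this
  refine Finset.sum_congr rfl (fun g hg => ?_)
  congr 1
  ext j
  simp only [Finset.mem_filter, Finset.bipartiteAbove]
  exact ⟨fun h => ⟨hS g hg h.1, h⟩, fun h => h.2⟩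

theorem Poly.chg_even {W : Submodule ℝ (V → ℝ)} {X : Finset V} (hP : Poly W X)
    (h3 : Module.finrank ℝ W = 3) (σ : V → Prop) :
    Even ((facets W X).filter (chg σ)).card := by
  have h1 := double_count (facets W X) X (fun g hg => (mem_facets.1 hg).1.1) (fun j _ => σ j)
  have h2 : Even (∑ g ∈ facets W X, (g.filter σ).card) := by
    rw [h1]
    refine Finset.even_sum _ (fun j hj => ?_)
    by_cases hσ : σ j
    · simp only [hσ, and_true, hP.deg2 h3 hj]; decide
    · simp [hσ]
  rw [Finset.even_sum_iff_even_card_odd] at h2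
  convert h2 using 2
  refine Finset.filter_congr (fun g hg => ?_)
  have hc := hP.fct2 h3 (mem_facets.1 hg)
  obtain ⟨a, b, hab, rfl⟩ := Finset.card_eq_two.1 hc
  unfold chg
  by_cases ha : σ a <;> by_cases hb : σ b <;>
    simp [Finset.filter_insert, Finset.filter_singleton, ha, hb, hab] <;> decide

theorem Poly.conn2 {W : Submodule ℝ (V → ℝ)} {X : Finset V} (hP : Poly W X)
    (h3 : Module.finrank ℝ W = 3) (R : V → Prop)
    (hR : ∀ g, Fct W X g → ∀ j ∈ g, ∀ k ∈ g, (R j ↔ R k)) :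
    ∀ x ∈ X, ∀ z ∈ X, (R x ↔ R z) := by
  intro x hx z hz
  refine hP.conn hP.pt R ?_ x hx (by simp) z hz (by simp)
  intro x hx _ j hj _
  rw [mem_nb] at hj
  refine hR {x, j} ⟨hj.2.2, ?_⟩ x (by simp) j (by simp)
  have := hP.finrank_van2 hx hj.1 hj.2.1.symm
  omega

theorem Poly.card_facets3 {W : Submodule ℝ (V → ℝ)} {X : Finset V} (hP : Poly W X)
    (h3 : Module.finrank ℝ W = 3) : (facets W X).card = X.card := by
  have h1 := double_count (facets W X) X (fun g hg => (mem_facets.1 hg).1.1) (fun j _ => True)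
  simp only [and_true, Finset.filter_true] at h1
  rw [Finset.sum_congr rfl (fun g hg => hP.fct2 h3 (mem_facets.1 hg)),
    Finset.sum_congr rfl (fun j hj => hP.deg2 h3 hj)] at h1
  simp at h1
  exact h1

theorem tri_func {W : Submodule ℝ (V → ℝ)} (h3 : Module.finrank ℝ W = 3)
    (a b c : (V → ℝ) →ₗ[ℝ] ℝ) {p q r : V → ℝ} (hp : p ∈ W) (hq : q ∈ W) (hr : r ∈ W)
    (hap : a p = 0) (hbp : 0 < b p) (hcp : 0 < c p)
    (haq : 0 < a q) (hbq : b q = 0) (hcq : 0 < c q)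
    (har : 0 < a r) (hbr : 0 < b r) (hcr : c r = 0)
    {w : V → ℝ} (hw : w ∈ W) (hwa : a w = 0) (hwb : b w = 0) (hwc : c w = 0) : w = 0 := by
  let T : W →ₗ[ℝ] (Fin 3 → ℝ) := (LinearMap.pi ![a, b, c]) ∘ₗ W.subtype
  have hTs : LinearMap.range T = ⊤ := by
    by_contra hne
    obtain ⟨co, hco, h⟩ := exists_coef T hne
    have h' : ∀ w ∈ W, co 0 * a w + co 1 * b w + co 2 * c w = 0 := by
      intro w hw
      have := h ⟨w, hw⟩
      simpa [Fin.sum_univ_three, T] using this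
    have e1 := h' p hp
    have e2 := h' q hq
    have e3 := h' r hr
    rw [hap] at e1; rw [hbq] at e2; rw [hcr] at e3
    obtain ⟨h0, h1, h2⟩ := tri hbp hcp haq hcq har hbr (a := co 0) (b := co 1) (c := co 2)
      (by linarith) (by linarith) (by linarith)
    apply hco
    ext i
    fin_cases i <;> simp [h0, h1, h2]
  have hk : LinearMap.ker T = ⊥ := by
    have := LinearMap.finrank_range_add_finrank_ker T
    rw [hTs, finrank_top, h3] at this
    simp at this
    exact this
  have : (⟨w, hw⟩ : W) ∈ LinearMap.ker T := by
    rw [LinearMap.mem_ker]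
    ext i
    fin_cases i <;> simp [T, hwa, hwb, hwc]
  rw [hk, Submodule.mem_bot] at this
  simpa using congrArg Subtype.val this

/-- positive combination of evaluations at j,k -/
def ev2 (s t : ℝ) (j k : V) : (V → ℝ) →ₗ[ℝ] ℝ := s • LinearMap.proj j + t • LinearMap.proj k

theorem ev2_apply (s t : ℝ) (j k : V) (w : V → ℝ) : ev2 s t j k w = s * w j + t * w k := by
  simp [ev2]

theorem ev2_facet {W : Submodule ℝ (V → ℝ)} {X : Finset V} (hP : Poly W X)
    (h3 : Module.finrank ℝ W = 3) {g g' : Finset V} (hg : Fct W X g) (hg' : Fct W X g') (hne : g' ≠ g)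
    {j k : V} (hj : j ∈ g') (hk : k ∈ g') (hjk : j ≠ k) {s t : ℝ} (hs : 0 < s) (ht : 0 < t)
    {l : V → ℝ} (l0 : ∀ x ∈ X, 0 ≤ l x) (l2 : ∀ x ∈ X, x ∉ g → 0 < l x) : 0 < ev2 s t j k l := by
  rw [ev2_apply]
  have hg'e : g' = {j, k} := by
    symm
    apply Finset.eq_of_subset_of_card_le
    · intro x hx; simp at hx; rcases hx with rfl | rfl <;> assumption
    · rw [hP.fct2 h3 hg', Finset.card_pair hjk]
  have : ¬ (j ∈ g ∧ k ∈ g) := by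
    rintro ⟨h1, h2⟩
    apply hne
    apply hg'.eq_of_sub hg
    rw [hg'e]
    intro x hx; simp at hx; rcases hx with rfl | rfl <;> assumption
  have hjX := hg'.1.1 hj
  have hkX := hg'.1.1 hk
  by_cases hjg : j ∈ g
  · have := l2 k hkX (fun h => this ⟨hjg, h⟩)
    have := l0 j hjX
    positivity
  · have := l2 j hjX hjg
    have := l0 k hkX
    positivity

theorem Poly.cross_le {W : Submodule ℝ (V → ℝ)} {X : Finset V} (hP : Poly W X)
    (h3 : Module.finrank ℝ W = 3) {w : V → ℝ} (hw : w ∈ W) (hw0 : ∀ x ∈ X, w x ≠ 0) :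
    ((facets W X).filter (chg (fun x => 0 < w x))).card ≤ 2 := by
  by_contra hcon
  push Not at hcon
  obtain ⟨g1, g2, g3, h1, h2, h3', h12, h13, h23⟩ := Finset.two_lt_card_iff.1 hcon
  simp only [Finset.mem_filter, mem_facets] at h1 h2 h3'
  obtain ⟨f1, j1, hj1, k1, hk1, p1, q1⟩ := h1
  obtain ⟨f2, j2, hj2, k2, hk2, p2, q2⟩ := h2
  obtain ⟨f3, j3, hj3, k3, hk3, p3, q3⟩ := h3'
  have n1 : w k1 < 0 := lt_of_le_of_ne (not_lt.1 q1) (hw0 _ (f1.1.1 hk1))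
  have n2 : w k2 < 0 := lt_of_le_of_ne (not_lt.1 q2) (hw0 _ (f2.1.1 hk2))
  have n3 : w k3 < 0 := lt_of_le_of_ne (not_lt.1 q3) (hw0 _ (f3.1.1 hk3))
  obtain ⟨l1, hl1, a1, b1, c1⟩ := f1.1.pos
  obtain ⟨l2, hl2, a2, b2, c2⟩ := f2.1.pos
  obtain ⟨l3, hl3, a3, b3, c3⟩ := f3.1.pos
  have e1 : j1 ≠ k1 := by rintro rfl; exact q1 p1
  have e2 : j2 ≠ k2 := by rintro rfl; exact q2 p2
  have e3 : j3 ≠ k3 := by rintro rfl; exact q3 p3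
  have := tri_func h3 (ev2 (-w k1) (w j1) j1 k1) (ev2 (-w k2) (w j2) j2 k2) (ev2 (-w k3) (w j3) j3 k3)
    hl1 hl2 hl3
    (by rw [ev2_apply, b1 _ hj1, b1 _ hk1]; ring)
    (ev2_facet hP h3 f1 f2 h12.symm hj2 hk2 e2 (by linarith) p2 a1 c1)
    (ev2_facet hP h3 f1 f3 h13.symm hj3 hk3 e3 (by linarith) p3 a1 c1)
    (ev2_facet hP h3 f2 f1 h12 hj1 hk1 e1 (by linarith) p1 a2 c2)
    (by rw [ev2_apply, b2 _ hj2, b2 _ hk2]; ring)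
    (ev2_facet hP h3 f2 f3 h23.symm hj3 hk3 e3 (by linarith) p3 a2 c2)
    (ev2_facet hP h3 f3 f1 h13 hj1 hk1 e1 (by linarith) p1 a3 c3)
    (ev2_facet hP h3 f3 f2 h23 hj2 hk2 e2 (by linarith) p2 a3 c3)
    (by rw [ev2_apply, b3 _ hj3, b3 _ hk3]; ring)
    hw (by rw [ev2_apply]; ring) (by rw [ev2_apply]; ring) (by rw [ev2_apply]; ring)
  rw [this] at p1
  simp at p1

theorem Poly.cross_eq {W : Submodule ℝ (V → ℝ)} {X : Finset V} (hP : Poly W X)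
    (h3 : Module.finrank ℝ W = 3) {w : V → ℝ} (hw : w ∈ W) (hw0 : ∀ x ∈ X, w x ≠ 0)
    {a b : V} (ha : a ∈ X) (hb : b ∈ X) (hwa : 0 < w a) (hwb : w b < 0) :
    ((facets W X).filter (chg (fun x => 0 < w x))).card = 2 := by
  have h1 := hP.cross_le h3 hw hw0
  have h2 := hP.chg_even h3 (fun x => 0 < w x)
  have h0 : ((facets W X).filter (chg (fun x => 0 < w x))).card ≠ 0 := by
    intro h
    rw [Finset.card_eq_zero, Finset.filter_eq_empty_iff] at h
    have := hP.conn2 h3 (fun x => 0 < w x)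
      (fun g hg => not_chg.1 (h (mem_facets.2 hg))) a ha b hb
    simp only [hwa, true_iff] at this
    linarith
  rcases h2 with ⟨r, hr⟩
  omega

theorem two_props {A B C D : Prop} (h : (A ∧ ¬ A ∨ A ∧ ¬ B) ∨ (B ∧ ¬ A ∨ B ∧ ¬ B))
    (h' : (C ∧ ¬ C ∨ C ∧ ¬ D) ∨ (D ∧ ¬ C ∨ D ∧ ¬ D)) :
    (True ∧ ((A ↔ C) ↔ (B ↔ D))) ∧ ((B ↔ D) ↔ (A ↔ C)) ∧ True := by
  by_cases A <;> by_cases B <;> by_cases C <;> by_cases D <;> simp_all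

/-- Stress sign lemma -/
theorem Poly.stress4 {W : Submodule ℝ (V → ℝ)} {X : Finset V} (hP : Poly W X)
    (h3 : Module.finrank ℝ W = 3) {c : V → ℝ} (hc : ∀ w ∈ W, ∑ x ∈ X, c x * w x = 0)
    (hc0 : ∃ x ∈ X, c x ≠ 0) :
    4 ≤ ((facets W X).filter (chg (fun x => c x < 0))).card := by
  have h2 := hP.chg_even h3 (fun x => c x < 0)
  obtain ⟨u, hu, -, -, u2⟩ := hP.pt.pos
  have upos : ∀ x ∈ X, 0 < u x := fun x hx => u2 x hx (by simp)
  have h0 : ((facets W X).filter (chg (fun x => c x < 0))).card ≠ 0 := by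
    intro h
    rw [Finset.card_eq_zero, Finset.filter_eq_empty_iff] at h
    have hcon := hP.conn2 h3 (fun x => c x < 0) (fun g hg => not_chg.1 (h (mem_facets.2 hg)))
    obtain ⟨x0, hx0, hne⟩ := hc0
    have hs := hc u hu
    by_cases hn : c x0 < 0
    · have hall : ∀ x ∈ X, c x * u x < 0 := fun x hx =>
        mul_neg_of_neg_of_pos ((hcon x0 hx0 x hx).1 hn) (upos x hx)
      have := Finset.sum_neg hall ⟨x0, hx0⟩
      linarith
    · have hall : ∀ x ∈ X, 0 ≤ c x * u x := fun x hx =>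
        mul_nonneg (not_lt.1 (fun h => hn ((hcon x hx x0 hx0).1 h))) (upos x hx).le
      have := (Finset.sum_eq_zero_iff_of_nonneg hall).1 hs x0 hx0
      rcases mul_eq_zero.1 this with h | h
      · exact hne h
      · exact (upos x0 hx0).ne' h
  have h2' : ((facets W X).filter (chg (fun x => c x < 0))).card ≠ 2 := by
    intro h
    obtain ⟨g1, g2, h12, he⟩ := Finset.card_eq_two.1 h
    have m1 : g1 ∈ (facets W X).filter (chg (fun x => c x < 0)) := by rw [he]; simp
    have m2 : g2 ∈ (facets W X).filter (chg (fun x => c x < 0)) := by rw [he]; simp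
    simp only [Finset.mem_filter, mem_facets] at m1 m2
    obtain ⟨f1, j1, hj1, k1, hk1, p1, q1⟩ := m1
    obtain ⟨f2, j2, hj2, k2, hk2, p2, q2⟩ := m2
    have e1 : j1 ≠ k1 := by rintro rfl; exact q1 p1
    have e2 : j2 ≠ k2 := by rintro rfl; exact q2 p2
    obtain ⟨l1, hl1, a1, b1, c1⟩ := f1.1.pos
    obtain ⟨l2, hl2, a2, b2, c2⟩ := f2.1.pos
    have one : (0:ℝ) < 1 := one_pos
    have E21 := ev2_facet hP h3 f1 f2 h12.symm hj2 hk2 e2 one one a1 c1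
    have E12 := ev2_facet hP h3 f2 f1 h12 hj1 hk1 e1 one one a2 c2
    have E11 : ev2 1 1 j1 k1 l1 = 0 := by rw [ev2_apply, b1 _ hj1, b1 _ hk1]; ring
    have E22 : ev2 1 1 j2 k2 l2 = 0 := by rw [ev2_apply, b2 _ hj2, b2 _ hk2]; ring
    have hg1e : g1 = {j1, k1} := by
      symm
      apply Finset.eq_of_subset_of_card_le
      · intro x hx; simp at hx; rcases hx with rfl | rfl <;> assumption
      · rw [hP.fct2 h3 f1, Finset.card_pair e1]
    have hg2e : g2 = {j2, k2} := by
      symm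
      apply Finset.eq_of_subset_of_card_le
      · intro x hx; simp at hx; rcases hx with rfl | rfl <;> assumption
      · rw [hP.fct2 h3 f2, Finset.card_pair e2]
    -- the separating functional
    obtain ⟨w, hw, hw0, s1, s2⟩ : ∃ w ∈ W, w ≠ 0 ∧ w j1 + w k1 = 0 ∧ w j2 + w k2 = 0 := by
      let T : W →ₗ[ℝ] (Fin 2 → ℝ) :=
        (LinearMap.pi ![ev2 1 1 j1 k1, ev2 1 1 j2 k2]) ∘ₗ W.subtype
      have hk := LinearMap.ker_ne_bot_of_finrank_lt (f := T) (by simp [h3])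
      obtain ⟨w, hwk, hw0⟩ := (Submodule.ne_bot_iff _).1 hk
      refine ⟨w.1, w.2, fun h => hw0 (Subtype.ext h), ?_, ?_⟩
      · have := congrFun hwk 0
        simpa [T, ev2] using this
      · have := congrFun hwk 1
        simpa [T, ev2] using this
    -- vanishing on an edge
    have van1 : ∀ {g g' : Finset V} {j k : V}, Fct W X g → w ∈ van W g → g' ≠ g → Fct W X g' →
        j ∈ g' → k ∈ g' → j ≠ k → w j + w k = 0 → False := by
      intro g g' j k hg hwg hne hg' hj hk hjk hs
      obtain ⟨l, hl, a, b, c, hmul⟩ := hg.fn hP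
      obtain ⟨t, rfl⟩ := hmul w hwg
      have := ev2_facet hP h3 hg hg' hne hj hk hjk one one a c
      rw [ev2_apply] at this
      simp only [Pi.smul_apply, smul_eq_mul] at hs
      have : t = 0 := by
        have : t * (1 * l j + 1 * l k) = 0 := by linarith
        rcases mul_eq_zero.1 this with h | h
        · exact h
        · linarith
      exact hw0 (by simp [this])
    have nz : ∀ x ∈ X, w x ≠ 0 := by
      intro x hx hwx
      by_cases hx1 : x ∈ g1
      · refine van1 f1 ⟨hw, ?_⟩ h12.symm f2 hj2 hk2 e2 s2
        rw [hg1e] at hx1 ⊢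
        intro y hy
        simp at hx1 hy
        rcases hx1 with rfl | rfl <;> rcases hy with rfl | rfl <;> linarith
      by_cases hx2 : x ∈ g2
      · refine van1 f2 ⟨hw, ?_⟩ h12 f1 hj1 hk1 e1 s1
        rw [hg2e] at hx2 ⊢
        intro y hy
        simp at hx2 hy
        rcases hx2 with rfl | rfl <;> rcases hy with rfl | rfl <;> linarith
      obtain ⟨t, ht, t0, t1, t2⟩ := (hP.vx x hx).pos
      apply hw0
      have tp : ∀ {j}, j ∈ X → j ≠ x → 0 < t j := fun hj hne => t2 _ hj (by simpa using hne)
      refine tri_func h3 (ev2 1 1 j1 k1) (ev2 1 1 j2 k2) (LinearMap.proj x) hl1 hl2 ht E11 E21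
        ?_ E12 E22 ?_ ?_ ?_ ?_ hw ?_ ?_ ?_
      · exact c1 x hx hx1
      · exact c2 x hx hx2
      · rw [ev2_apply]
        have := tp (f1.1.1 hj1) (by rintro rfl; exact hx1 hj1)
        have := tp (f1.1.1 hk1) (by rintro rfl; exact hx1 hk1)
        linarith
      · rw [ev2_apply]
        have := tp (f2.1.1 hj2) (by rintro rfl; exact hx2 hj2)
        have := tp (f2.1.1 hk2) (by rintro rfl; exact hx2 hk2)
        linarith
      · simpa using t1 x (by simp)
      · rw [ev2_apply]; linarith
      · rw [ev2_apply]; linarith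
      · simpa using hwx
    have cw : (facets W X).filter (chg (fun x => 0 < w x)) = {g1, g2} := by
      symm
      apply Finset.eq_of_subset_of_card_le
      · intro g hg
        simp only [Finset.mem_insert, Finset.mem_singleton] at hg
        simp only [Finset.mem_filter, mem_facets]
        have aux : ∀ {j k : V} {g : Finset V}, Fct W X g → j ∈ g → k ∈ g → w j + w k = 0 →
            chg (fun x => 0 < w x) g := by
          intro j k g hg hj hk hs
          rcases lt_or_gt_of_ne (nz j (hg.1.1 hj)) with h | h
          · exact ⟨k, hk, j, hj, by linarith, by simp only; linarith⟩
          · exact ⟨j, hj, k, hk, h, by simp only; linarith⟩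
        rcases hg with rfl | rfl
        · exact ⟨f1, aux f1 hj1 hk1 s1⟩
        · exact ⟨f2, aux f2 hj2 hk2 s2⟩
      · rw [Finset.card_pair h12]
        exact hP.cross_le h3 hw nz
    have agree : ∀ x ∈ X, ∀ z ∈ X, ((0 < w x ↔ c x < 0) ↔ (0 < w z ↔ c z < 0)) := by
      apply hP.conn2 h3 (fun x => (0 < w x ↔ c x < 0))
      intro g hg
      by_cases hm : g = g1 ∨ g = g2
      · have q1' : chg (fun x => 0 < w x) g := by
          have : g ∈ (facets W X).filter (chg (fun x => 0 < w x)) := by rw [cw]; simpa using hm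
          exact (Finset.mem_filter.1 this).2
        have q2' : chg (fun x => c x < 0) g := by
          have : g ∈ (facets W X).filter (chg (fun x => c x < 0)) := by rw [he]; simpa using hm
          exact (Finset.mem_filter.1 this).2
        obtain ⟨a, b, hab, rfl⟩ := Finset.card_eq_two.1 (hP.fct2 h3 hg)
        simp only [chg, Finset.mem_insert, Finset.mem_singleton, exists_eq_or_imp, exists_eq_left,
          forall_eq_or_imp, forall_eq] at q1' q2' ⊢
        exact two_props q1' q2'
      · have q1' : ¬ chg (fun x => 0 < w x) g := by
          intro h
          have : g ∈ (facets W X).filter (chg (fun x => 0 < w x)) :=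
            Finset.mem_filter.2 ⟨mem_facets.2 hg, h⟩
          rw [cw] at this
          exact hm (by simpa using this)
        have q2' : ¬ chg (fun x => c x < 0) g := by
          intro h
          have : g ∈ (facets W X).filter (chg (fun x => c x < 0)) :=
            Finset.mem_filter.2 ⟨mem_facets.2 hg, h⟩
          rw [he] at this
          exact hm (by simpa using this)
        rw [not_chg] at q1' q2'
        intro j hj k hk
        rw [q1' j hj k hk, q2' j hj k hk]
    obtain ⟨x0, hx0, hne⟩ := hc0
    have hs := hc w hw
    have fin : c x0 * w x0 = 0 := by
      by_cases hag : (0 < w x0 ↔ c x0 < 0)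
      · have hall : ∀ x ∈ X, 0 ≤ -(c x * w x) := by
          intro x hx
          have hx' := (agree x0 hx0 x hx).1 hag
          by_cases h : 0 < w x
          · have := mul_neg_of_neg_of_pos (hx'.1 h) h
            linarith
          · have h1 : 0 ≤ c x := not_lt.1 (fun h' => h (hx'.2 h'))
            have := mul_nonpos_of_nonneg_of_nonpos h1 (not_lt.1 h)
            linarith
        have := (Finset.sum_eq_zero_iff_of_nonneg hall).1 (by simp [hs]) x0 hx0
        linarith
      · have hall : ∀ x ∈ X, 0 ≤ c x * w x := by
          intro x hx
          have hx' : ¬ (0 < w x ↔ c x < 0) := fun h => hag ((agree x0 hx0 x hx).2 h)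
          by_cases h : 0 < w x
          · have : 0 ≤ c x := by by_contra h'; exact hx' ⟨fun _ => not_le.1 h', fun _ => h⟩
            positivity
          · have h1 : c x < 0 := by
              by_contra h'; exact hx' ⟨fun h'' => absurd h'' h, fun h'' => absurd h'' h'⟩
            exact mul_nonneg_of_nonpos_of_nonpos h1.le (not_lt.1 h)
        exact (Finset.sum_eq_zero_iff_of_nonneg hall).1 hs x0 hx0
    rcases mul_eq_zero.1 fin with h | h
    · exact hne h
    · exact nz x0 hx0 h
  rcases h2 with ⟨r, hr⟩
  omega

end Core3

section Core4
open scoped Classical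
set_option linter.all false
variable {V : Type} [Fintype V]

def fs (W : Submodule ℝ (V → ℝ)) (X : Finset V) (k : ℕ) : Finset (Finset V) :=
  X.powerset.filter (fun A => Fc W X A ∧ Module.finrank ℝ (van W A) + k = Module.finrank ℝ W)

theorem mem_fs {W : Submodule ℝ (V → ℝ)} {X A : Finset V} {k : ℕ} : A ∈ fs W X k ↔
    Fc W X A ∧ Module.finrank ℝ (van W A) + k = Module.finrank ℝ W := by
  simp only [fs, Finset.mem_filter, Finset.mem_powerset]
  exact ⟨fun h => h.2, fun h => ⟨h.1.1, h⟩⟩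

theorem fs_facets {W : Submodule ℝ (V → ℝ)} {X : Finset V} {k : ℕ}
    (h : Module.finrank ℝ W = k + 1) : fs W X k = facets W X := by
  ext A
  rw [mem_fs, mem_facets, Fct, h]
  constructor
  · rintro ⟨a, b⟩; exact ⟨a, by omega⟩
  · rintro ⟨a, b⟩; exact ⟨a, by omega⟩

theorem link_fs {W : Submodule ℝ (V → ℝ)} {X : Finset V} (hP : Poly W X) {v : V} (hv : v ∈ X)
    (k : ℕ) (p : Finset V → Prop) :
    ((fs W X (k + 1)).filter (fun A => v ∈ A ∧ p (A ∩ nb W X v))).card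
      = ((fs (van W {v}) (nb W X v) k).filter p).card := by
  have h1 := hP.finrank_van1 hv
  refine Finset.card_bij (fun A _ => A ∩ nb W X v) ?_ ?_ ?_
  · intro A hA
    obtain ⟨hA, hvA, hp⟩ := Finset.mem_filter.1 hA
    rw [mem_fs] at hA
    refine Finset.mem_filter.2 ⟨mem_fs.2 ⟨fc_link_of hA.1 hvA, ?_⟩, hp⟩
    rw [van_link hP hA.1 hvA]
    omega
  · intro A hA B hB hAB
    obtain ⟨hA, hvA, hp⟩ := Finset.mem_filter.1 hA
    obtain ⟨hB, hvB, hp⟩ := Finset.mem_filter.1 hB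
    exact link_inj hP (mem_fs.1 hA).1 hvA (mem_fs.1 hB).1 hvB hAB
  · intro B hB
    obtain ⟨hB, hp⟩ := Finset.mem_filter.1 hB
    rw [mem_fs] at hB
    obtain ⟨A, hvA, hA, rfl⟩ := (fc_link_iff hP hv).1 hB.1
    refine ⟨A, Finset.mem_filter.2 ⟨mem_fs.2 ⟨hA, ?_⟩, hvA, hp⟩, rfl⟩
    rw [van_link hP hA hvA] at hB
    omega

theorem link_fs' {W : Submodule ℝ (V → ℝ)} {X : Finset V} (hP : Poly W X) {v : V} (hv : v ∈ X)
    (k : ℕ) :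
    ((fs W X (k + 1)).filter (fun A => v ∈ A)).card = (fs (van W {v}) (nb W X v) k).card := by
  have := link_fs hP hv k (fun _ => True)
  simpa using this

theorem Poly.card_small {W : Submodule ℝ (V → ℝ)} {X A : Finset V} (hP : Poly W X) {k : ℕ}
    (hk : k ≤ 2) (hA : A ⊆ X) (h : Module.finrank ℝ (van W A) + k = Module.finrank ℝ W) :
    A.card = k := by
  by_cases hc : A.card ≤ 3
  · have := (hP.ind3 hA hc).finrank
    omega
  · obtain ⟨S, hS, hSc⟩ := Finset.exists_subset_card_eq (s := A) (n := 3) (by omega)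
    have h2 := (hP.ind3 (hS.trans hA) hSc.le).finrank
    have h3 := Submodule.finrank_mono (van_anti (W := W) hS)
    omega

theorem Poly.fs1 {W : Submodule ℝ (V → ℝ)} {X : Finset V} (hP : Poly W X) :
    (fs W X 1).card = X.card := by
  symm
  refine Finset.card_bij (fun x _ => {x}) ?_ ?_ ?_
  · intro x hx
    exact mem_fs.2 ⟨hP.vx x hx, hP.finrank_van1 hx⟩
  · intro a _ b _ h; simpa using h
  · intro A hA
    rw [mem_fs] at hA
    obtain ⟨x, rfl⟩ := Finset.card_eq_one.1 (hP.card_small (by norm_num) hA.1.1 hA.2)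
    exact ⟨x, hA.1.1 (by simp), rfl⟩

theorem Poly.sum_deg {W : Submodule ℝ (V → ℝ)} {X : Finset V} (hP : Poly W X) :
    ∑ v ∈ X, (nb W X v).card = 2 * (fs W X 2).card := by
  have h1 := double_count (fs W X 2) X (fun g hg => (mem_fs.1 hg).1.1) (fun j _ => True)
  simp only [and_true, Finset.filter_true] at h1
  rw [Finset.sum_congr rfl (fun g hg => hP.card_small (le_refl 2) (mem_fs.1 hg).1.1 (mem_fs.1 hg).2),
    Finset.sum_congr rfl (fun j hj => (link_fs' hP hj 1).trans (hP.link hj).fs1)] at h1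
  rw [← h1]
  simp [mul_comm]

theorem link3_facets {W : Submodule ℝ (V → ℝ)} {X : Finset V} (hP : Poly W X)
    (h4 : Module.finrank ℝ W = 4) {v : V} (hv : v ∈ X) (p : Finset V → Prop) :
    ((facets W X).filter (fun A => v ∈ A ∧ p (A ∩ nb W X v))).card
      = ((facets (van W {v}) (nb W X v)).filter p).card := by
  have h1 := hP.finrank_van1 hv
  rw [← fs_facets (k := 3) h4, ← fs_facets (k := 2) (by omega)]
  exact link_fs hP hv 2 p

theorem Poly.sum_facets4 {W : Submodule ℝ (V → ℝ)} {X : Finset V} (hP : Poly W X)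
    (h4 : Module.finrank ℝ W = 4) : ∑ f ∈ facets W X, f.card = 2 * (fs W X 2).card := by
  have h1 := double_count (facets W X) X (fun g hg => (mem_facets.1 hg).1.1) (fun j _ => True)
  simp only [and_true, Finset.filter_true] at h1
  rw [h1, ← hP.sum_deg]
  refine Finset.sum_congr rfl (fun v hv => ?_)
  have h2 := link3_facets hP h4 hv (fun _ => True)
  simp only [and_true, Finset.filter_true] at h2
  rw [h2, (hP.link hv).card_facets3 (by have := hP.finrank_van1 hv; omega)]

theorem card_mid (S : Finset V) (r : V → ℝ) (hr : Set.InjOn r S) (hS : 2 ≤ S.card) :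
    (S.filter (fun v => (∃ x ∈ S, r v < r x) ∧ (∃ y ∈ S, r y < r v))).card + 2 = S.card := by
  have hne : S.Nonempty := Finset.card_pos.1 (by omega)
  obtain ⟨M, hM, hM'⟩ := Finset.exists_max_image S r hne
  obtain ⟨m, hm, hm'⟩ := Finset.exists_min_image S r hne
  have hMm : m ≠ M := by
    rintro rfl
    obtain ⟨a, ha, b, hb, hab⟩ := Finset.one_lt_card.1 (by omega : 1 < S.card)
    exact hab (hr ha hb (le_antisymm ((hM' a ha).trans (hm' b hb)) ((hM' b hb).trans (hm' a ha))))
  have : S.filter (fun v => (∃ x ∈ S, r v < r x) ∧ (∃ y ∈ S, r y < r v)) = (S.erase M).erase m := by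
    ext v
    simp only [Finset.mem_filter, Finset.mem_erase]
    constructor
    · rintro ⟨hv, ⟨x, hx, h1⟩, ⟨y, hy, h2⟩⟩
      refine ⟨?_, ?_, hv⟩
      · rintro rfl; exact absurd (hm' y hy) (not_le.2 h2)
      · rintro rfl; exact absurd (hM' x hx) (not_le.2 h1)
    · rintro ⟨h1, h2, hv⟩
      refine ⟨hv, ⟨M, hM, ?_⟩, ⟨m, hm, ?_⟩⟩
      · exact lt_of_le_of_ne (hM' v hv) (fun h => h2 (hr hv hM h))
      · exact lt_of_le_of_ne (hm' v hv) (fun h => h1 (hr hv hm h.symm))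
  rw [this, Finset.card_erase_of_mem (Finset.mem_erase.2 ⟨hMm, hm⟩), Finset.card_erase_of_mem hM]
  omega

theorem Poly.generic {W : Submodule ℝ (V → ℝ)} {X : Finset V} (hP : Poly W X) {u : V → ℝ}
    (hu : ∀ x ∈ X, 0 < u x) : ∃ l ∈ W, Set.InjOn (fun x => l x / u x) X := by
  let K : V × V → Submodule ℝ W := fun q =>
    LinearMap.ker ((u q.2 • LinearMap.proj q.1 - u q.1 • LinearMap.proj q.2 :
      (V → ℝ) →ₗ[ℝ] ℝ) ∘ₗ W.subtype)
  have hK : ∀ q w, w ∈ K q ↔ u q.2 * w.1 q.1 - u q.1 * w.1 q.2 = 0 := by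
    intro q w; simp [K]
  have := Subspace.biUnion_ne_univ_of_top_notMem (k := ℝ) (E := W)
    (s := (X.offDiag).image K) (by
      intro h
      obtain ⟨q, hq, hqt⟩ := Finset.mem_image.1 h
      rw [Finset.mem_offDiag] at hq
      obtain ⟨l, hl, l0, l1, l2⟩ := (hP.vx q.1 hq.1).pos
      have : (⟨l, hl⟩ : W) ∈ K q := by rw [hqt]; trivial
      rw [hK] at this
      simp only at this
      rw [l1 _ (by simp)] at this
      have h1 := l2 q.2 hq.2.1 (by simpa using hq.2.2.symm)
      have h2 := hu _ hq.1
      have : 0 < u q.1 * l q.2 := by positivity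
      linarith)
  obtain ⟨l, hl⟩ := (Set.ne_univ_iff_exists_notMem _).1 this
  refine ⟨l.1, l.2, ?_⟩
  intro a ha b hb hab
  by_contra hne
  apply hl
  simp only [Set.mem_iUnion]
  refine ⟨K (a, b), Finset.mem_image.2 ⟨(a, b), Finset.mem_offDiag.2 ⟨ha, hb, hne⟩, rfl⟩, ?_⟩
  show l ∈ K (a, b)
  rw [hK]
  have h1 := (hu a ha).ne'
  have h2 := (hu b hb).ne'
  simp only at hab ⊢
  rw [div_eq_div_iff h1 h2] at hab
  linarith

/-- sweep -/
theorem Poly.sweep {W : Submodule ℝ (V → ℝ)} {X : Finset V} (hP : Poly W X)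
    (h4 : Module.finrank ℝ W = 4) :
    ∑ f ∈ facets W X, f.card + 4 = 2 * (facets W X).card + 2 * X.card := by
  obtain ⟨u, hu, -, -, u2⟩ := hP.pt.pos
  have upos : ∀ x ∈ X, 0 < u x := fun x hx => u2 x hx (by simp)
  obtain ⟨l, hl, hinj⟩ := hP.generic upos
  set r : V → ℝ := fun x => l x / u x with hr
  -- local functional
  let w : V → V → ℝ := fun v => u v • l - l v • u
  have hwW : ∀ v, w v ∈ W := fun v => W.sub_mem (W.smul_mem _ hl) (W.smul_mem _ hu)
  have hwx : ∀ v ∈ X, ∀ x ∈ X, w v x = (u v * u x) * (r x - r v) := by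
    intro v hv x hx
    have := (upos v hv).ne'
    have := (upos x hx).ne'
    simp only [w, r, Pi.sub_apply, Pi.smul_apply, smul_eq_mul]
    field_simp
  have hwv : ∀ v, w v v = 0 := fun v => by simp [w]; ring
  have hpos : ∀ v ∈ X, ∀ x ∈ X, (0 < w v x ↔ r v < r x) := by
    intro v hv x hx
    rw [hwx v hv x hx, mul_pos_iff_of_pos_left (mul_pos (upos v hv) (upos x hx)), sub_pos]
  have hneg : ∀ v ∈ X, ∀ x ∈ X, (w v x < 0 ↔ r x < r v) := by
    intro v hv x hx
    have := mul_pos (upos v hv) (upos x hx)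
    rw [hwx v hv x hx]
    constructor
    · intro h; by_contra h'; push Not at h'
      have := mul_nonneg this.le (sub_nonneg.2 h')
      linarith
    · intro h; exact mul_neg_of_pos_of_neg this (by linarith)
  have hz : ∀ v ∈ X, ∀ x ∈ X, x ≠ v → w v x ≠ 0 := by
    intro v hv x hx hne h
    have h1 := (hpos v hv x hx).not.1 (by rw [h]; simp)
    have h2 := (hneg v hv x hx).not.1 (by rw [h]; simp)
    exact hne (hinj hx hv (le_antisymm (not_lt.1 h1) (not_lt.1 h2)))
  -- both signs on a face iff sign change in the link
  have both : ∀ A, Fc W X A → ∀ v ∈ A, (chg (fun x => 0 < w v x) (A ∩ nb W X v) ↔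
      (∃ x ∈ A, r v < r x) ∧ (∃ y ∈ A, r y < r v)) := by
    intro A hA v hv
    have hvX := hA.1 hv
    constructor
    · rintro ⟨j, hj, k, hk, p, q⟩
      rw [Finset.mem_inter] at hj hk
      refine ⟨⟨j, hj.1, (hpos v hvX j (hA.1 hj.1)).1 p⟩, ⟨k, hk.1, (hneg v hvX k (hA.1 hk.1)).1 ?_⟩⟩
      exact lt_of_le_of_ne (not_lt.1 q) (hz v hvX k (hA.1 hk.1) (mem_nb.1 hk.2).2.1)
    · rintro ⟨⟨x, hx, hvx⟩, ⟨y, hy, hyv⟩⟩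
      have h1 : ∃ j ∈ A ∩ nb W X v, 0 < w v j := by
        by_contra hcon
        push Not at hcon
        have := hP.neighbor_face hA hv (w := -w v) (W.neg_mem (hwW v)) (by simp [hwv])
          (fun j hj hjA => by simpa using hcon j (Finset.mem_inter.2 ⟨hjA, hj⟩)) x hx
        have h2 := (hpos v hvX x (hA.1 hx)).2 hvx
        simp at this
        linarith
      have h2 : ∃ j ∈ A ∩ nb W X v, ¬ 0 < w v j := by
        by_contra hcon
        push Not at hcon
        have := hP.neighbor_face hA hv (w := w v) ((hwW v)) (by simp [hwv])
          (fun j hj hjA => (hcon j (Finset.mem_inter.2 ⟨hjA, hj⟩)).le) y hy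
        have h2 := (hneg v hvX y (hA.1 hy)).2 hyv
        linarith
      obtain ⟨j, hj, hj'⟩ := h1
      obtain ⟨k, hk, hk'⟩ := h2
      exact ⟨j, hj, k, hk, hj', hk'⟩
  have hdc := double_count (facets W X) X (fun g hg => (mem_facets.1 hg).1.1)
    (fun v f => chg (fun x => 0 < w v x) (f ∩ nb W X v))
  have hfc : ∀ f ∈ facets W X, 3 ≤ f.card := by
    intro f hf
    have := finrank_le_card W f
    have := (mem_facets.1 hf).2
    omega
  have hL : ∑ f ∈ facets W X, (f.filter (fun v => chg (fun x => 0 < w v x) (f ∩ nb W X v))).card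
      + 2 * (facets W X).card = ∑ f ∈ facets W X, f.card := by
    have : 2 * (facets W X).card = ∑ f ∈ facets W X, 2 := by simp [mul_comm]
    rw [this, ← Finset.sum_add_distrib]
    refine Finset.sum_congr rfl (fun f hf => ?_)
    have hF := (mem_facets.1 hf).1
    rw [← card_mid f r (hinj.mono (by exact_mod_cast hF.1)) (by have := hfc f hf; omega)]
    congr 2
    refine Finset.filter_congr (fun v hv => both f hF v hv)
  have hXc : 4 ≤ X.card := by
    have := finrank_le_card W X
    have h0 : van W X = ⊥ := by
      rw [eq_bot_iff]; intro w hw; exact hP.inj w hw.1 hw.2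
    rw [h0] at this
    simp at this
    omega
  have hR : ∑ v ∈ X, ((facets W X).filter
      (fun f => v ∈ f ∧ chg (fun x => 0 < w v x) (f ∩ nb W X v))).card + 4 = 2 * X.card := by
    have key : ∀ v ∈ X, ((facets W X).filter
      (fun f => v ∈ f ∧ chg (fun x => 0 < w v x) (f ∩ nb W X v))).card
        = if ((∃ x ∈ X, r v < r x) ∧ (∃ y ∈ X, r y < r v)) then 2 else 0 := by
      intro v hv
      rw [link3_facets hP h4 hv]
      have h1 := hP.finrank_van1 hv
      split_ifs with hb
      · obtain ⟨j, hj, k, hk, p, q⟩ := (both X Fc.self v hv).2 hb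
        rw [Finset.mem_inter] at hj hk
        have hnz : ∀ x ∈ nb W X v, w v x ≠ 0 := fun x hx =>
          hz v hv x (mem_nb.1 hx).1 (mem_nb.1 hx).2.1
        refine (hP.link hv).cross_eq (by omega) ⟨hwW v, by simp [hwv]⟩ hnz hj.2 hk.2 p ?_
        exact lt_of_le_of_ne (not_lt.1 q) (hnz k hk.2)
      · rw [Finset.card_eq_zero, Finset.filter_eq_empty_iff]
        intro g hg hch
        apply hb
        apply (both X Fc.self v hv).1
        obtain ⟨j, hj, k, hk, p, q⟩ := hch
        have hgs := (mem_facets.1 hg).1.1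
        have hs : nb W X v ⊆ X := fun x hx => (mem_nb.1 hx).1
        exact ⟨j, Finset.mem_inter.2 ⟨hs (hgs hj), hgs hj⟩, k,
          Finset.mem_inter.2 ⟨hs (hgs hk), hgs hk⟩, p, q⟩
    rw [Finset.sum_congr rfl key, ← Finset.sum_filter, Finset.sum_const, smul_eq_mul]
    have := card_mid X r hinj (by omega)
    omega
  omega

end Core4

section Core5
open scoped Classical
set_option linter.all false
variable {V : Type} [Fintype V]


theorem Poly.dehn_active {W : Submodule ℝ (V → ℝ)} {X : Finset V} (hP : Poly W X)
    (h4 : Module.finrank ℝ W = 4) (L : V → V → ℝ) (hs : ∀ i j, L i j = L j i)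
    (hL : ∀ i ∈ X, ∀ w ∈ van W {i}, ∑ j ∈ nb W X i, L i j * w j = 0)
    (hact : ∀ i ∈ X, ∃ j ∈ nb W X i, L i j ≠ 0) : False := by
  have hdc := double_count (facets W X) X (fun g hg => (mem_facets.1 hg).1.1)
    (fun v f => chg (fun x => L v x < 0) (f ∩ nb W X v))
  have hsw := hP.sweep h4
  have hR : ∑ v ∈ X, 4 ≤ ∑ v ∈ X, ((facets W X).filter
      (fun f => v ∈ f ∧ chg (fun x => L v x < 0) (f ∩ nb W X v))).card := by
    refine Finset.sum_le_sum (fun v hv => ?_)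
    rw [link3_facets hP h4 hv]
    exact (hP.link hv).stress4 (by have := hP.finrank_van1 hv; omega) (hL v hv) (hact v hv)
  have hfc : ∀ f ∈ facets W X, 3 ≤ f.card := by
    intro f hf
    have := finrank_le_card W f
    have := (mem_facets.1 hf).2
    omega
  have hLe : ∑ f ∈ facets W X, ((f.filter (fun v => chg (fun x => L v x < 0) (f ∩ nb W X v))).card + 4)
      ≤ ∑ f ∈ facets W X, 2 * f.card := by
    refine Finset.sum_le_sum (fun f hf => ?_)
    have h3 := hfc f hf
    by_cases hc : 4 ≤ f.card
    · have := Finset.card_filter_le f (fun v => chg (fun x => L v x < 0) (f ∩ nb W X v))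
      omega
    · have hc3 : f.card = 3 := by omega
      obtain ⟨a, b, c, hab, hac, hbc, rfl⟩ := Finset.card_eq_three.1 hc3
      have : ({a, b, c} : Finset V).filter (fun v => chg (fun x => L v x < 0) ({a, b, c} ∩ nb W X v))
          ≠ {a, b, c} := by
        intro h
        rw [Finset.filter_eq_self] at h
        have ha := h a (by simp)
        have hb := h b (by simp)
        have hc := h c (by simp)
        have nself : ∀ v, v ∉ nb W X v := fun v hv => (mem_nb.1 hv).2.1 rfl
        have sub : ∀ {v x y : V}, (∀ z ∈ ({a, b, c} : Finset V), z = v ∨ z = x ∨ z = y) →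
            chg (fun z => L v z < 0) ({a, b, c} ∩ nb W X v) → ¬ (L v x < 0 ↔ L v y < 0) := by
          rintro v x y hz ⟨j, hj, k, hk, p, q⟩
          rw [Finset.mem_inter] at hj hk
          rcases hz j hj.1 with rfl | rfl | rfl
          · exact absurd hj.2 (nself _)
          · rcases hz k hk.1 with rfl | rfl | rfl
            · exact absurd hk.2 (nself _)
            · exact absurd p q
            · exact fun h => q (h.1 p)
          · rcases hz k hk.1 with rfl | rfl | rfl
            · exact absurd hk.2 (nself _)
            · exact fun h => q (h.2 p)
            · exact absurd p q
        have e1 := sub (x := b) (y := c) (by simp) ha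
        have e2 := sub (x := a) (y := c) (by simp) hb
        have e3 := sub (x := a) (y := b) (by simp) hc
        rw [hs b a] at e2
        rw [hs c a, hs c b] at e3
        tauto
      have h5 := Finset.card_lt_card (Finset.ssubset_iff_subset_ne.2 ⟨Finset.filter_subset _ _, this⟩)
      omega
  rw [Finset.sum_add_distrib, hdc, ← Finset.mul_sum] at hLe
  simp only [Finset.sum_const, smul_eq_mul] at hLe hR
  omega

/-- restriction of functions to `A` -/
def resA (A : Finset V) : (V → ℝ) →ₗ[ℝ] (V → ℝ) where
  toFun w := fun x => if x ∈ A then w x else 0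
  map_add' := fun a b => by ext x; simp only [Pi.add_apply]; split_ifs <;> simp
  map_smul' := fun c a => by ext x; simp

theorem resA_apply (A : Finset V) (w : V → ℝ) {x : V} (hx : x ∈ A) : resA A w x = w x := by
  simp [resA, hx]

theorem Fc.res {W : Submodule ℝ (V → ℝ)} {X A B : Finset V} (hA : A ⊆ X) (hB : Fc W X B) :
    Fc (W.map (resA A)) A (B ∩ A) := by
  obtain ⟨l, hl, l0, l1, l2⟩ := hB.pos
  refine Fc.mk' Finset.inter_subset_right (resA A l) (Submodule.mem_map_of_mem hl) ?_ ?_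
  · intro x hx
    rw [Finset.mem_inter] at hx
    rw [resA_apply _ _ hx.2, l1 x hx.1]
  · intro x hx hxB
    rw [resA_apply _ _ hx]
    exact l2 x (hA hx) (fun h => hxB (Finset.mem_inter.2 ⟨h, hx⟩))

theorem Poly.res {W : Submodule ℝ (V → ℝ)} {X A : Finset V} (hP : Poly W X) (hA : A ⊆ X) :
    Poly (W.map (resA A)) A := by
  refine ⟨?_, ?_, ?_⟩
  · simpa using hP.pt.res hA
  · intro x hx
    have := (hP.vx x (hA hx)).res hA
    rwa [Finset.inter_eq_left.2 (by simpa using hx)] at this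
  · rintro w ⟨y, hy, rfl⟩ h
    ext x
    by_cases hx : x ∈ A
    · exact h x hx
    · simp [resA, hx]

theorem Poly.dehn {W : Submodule ℝ (V → ℝ)} {X : Finset V} (hP : Poly W X)
    (h4 : Module.finrank ℝ W = 4) (L : V → V → ℝ) (hs : ∀ i j, L i j = L j i)
    (hL : ∀ i ∈ X, ∀ w ∈ van W {i}, ∑ j ∈ nb W X i, L i j * w j = 0) :
    ∀ i ∈ X, ∀ j ∈ nb W X i, L i j = 0 := by
  by_contra hcon
  push Not at hcon
  obtain ⟨i0, hi0, j0, hj0, hne0⟩ := hcon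
  set A := X.filter (fun i => ∃ j ∈ nb W X i, L i j ≠ 0) with hAdef
  have hAX : A ⊆ X := Finset.filter_subset _ _
  set W' := W.map (resA A) with hW'
  have hP' : Poly W' A := hP.res hAX
  let L' : V → V → ℝ := fun i j => if j ∈ nb W X i then L i j else 0
  have hs' : ∀ i j, L' i j = L' j i := by
    intro i j
    simp only [L']
    by_cases h : j ∈ nb W X i
    · rw [if_pos h, if_pos (nb_symm h), hs]
    · rw [if_neg h, if_neg (fun h' => h (nb_symm h'))]
  have hAmem : ∀ i ∈ X, ∀ j ∈ nb W X i, L i j ≠ 0 → j ∈ A := by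
    intro i hi j hj h
    refine Finset.mem_filter.2 ⟨(mem_nb.1 hj).1, i, nb_symm hj, by rwa [hs]⟩
  have hnb : ∀ i ∈ A, ∀ j ∈ A, j ∈ nb W X i → j ∈ nb W' A i := by
    intro i hi j hj h
    rw [mem_nb] at h ⊢
    refine ⟨hj, h.2.1, ?_⟩
    have := h.2.2.res hAX
    rwa [Finset.inter_eq_left.2] at this
    intro x hx; simp at hx; rcases hx with rfl | rfl <;> assumption
  have hL' : ∀ i ∈ A, ∀ w ∈ van W' {i}, ∑ j ∈ nb W' A i, L' i j * w j = 0 := by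
    rintro i hi w ⟨⟨y, hy, rfl⟩, hw⟩
    have hy0 : y i = 0 := by
      have := hw i (by simp)
      rwa [resA_apply _ _ hi] at this
    rw [← hL i (hAX hi) y ⟨hy, by simpa using hy0⟩]
    have e1 : ∑ j ∈ nb W' A i, L' i j * resA A y j = ∑ j : V, L' i j * resA A y j := by
      refine Finset.sum_subset (Finset.subset_univ _) (fun j _ hj => ?_)
      by_cases hjA : j ∈ A
      · have : j ∉ nb W X i := fun h => hj (hnb i hi j hjA h)
        simp [L', this]
      · simp [resA, hjA]
    have e2 : ∑ j ∈ nb W X i, L i j * y j = ∑ j : V, L' i j * resA A y j := by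
      rw [← Finset.sum_subset (Finset.subset_univ (nb W X i)) (f := fun j => L' i j * resA A y j)
        (fun j _ hj => by simp [L', hj])]
      refine Finset.sum_congr rfl (fun j hj => ?_)
      simp only [L', if_pos hj]
      by_cases hjA : j ∈ A
      · rw [resA_apply _ _ hjA]
      · have : L i j = 0 := by
          by_contra h
          exact hjA (hAmem i (hAX hi) j hj h)
        simp [this]
    rw [e1, e2]
  have hact : ∀ i ∈ A, ∃ j ∈ nb W' A i, L' i j ≠ 0 := by
    intro i hi
    obtain ⟨hiX, j, hj, hne⟩ := Finset.mem_filter.1 hi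
    exact ⟨j, hnb i hi j (hAmem i hiX j hj hne) hj, by simpa [L', hj] using hne⟩
  have hi0A : i0 ∈ A := Finset.mem_filter.2 ⟨hi0, j0, hj0, hne0⟩
  have hfr : Module.finrank ℝ W' ≤ 4 := by
    rw [← h4]; exact Submodule.finrank_map_le _ _
  by_cases hfr4 : Module.finrank ℝ W' = 4
  · exact hP'.dehn_active hfr4 L' hs' hL' hact
  · have h1 := hP'.finrank_van1 hi0A
    have hPl := hP'.link hi0A
    have hcard : (nb W' A i0).card ≤ 3 := by
      by_contra hc
      obtain ⟨S, hS, hSc⟩ := Finset.exists_subset_card_eq (s := nb W' A i0) (n := 3) (by omega)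
      have := (hPl.ind3 hS hSc.le).finrank
      omega
    obtain ⟨j, hj, hne⟩ := hact i0 hi0A
    exact hne (hPl.ind3 subset_rfl hcard (L' i0) (hL' i0 hi0A) j hj)

end Core5

section Core6
open scoped Classical
set_option linter.all false
variable {V : Type} [Fintype V]

/-- families of rows in `W`, vanishing on `Y` -/
def Zr (W : Submodule ℝ (V → ℝ)) (Y : Finset V) : Submodule ℝ (V → V → ℝ) where
  carrier := {Q | (∀ i, Q i ∈ W) ∧ ∀ i ∈ Y, Q i = 0}
  add_mem' := by
    rintro a b ⟨ha, ha'⟩ ⟨hb, hb'⟩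
    exact ⟨fun i => W.add_mem (ha i) (hb i), fun x hx => by simp [ha' x hx, hb' x hx]⟩
  zero_mem' := ⟨fun i => W.zero_mem, fun x _ => rfl⟩
  smul_mem' := by
    rintro c a ⟨ha, ha'⟩
    exact ⟨fun i => W.smul_mem c (ha i), fun x hx => by simp [ha' x hx]⟩

def Skew (W : Submodule ℝ (V → ℝ)) : Submodule ℝ (V → V → ℝ) where
  carrier := {Q | (∀ i, Q i ∈ W) ∧ ∀ i j, Q i j = - Q j i}
  add_mem' := by
    rintro a b ⟨ha, ha'⟩ ⟨hb, hb'⟩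
    exact ⟨fun i => W.add_mem (ha i) (hb i), fun i j => by
      simp only [Pi.add_apply]; rw [ha' i j, hb' i j]; ring⟩
  zero_mem' := ⟨fun i => W.zero_mem, fun i j => by simp⟩
  smul_mem' := by
    rintro c a ⟨ha, ha'⟩
    exact ⟨fun i => W.smul_mem c (ha i), fun i j => by
      simp only [Pi.smul_apply, smul_eq_mul]; rw [ha' i j]; ring⟩

def cf (A : Finset V) : (V → V → ℝ) →ₗ[ℝ] ℝ where
  toFun Q := ∑ i ∈ A, ∑ j ∈ A, Q i j
  map_add' := fun a b => by simp [Finset.sum_add_distrib]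
  map_smul' := fun c a => by simp [Finset.mul_sum]

theorem cf_apply (A : Finset V) (Q : V → V → ℝ) : cf A Q = ∑ i ∈ A, ∑ j ∈ A, Q i j := rfl

theorem cf_skew {W : Submodule ℝ (V → ℝ)} {Q : V → V → ℝ} (hQ : Q ∈ Skew W) (A : Finset V) :
    cf A Q = 0 := by
  have h : cf A Q = - cf A Q := by
    conv_lhs => rw [cf_apply, Finset.sum_comm]
    rw [cf_apply, ← Finset.sum_neg_distrib]
    refine Finset.sum_congr rfl (fun i _ => ?_)
    rw [← Finset.sum_neg_distrib]
    exact Finset.sum_congr rfl (fun j _ => hQ.2 j i)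
  linarith

theorem cf_single (i : V) (Q : V → V → ℝ) : cf {i} Q = Q i i := by simp [cf_apply]

theorem cf_pair {i j : V} (h : i ≠ j) (Q : V → V → ℝ) :
    cf {i, j} Q = Q i i + Q i j + (Q j i + Q j j) := by simp [cf_apply, Finset.sum_pair h]

def Kc (W : Submodule ℝ (V → ℝ)) (C : Finset (Finset V)) : Submodule ℝ (V → V → ℝ) where
  carrier := {Q | (∀ i, Q i ∈ W) ∧ ∀ A ∈ C, cf A Q = 0}
  add_mem' := by
    rintro a b ⟨ha, ha'⟩ ⟨hb, hb'⟩
    exact ⟨fun i => W.add_mem (ha i) (hb i), fun x hx => by simp [ha' x hx, hb' x hx]⟩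
  zero_mem' := ⟨fun i => W.zero_mem, fun x _ => by simp⟩
  smul_mem' := by
    rintro c a ⟨ha, ha'⟩
    exact ⟨fun i => W.smul_mem c (ha i), fun x hx => by simp [ha' x hx]⟩

theorem finrank_Zr (W : Submodule ℝ (V → ℝ)) (Y : Finset V) :
    Module.finrank ℝ (Zr W Y) + Y.card * Module.finrank ℝ W
      = Fintype.card V * Module.finrank ℝ W := by
  let g : ({x // x ∉ Y} → W) →ₗ[ℝ] (V → V → ℝ) :=
    { toFun := fun f i => if h : i ∉ Y then (f ⟨i, h⟩ : V → ℝ) else 0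
      map_add' := fun a b => by ext i j; by_cases h : i ∈ Y <;> simp [h]
      map_smul' := fun c a => by ext i j; by_cases h : i ∈ Y <;> simp [h] }
  have hg : ∀ f (i : {x // x ∉ Y}), g f i.1 = (f i : V → ℝ) := by
    intro f i; simp [g, i.2]
  have hg' : ∀ f i, i ∈ Y → g f i = 0 := by
    intro f i hi; simp [g, hi]
  have hinj : Function.Injective g := by
    intro a b hab
    ext i : 1
    apply Subtype.ext
    rw [← hg, ← hg, hab]
  have hrange : LinearMap.range g = Zr W Y := by
    ext Q
    constructor
    · rintro ⟨f, rfl⟩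
      refine ⟨fun i => ?_, fun i hi => hg' f i hi⟩
      by_cases h : i ∈ Y
      · rw [hg' f i h]; exact W.zero_mem
      · rw [hg f ⟨i, h⟩]; exact (f ⟨i, h⟩).2
    · rintro ⟨h1, h2⟩
      refine ⟨fun i => ⟨Q i.1, h1 i.1⟩, ?_⟩
      ext i : 1
      by_cases h : i ∈ Y
      · rw [hg' _ i h, h2 i h]
      · rw [hg _ ⟨i, h⟩]
  have h1 := LinearMap.finrank_range_of_inj hinj
  rw [hrange, Module.finrank_pi_fintype] at h1
  simp only [Finset.sum_const, Finset.card_univ, smul_eq_mul] at h1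
  rw [h1, Fintype.card_subtype_compl (fun x => x ∈ Y), Fintype.card_coe, ← add_mul]
  congr 1
  have := Finset.card_le_univ Y
  omega

theorem finrank_skew : ∀ (D : ℕ) (W : Submodule ℝ (V → ℝ)), Module.finrank ℝ W = D →
    Module.finrank ℝ (Skew W) = D.choose 2 := by
  intro D
  induction D with
  | zero =>
    intro W hW
    have hb : W = ⊥ := Submodule.finrank_eq_zero.1 hW
    have : Skew W = ⊥ := by
      rw [eq_bot_iff]
      rintro Q ⟨h, -⟩
      rw [Submodule.mem_bot]
      ext i : 1
      have := h i
      rw [hb, Submodule.mem_bot] at this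
      exact this
    rw [this]; simp
  | succ D ih =>
    intro W hW
    have hne : W ≠ ⊥ := by
      intro h; rw [h] at hW; simp at hW
    obtain ⟨w0, hw0, hw0'⟩ := (Submodule.ne_bot_iff _).1 hne
    obtain ⟨v, hv⟩ : ∃ v, w0 v ≠ 0 := by
      by_contra hcon; push Not at hcon; exact hw0' (funext hcon)
    set u : V → ℝ := (w0 v)⁻¹ • w0 with hu
    have huW : u ∈ W := W.smul_mem _ hw0
    have huv : u v = 1 := by simp [hu, hv]
    have hI : Ind W {v} := by
      intro c hc x hx
      simp at hx; subst hx
      have := hc u huW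
      simpa [huv] using this
    have h1 : Module.finrank ℝ (van W {v}) = D := by
      have := hI.finrank
      simp at this; omega
    let p : Skew W →ₗ[ℝ] (V → ℝ) := (LinearMap.proj v) ∘ₗ (Skew W).subtype
    have hp : ∀ A, p A = A.1 v := fun A => rfl
    have hr : LinearMap.range p = van W {v} := by
      ext w
      constructor
      · rintro ⟨A, rfl⟩
        refine ⟨A.2.1 v, fun x hx => ?_⟩
        simp at hx; subst hx
        rw [hp]
        have := A.2.2 x x
        linarith
      · rintro ⟨hw, hwv⟩
        refine ⟨⟨fun i => u i • w - w i • u, fun i =>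
          W.sub_mem (W.smul_mem _ hw) (W.smul_mem _ huW), fun i j => ?_⟩, ?_⟩
        · simp only [Pi.sub_apply, Pi.smul_apply, smul_eq_mul]; ring
        · rw [hp]; simp [huv, hwv v (by simp)]
    have hk : (LinearMap.ker p).map (Skew W).subtype = Skew (van W {v}) := by
      ext A
      simp only [Submodule.mem_map, LinearMap.mem_ker, Submodule.subtype_apply]
      constructor
      · rintro ⟨B, hB, rfl⟩
        rw [hp] at hB
        refine ⟨fun i => ⟨B.2.1 i, fun x hx => ?_⟩, B.2.2⟩
        simp at hx; subst hx
        rw [B.2.2, hB]; simp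
      · rintro ⟨h1, h2⟩
        refine ⟨⟨A, fun i => (h1 i).1, h2⟩, ?_, rfl⟩
        rw [hp]
        ext j
        show A v j = 0
        rw [h2, (h1 j).2 v (by simp)]; simp
    have h2 := LinearMap.finrank_range_add_finrank_ker p
    rw [hr, h1] at h2
    have h3 := LinearEquiv.finrank_eq ((Skew W).equivSubtypeMap (LinearMap.ker p))
    rw [hk, ih _ h1] at h3
    rw [← h2, h3, Nat.choose_succ_succ' D 1]
    simp

/-- trivially determined families -/
def Sk (W : Submodule ℝ (V → ℝ)) (Y : Finset V) : Submodule ℝ (V → V → ℝ) := Skew W ⊔ Zr W Y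

theorem mem_Sk {W : Submodule ℝ (V → ℝ)} {Y : Finset V} {Q : V → V → ℝ} :
    Q ∈ Sk W Y ↔ (∀ i, Q i ∈ W) ∧ ∃ A ∈ Skew W, ∀ i ∈ Y, Q i = A i := by
  rw [Sk, Submodule.mem_sup]
  constructor
  · rintro ⟨A, hA, B, hB, rfl⟩
    exact ⟨fun i => W.add_mem (hA.1 i) (hB.1 i), A, hA, fun i hi => by simp [hB.2 i hi]⟩
  · rintro ⟨h, A, hA, h'⟩
    refine ⟨A, hA, Q - A, ⟨fun i => W.sub_mem (h i) (hA.1 i), fun i hi => ?_⟩, by simp⟩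
    simp [h' i hi]

theorem finrank_Sk {W : Submodule ℝ (V → ℝ)} {Y : Finset V}
    (hinj : ∀ w ∈ W, (∀ x ∈ Y, w x = 0) → w = 0) :
    Module.finrank ℝ (Sk W Y) + Y.card * Module.finrank ℝ W
      = Fintype.card V * Module.finrank ℝ W + (Module.finrank ℝ W).choose 2 := by
  have h1 := Submodule.finrank_sup_add_finrank_inf_eq (Skew W) (Zr W Y)
  have h2 : Skew W ⊓ Zr W Y = ⊥ := by
    rw [eq_bot_iff]
    rintro Q ⟨⟨a1, a2⟩, ⟨b1, b2⟩⟩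
    rw [Submodule.mem_bot]
    ext i : 1
    apply hinj _ (a1 i)
    intro x hx
    rw [a2, b2 x hx]; simp
  rw [h2, finrank_bot, finrank_skew _ W rfl] at h1
  have := finrank_Zr W Y
  rw [Sk]
  omega

theorem Sk_le_Kc {W : Submodule ℝ (V → ℝ)} {Y : Finset V} {C : Finset (Finset V)}
    (hC : ∀ A ∈ C, A ⊆ Y) : Sk W Y ≤ Kc W C := by
  intro Q hQ
  rw [mem_Sk] at hQ
  obtain ⟨h, A, hA, hA'⟩ := hQ
  refine ⟨h, fun B hB => ?_⟩
  rw [← cf_skew hA B, cf_apply, cf_apply]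
  refine Finset.sum_congr rfl (fun i hi => ?_)
  rw [hA' i (hC B hB hi)]

theorem Kc_mono {W : Submodule ℝ (V → ℝ)} {C C' : Finset (Finset V)} (h : C' ⊆ C) :
    Kc W C ≤ Kc W C' := fun _ hQ => ⟨hQ.1, fun A hA => hQ.2 A (h hA)⟩

theorem finrank_Kc_le {W : Submodule ℝ (V → ℝ)} {C C' : Finset (Finset V)} (h : C' ⊆ C) :
    Module.finrank ℝ (Kc W C') + C'.card ≤ Module.finrank ℝ (Kc W C) + C.card := by
  let T : Kc W C' →ₗ[ℝ] (↥(C \ C') → ℝ) :=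
    (LinearMap.pi (fun A : ↥(C \ C') => cf A.1)) ∘ₗ (Kc W C').subtype
  have hk : (LinearMap.ker T).map (Kc W C').subtype = Kc W C := by
    ext Q
    simp only [Submodule.mem_map, LinearMap.mem_ker, Submodule.subtype_apply]
    constructor
    · rintro ⟨B, hB, rfl⟩
      refine ⟨B.2.1, fun A hA => ?_⟩
      by_cases hA' : A ∈ C'
      · exact B.2.2 A hA'
      · exact congrFun hB ⟨A, Finset.mem_sdiff.2 ⟨hA, hA'⟩⟩
    · intro hQ
      refine ⟨⟨Q, Kc_mono h hQ⟩, ?_, rfl⟩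
      ext A
      exact hQ.2 A.1 (Finset.mem_sdiff.1 A.2).1
  have h1 := LinearMap.finrank_range_add_finrank_ker T
  have h2 := LinearEquiv.finrank_eq ((Kc W C').equivSubtypeMap (LinearMap.ker T))
  rw [hk] at h2
  have h3 := Submodule.finrank_le (LinearMap.range T)
  rw [Module.finrank_fintype_fun_eq_card, Fintype.card_coe, Finset.card_sdiff_of_subset h] at h3
  have := Finset.card_le_card h
  omega

theorem Kc_empty (W : Submodule ℝ (V → ℝ)) : Kc W ∅ = Zr W ∅ := by
  ext Q; constructor
  · intro h; exact ⟨h.1, by simp⟩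
  · intro h; exact ⟨h.1, by simp⟩

theorem finrank_Kc_empty (W : Submodule ℝ (V → ℝ)) :
    Module.finrank ℝ (Kc W ∅) = Fintype.card V * Module.finrank ℝ W := by
  rw [Kc_empty, ← finrank_Zr W ∅]; simp

/-- independence of cells gives the exact rank -/
theorem finrank_Kc_of_surj {W : Submodule ℝ (V → ℝ)} {C : Finset (Finset V)}
    (h : ∀ c : Finset V → ℝ, (∀ Q : V → V → ℝ, (∀ i, Q i ∈ W) → ∑ A ∈ C, c A * cf A Q = 0) →
      ∀ A ∈ C, c A = 0) :
    Module.finrank ℝ (Kc W C) + C.card = Fintype.card V * Module.finrank ℝ W := by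
  let T : Kc W ∅ →ₗ[ℝ] (↥C → ℝ) :=
    (LinearMap.pi (fun A : ↥C => cf A.1)) ∘ₗ (Kc W ∅).subtype
  have hk : (LinearMap.ker T).map (Kc W ∅).subtype = Kc W C := by
    ext Q
    simp only [Submodule.mem_map, LinearMap.mem_ker, Submodule.subtype_apply]
    constructor
    · rintro ⟨B, hB, rfl⟩
      exact ⟨B.2.1, fun A hA => congrFun hB ⟨A, hA⟩⟩
    · intro hQ
      refine ⟨⟨Q, Kc_mono (by simp) hQ⟩, ?_, rfl⟩
      ext A
      exact hQ.2 A.1 A.2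
  have hs : LinearMap.range T = ⊤ := by
    by_contra hne
    obtain ⟨c, hc, h0⟩ := exists_coef T hne
    apply hc
    ext A
    have := h (fun B => if hB : B ∈ C then c ⟨B, hB⟩ else 0) (by
      intro Q hQ
      rw [← h0 ⟨Q, hQ, by simp⟩, ← Finset.sum_coe_sort]
      refine Finset.sum_congr rfl (fun B _ => ?_)
      simp [T]) A.1 A.2
    simpa using this
  have h1 := LinearMap.finrank_range_add_finrank_ker T
  have h2 := LinearEquiv.finrank_eq ((Kc W ∅).equivSubtypeMap (LinearMap.ker T))
  rw [hs, finrank_top, Module.finrank_fintype_fun_eq_card, Fintype.card_coe, finrank_Kc_empty] at h1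
  rw [hk] at h2
  omega

def cells (W : Submodule ℝ (V → ℝ)) (X : Finset V) : Finset (Finset V) := fs W X 1 ∪ fs W X 2

def Rigid (W : Submodule ℝ (V → ℝ)) (X : Finset V) : Prop := Kc W (cells W X) ≤ Sk W X

theorem cells_sub {W : Submodule ℝ (V → ℝ)} {X A : Finset V} (h : A ∈ cells W X) : A ⊆ X := by
  rw [cells, Finset.mem_union, mem_fs, mem_fs] at h
  rcases h with h | h <;> exact h.1.1

theorem card_cells {W : Submodule ℝ (V → ℝ)} {X : Finset V} (hP : Poly W X) :
    (cells W X).card = X.card + (fs W X 2).card := by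
  rw [cells, Finset.card_union_of_disjoint, hP.fs1]
  rw [Finset.disjoint_left]
  intro A h1 h2
  rw [mem_fs] at h1 h2
  omega

theorem single_mem_cells {W : Submodule ℝ (V → ℝ)} {X : Finset V} (hP : Poly W X) {x : V}
    (hx : x ∈ X) : {x} ∈ cells W X :=
  Finset.mem_union_left _ (mem_fs.2 ⟨hP.vx x hx, hP.finrank_van1 hx⟩)

theorem pair_mem_fs2 {W : Submodule ℝ (V → ℝ)} {X : Finset V} (hP : Poly W X) {x j : V}
    (hx : x ∈ X) (hj : j ∈ nb W X x) : {x, j} ∈ fs W X 2 :=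
  mem_fs.2 ⟨(mem_nb.1 hj).2.2, hP.finrank_van2 hx (mem_nb.1 hj).1 (mem_nb.1 hj).2.1.symm⟩

theorem pair_mem_cells {W : Submodule ℝ (V → ℝ)} {X : Finset V} (hP : Poly W X) {x j : V}
    (hx : x ∈ X) (hj : j ∈ nb W X x) : {x, j} ∈ cells W X :=
  Finset.mem_union_right _ (pair_mem_fs2 hP hx hj)

/-- shape of cells -/
theorem cells_cases {W : Submodule ℝ (V → ℝ)} {X A : Finset V} (hP : Poly W X)
    (h : A ∈ cells W X) : (∃ x ∈ X, A = {x}) ∨ (∃ x ∈ X, ∃ j ∈ nb W X x, A = {x, j}) := by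
  rw [cells, Finset.mem_union, mem_fs, mem_fs] at h
  rcases h with h | h
  · obtain ⟨x, rfl⟩ := Finset.card_eq_one.1 (hP.card_small (by norm_num) h.1.1 h.2)
    exact Or.inl ⟨x, h.1.1 (by simp), rfl⟩
  · obtain ⟨x, j, hxj, rfl⟩ := Finset.card_eq_two.1 (hP.card_small (by norm_num) h.1.1 h.2)
    exact Or.inr ⟨x, h.1.1 (by simp), j, mem_nb.2 ⟨h.1.1 (by simp), hxj.symm, h.1⟩, rfl⟩

theorem cells_at {W : Submodule ℝ (V → ℝ)} {X : Finset V} (hP : Poly W X) {i : V} (hi : i ∈ X) :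
    (cells W X).filter (fun A => i ∈ A) = insert {i} ((nb W X i).image (fun j => {i, j})) := by
  ext A
  simp only [Finset.mem_filter, Finset.mem_insert, Finset.mem_image]
  constructor
  · rintro ⟨hA, hiA⟩
    rcases cells_cases hP hA with ⟨x, hx, rfl⟩ | ⟨x, hx, j, hj, rfl⟩
    · simp at hiA; subst hiA; exact Or.inl rfl
    · right
      simp at hiA
      rcases hiA with rfl | rfl
      · exact ⟨j, hj, rfl⟩
      · exact ⟨x, nb_symm hj, Finset.pair_comm _ _⟩
  · rintro (rfl | ⟨j, hj, rfl⟩)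
    · exact ⟨single_mem_cells hP hi, by simp⟩
    · exact ⟨pair_mem_cells hP hi hj, by simp⟩

theorem cf_row (A : Finset V) (i : V) (w : V → ℝ) :
    cf A (Pi.single i w) = if i ∈ A then ∑ j ∈ A, w j else 0 := by
  rw [cf_apply]
  have : ∀ i' ∈ A, ∑ j ∈ A, (Pi.single i w : V → V → ℝ) i' j = if i' = i then ∑ j ∈ A, w j else 0 := by
    intro i' _
    by_cases h : i' = i
    · subst h; simp
    · simp [h, Pi.single_eq_of_ne h]
  rw [Finset.sum_congr rfl this, Finset.sum_ite_eq']

theorem Poly.rigid3 {W : Submodule ℝ (V → ℝ)} {X : Finset V} (hP : Poly W X)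
    (h4 : Module.finrank ℝ W = 4) (hsim : ∀ G, Fct W X G → G.card = 3) : Rigid W X := by
  have hind : Module.finrank ℝ (Kc W (cells W X)) + (cells W X).card
      = Fintype.card V * Module.finrank ℝ W := by
    apply finrank_Kc_of_surj
    intro c hc
    have hrow : ∀ i ∈ X, ∀ w ∈ W, c {i} * w i + ∑ j ∈ nb W X i, c {i, j} * (w i + w j) = 0 := by
      intro i hi w hw
      have := hc (Pi.single i w) (by
        intro i'
        by_cases h : i' = i
        · subst h; simpa using hw
        · rw [Pi.single_eq_of_ne h]; exact W.zero_mem)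
      simp only [cf_row, mul_ite, mul_zero] at this
      rw [← Finset.sum_filter, cells_at hP hi, Finset.sum_insert, Finset.sum_image] at this
      · rw [← this]
        congr 1
        · simp
        · refine Finset.sum_congr rfl (fun j hj => ?_)
          rw [Finset.sum_pair (mem_nb.1 hj).2.1.symm]
      · intro a ha b hb hab
        have h1 := (mem_nb.1 ha).2.1
        have hab' : ({i, a} : Finset V) = {i, b} := hab
        have : a ∈ ({i, b} : Finset V) := by rw [← hab']; simp
        simp at this
        exact this.resolve_left h1
      · intro h
        obtain ⟨j, hj, he⟩ := Finset.mem_image.1 h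
        have : j ∈ ({i} : Finset V) := by rw [← he]; simp
        exact (mem_nb.1 hj).2.1 (by simpa using this)
    have hd := hP.dehn h4 (fun i j => c {i, j}) (fun i j => by rw [Finset.pair_comm]) (by
      rintro i hi w ⟨hw, hwi⟩
      have h0 := hwi i (by simp)
      have := hrow i hi w hw
      rw [h0] at this
      simpa using this)
    obtain ⟨u, hu, -, -, u2⟩ := hP.pt.pos
    intro A hA
    rcases cells_cases hP hA with ⟨x, hx, rfl⟩ | ⟨x, hx, j, hj, rfl⟩
    · have := hrow x hx u hu
      rw [Finset.sum_eq_zero (fun j hj => by rw [hd x hx j hj, zero_mul]), add_zero] at this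
      exact (mul_eq_zero.1 this).resolve_right (u2 x hx (by simp)).ne'
    · exact hd x hx j hj
  have h1 := hP.sweep h4
  have h2 := hP.sum_facets4 h4
  have h3 : ∑ f ∈ facets W X, f.card = 3 * (facets W X).card := by
    rw [Finset.sum_congr rfl (fun f hf => hsim f (mem_facets.1 hf))]; simp [mul_comm]
  have h5 := finrank_Sk (W := W) (Y := X) hP.inj
  have h6 := card_cells hP
  rw [h4] at h5 hind
  have h7 : Nat.choose 4 2 = 6 := by decide
  rw [h7] at h5
  have := Submodule.eq_of_le_of_finrank_eq (Sk_le_Kc (W := W) (Y := X) (C := cells W X)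
    (fun A hA => cells_sub hA)) (by omega)
  exact this.ge

end Core6

section Core7
open scoped Classical
set_option linter.all false
variable {V : Type} [Fintype V]

def stc (W : Submodule ℝ (V → ℝ)) (X : Finset V) (v : V) : Finset (Finset V) :=
  cells (van W {v}) (nb W X v) ∪ (cells W X).filter (fun A => v ∈ A)

theorem notMem_nb {W : Submodule ℝ (V → ℝ)} {X : Finset V} {v : V} : v ∉ nb W X v :=
  fun h => (mem_nb.1 h).2.1 rfl

theorem nb_sub {W : Submodule ℝ (V → ℝ)} {X : Finset V} {v : V} : nb W X v ⊆ X :=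
  fun _ h => (mem_nb.1 h).1

theorem card_stc {W : Submodule ℝ (V → ℝ)} {X : Finset V} (hP : Poly W X) {v : V} (hv : v ∈ X) :
    (stc W X v).card = 2 * (nb W X v).card + 1 + (fs (van W {v}) (nb W X v) 2).card := by
  rw [stc, Finset.card_union_of_disjoint, card_cells (hP.link hv), cells_at hP hv,
    Finset.card_insert_of_notMem, Finset.card_image_of_injOn]
  · ring
  · intro a ha b hb hab
    have h1 := (mem_nb.1 ha).2.1
    have hab' : ({v, a} : Finset V) = {v, b} := hab
    have : a ∈ ({v, b} : Finset V) := by rw [← hab']; simp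
    simp at this
    exact this.resolve_left h1
  · intro h
    obtain ⟨j, hj, he⟩ := Finset.mem_image.1 h
    have : j ∈ ({v} : Finset V) := by rw [← he]; simp
    exact (mem_nb.1 hj).2.1 (by simpa using this)
  · rw [Finset.disjoint_left]
    intro A h1 h2
    exact notMem_nb (cells_sub h1 (Finset.mem_filter.1 h2).2)

theorem cone {W : Submodule ℝ (V → ℝ)} {X : Finset V} (hP : Poly W X) {v : V} (hv : v ∈ X)
    (hr : Rigid (van W {v}) (nb W X v)) : Kc W (stc W X v) ≤ Sk W (insert v (nb W X v)) := by
  rintro Q ⟨hQ, hQc⟩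
  have hat : ∀ A ∈ (cells W X).filter (fun A => v ∈ A), cf A Q = 0 :=
    fun A hA => hQc A (Finset.mem_union_right _ hA)
  have hln : ∀ A ∈ cells (van W {v}) (nb W X v), cf A Q = 0 :=
    fun A hA => hQc A (Finset.mem_union_left _ hA)
  rw [cells_at hP hv] at hat
  have hPl := hP.link hv
  have h0 : Q v v = 0 := by
    have := hat {v} (by simp)
    rwa [cf_single] at this
  have hj0 : ∀ j ∈ nb W X v, Q j j = 0 := by
    intro j hj
    have := hln {j} (single_mem_cells hPl hj)
    rwa [cf_single] at this
  have hvj : ∀ j ∈ nb W X v, Q v j + Q j v = 0 := by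
    intro j hj
    have := hat {v, j} (Finset.mem_insert_of_mem (Finset.mem_image.2 ⟨j, hj, rfl⟩))
    rw [cf_pair (mem_nb.1 hj).2.1.symm, h0, hj0 j hj] at this
    linarith
  obtain ⟨u0, hu0, -, -, hpos⟩ := hP.pt.pos
  have hu0v := hpos v hv (by simp)
  set u : V → ℝ := (u0 v)⁻¹ • u0 with hu
  have huW : u ∈ W := W.smul_mem _ hu0
  have huv : u v = 1 := by simp [hu, hu0v.ne']
  let A0 : V → V → ℝ := fun i => u i • Q v - Q v i • u
  have hA0 : A0 ∈ Skew W := by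
    refine ⟨fun i => W.sub_mem (W.smul_mem _ (hQ v)) (W.smul_mem _ huW), fun i j => ?_⟩
    simp only [A0, Pi.sub_apply, Pi.smul_apply, smul_eq_mul]; ring
  let Q2 : V → V → ℝ := fun i => if i ∈ nb W X v then Q i - A0 i else 0
  have hQ2 : Q2 ∈ Kc (van W {v}) (cells (van W {v}) (nb W X v)) := by
    refine ⟨fun i => ?_, fun A hA => ?_⟩
    · by_cases hi : i ∈ nb W X v
      · simp only [Q2, if_pos hi]
        refine ⟨W.sub_mem (hQ i) (hA0.1 i), fun x hx => ?_⟩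
        simp at hx; subst hx
        simp only [A0, Pi.sub_apply, Pi.smul_apply, smul_eq_mul]
        rw [h0, huv]
        have := hvj i hi
        linarith
      · simp only [Q2, if_neg hi]; exact Submodule.zero_mem _
    · have hs := cells_sub hA
      have : cf A Q2 = cf A (Q - A0) := by
        rw [cf_apply, cf_apply]
        refine Finset.sum_congr rfl (fun i hi => ?_)
        simp only [Q2, if_pos (hs hi)]; rfl
      rw [this, map_sub, hln A hA, cf_skew hA0, sub_zero]
  have := hr hQ2
  rw [mem_Sk] at this ⊢
  obtain ⟨-, B, hB, hB'⟩ := this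
  refine ⟨hQ, A0 + B, (Skew W).add_mem hA0 ⟨fun i => (hB.1 i).1, hB.2⟩, ?_⟩
  intro i hi
  rw [Finset.mem_insert] at hi
  rcases hi with rfl | hi
  · have hBi : B i = 0 := by
      ext j
      rw [hB.2, (hB.1 j).2 i (by simp)]; simp
    rw [Pi.add_apply, hBi, add_zero]
    ext j
    simp [A0, huv, h0]
  · have := hB' i hi
    simp only [Q2, if_pos hi] at this
    rw [Pi.add_apply, ← this]; abel

theorem skew_glue {W : Submodule ℝ (V → ℝ)} {G : Finset V}
    (h1 : Module.finrank ℝ (van W G) = 1) {A B : V → V → ℝ} (hA : A ∈ Skew W) (hB : B ∈ Skew W)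
    (h : ∀ i ∈ G, A i = B i) : A = B := by
  have hD : A - B ∈ Skew W := (Skew W).sub_mem hA hB
  set D := A - B with hDd
  have hD0 : ∀ i ∈ G, D i = 0 := fun i hi => by simp [hDd, h i hi]
  have hDv : ∀ i, D i ∈ van W G := fun i => ⟨hD.1 i, fun x hx => by rw [hD.2, hD0 x hx]; simp⟩
  obtain ⟨l, hl0, hl⟩ := finrank_eq_one_iff'.1 h1
  obtain ⟨j, hj⟩ : ∃ j, l.1 j ≠ 0 := by
    by_contra hcon; push Not at hcon; exact hl0 (Subtype.ext (funext hcon))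
  have hrow : ∀ i, ∃ a : ℝ, D i = a • l.1 := by
    intro i
    obtain ⟨a, ha⟩ := hl ⟨D i, hDv i⟩
    exact ⟨a, by rw [← Submodule.coe_smul, ha]⟩
  have hjz : D j = 0 := by
    obtain ⟨a, ha⟩ := hrow j
    have h2 : D j j = 0 := by have := hD.2 j j; linarith
    rw [ha] at h2 ⊢
    simp [hj] at h2
    simp [h2]
  have hz : D = 0 := by
    ext i : 1
    obtain ⟨a, ha⟩ := hrow i
    have h2 : D i j = 0 := by rw [hD.2, hjz]; simp
    rw [ha] at h2 ⊢
    simp [hj] at h2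
    simp [h2]
  exact sub_eq_zero.1 hz

structure Asp (d : ℕ) (W : Submodule ℝ (V → ℝ)) (X F : Finset V) : Prop where
  poly : Poly W X
  fr : Module.finrank ℝ W = d + 1
  fF : Fct W X F
  simp : ∀ G, Fct W X G → G ≠ F → G.card = d

structure Smp (d : ℕ) (W : Submodule ℝ (V → ℝ)) (X : Finset V) : Prop where
  poly : Poly W X
  fr : Module.finrank ℝ W = d + 1
  simp : ∀ G, Fct W X G → G.card = d

variable {d : ℕ} {W : Submodule ℝ (V → ℝ)} {X F : Finset V}

theorem Poly.card_pos (hP : Poly W X) (h : Module.finrank ℝ W ≠ 0) : X.Nonempty := by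
  by_contra hne
  rw [Finset.not_nonempty_iff_eq_empty] at hne
  apply h
  rw [Submodule.finrank_eq_zero, eq_bot_iff]
  intro w hw
  exact hP.inj w hw (by simp [hne])

theorem Smp.asp (h : Smp d W X) : ∃ F, Asp d W X F ∧ F.card = d := by
  have hne := h.poly.card_pos (by rw [h.fr]; omega)
  obtain ⟨G, -, hG⟩ := h.poly.exists_facet h.poly.pt hne.ne_empty.symm
  exact ⟨G, ⟨h.poly, h.fr, hG, fun G' hG' _ => h.simp G' hG'⟩, h.simp G hG⟩

theorem Asp.ind_facet (h : Asp d W X F) {G : Finset V} (hG : Fct W X G) (hne : G ≠ F) :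
    Ind W G := ind_of_finrank (by rw [hG.2, h.simp G hG hne, h.fr]; omega)

theorem Asp.ind_face (h : Asp d W X F) {A : Finset V} (hA : Fc W X A) (hX : A ≠ X) (hF : A ≠ F) :
    Ind W A := by
  obtain ⟨G, hAG, hG, hne⟩ := h.poly.exists_facet_ne hA hX h.fF hF
  exact (h.ind_facet hG hne).mono hAG

theorem Poly.van_self (hP : Poly W X) : van W X = ⊥ := by
  rw [eq_bot_iff]; intro w hw; exact hP.inj w hw.1 hw.2

/-- a face of intermediate rank is a simplex -/
theorem Asp.ind_fs (h : Asp d W X F) {A : Finset V} {k : ℕ} (hk : k < d) (hA : A ∈ fs W X k) :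
    Ind W A ∧ A.card = k := by
  rw [mem_fs] at hA
  have hI : Ind W A := by
    apply h.ind_face hA.1
    · rintro rfl
      have := hA.2
      rw [h.poly.van_self, h.fr] at this
      simp at this; omega
    · rintro rfl
      have := hA.2
      rw [h.fF.2, h.fr] at this
      omega
  refine ⟨hI, ?_⟩
  have := hI.finrank
  omega

theorem ind_nb {G : Finset V} (hP : Poly W X) (hG : Fc W X G) (hI : Ind W G) {v : V} (hv : v ∈ G) :
    G ∩ nb W X v = G.erase v := by
  ext x
  simp only [Finset.mem_inter, Finset.mem_erase]
  constructor
  · rintro ⟨h1, h2⟩; exact ⟨(mem_nb.1 h2).2.1, h1⟩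
  · rintro ⟨h1, h2⟩
    refine ⟨h2, mem_nb.2 ⟨hG.1 h2, h1, hG.of_ind hI ?_⟩⟩
    intro y hy; simp at hy; rcases hy with rfl | rfl <;> assumption

theorem link_fct (hP : Poly W X) {v : V} (hv : v ∈ X) {B : Finset V}
    (hB : Fct (van W {v}) (nb W X v) B) : ∃ A, v ∈ A ∧ Fct W X A ∧ B = A ∩ nb W X v := by
  obtain ⟨A, hvA, hA, rfl⟩ := (fc_link_iff hP hv).1 hB.1
  refine ⟨A, hvA, ⟨hA, ?_⟩, rfl⟩
  rw [← van_link hP hA hvA]; exact hB.2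

theorem Asp.link_out (h : Asp (d + 1) W X F) {v : V} (hv : v ∈ X) (hvF : v ∉ F) :
    Smp d (van W {v}) (nb W X v) := by
  refine ⟨h.poly.link hv, by have := h.poly.finrank_van1 hv; have := h.fr; omega, ?_⟩
  intro B hB
  obtain ⟨A, hvA, hA, rfl⟩ := link_fct h.poly hv hB
  have hne : A ≠ F := by rintro rfl; exact hvF hvA
  rw [ind_nb h.poly hA.1 (h.ind_facet hA hne) hvA, Finset.card_erase_of_mem hvA, h.simp A hA hne]
  omega

theorem Asp.link_in (h : Asp (d + 1) W X F) {v : V} (hvF : v ∈ F) :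
    Asp d (van W {v}) (nb W X v) (F ∩ nb W X v) := by
  have hv := h.fF.1.1 hvF
  refine ⟨h.poly.link hv, by have := h.poly.finrank_van1 hv; have := h.fr; omega, ?_, ?_⟩
  · exact ⟨fc_link_of h.fF.1 hvF, by rw [van_link h.poly h.fF.1 hvF]; exact h.fF.2⟩
  intro B hB hBne
  obtain ⟨A, hvA, hA, rfl⟩ := link_fct h.poly hv hB
  have hne : A ≠ F := by rintro rfl; exact hBne rfl
  rw [ind_nb h.poly hA.1 (h.ind_facet hA hne) hvA, Finset.card_erase_of_mem hvA, h.simp A hA hne]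
  omega

/-- link cells are cells, provided that dimension is at least four -/
theorem Asp.stc_sub (h : Asp d W X F) (hd : 4 ≤ d) {v : V} (hv : v ∈ X) :
    stc W X v ⊆ cells W X := by
  intro A hA
  rw [stc, Finset.mem_union] at hA
  rcases hA with hA | hA
  · rcases cells_cases (h.poly.link hv) hA with ⟨x, hx, rfl⟩ | ⟨x, hx, j, hj, rfl⟩
    · exact single_mem_cells h.poly (nb_sub hx)
    · have hx' := nb_sub hx
      have hmem := pair_mem_fs2 (h.poly.link hv) hx hj
      rw [mem_fs] at hmem
      obtain ⟨B, hvB, hB, he⟩ := (fc_link_iff h.poly hv).1 hmem.1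
      have hr := hmem.2
      rw [he, van_link h.poly hB hvB] at hr
      have h1 := h.poly.finrank_van1 hv
      have hB3 : B ∈ fs W X 3 := mem_fs.2 ⟨hB, by omega⟩
      have hI := (h.ind_fs (by omega) hB3).1
      have hsub : ({x, j} : Finset V) ⊆ B := by rw [he]; exact Finset.inter_subset_left
      refine pair_mem_cells h.poly hx' (mem_nb.2 ⟨nb_sub (mem_nb.1 hj).1, (mem_nb.1 hj).2.1, ?_⟩)
      exact hB.of_ind hI hsub
  · exact (Finset.mem_filter.1 hA).1

theorem Asp.rigid_of (h : Asp d W X F) (hd : 4 ≤ d)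
    (hl : ∀ v ∈ X, v ∉ F → Rigid (van W {v}) (nb W X v)) : Rigid W X := by
  intro Q hQ
  have hFX := h.fF.ne h.poly
  have hstar : ∀ v, ∃ A ∈ Skew W, v ∈ X → v ∉ F → ∀ i ∈ insert v (nb W X v), Q i = A i := by
    intro v
    by_cases hv : v ∈ X ∧ v ∉ F
    · have := cone h.poly hv.1 (hl v hv.1 hv.2) (Kc_mono (h.stc_sub hd hv.1) hQ)
      rw [mem_Sk] at this
      obtain ⟨-, A, hA, hA'⟩ := this
      exact ⟨A, hA, fun _ _ => hA'⟩
    · exact ⟨0, (Skew W).zero_mem, fun h1 h2 => absurd ⟨h1, h2⟩ hv⟩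
  choose A hA hAr using hstar
  have hadj : ∀ x ∈ X, x ∉ F → ∀ j ∈ nb W X x, j ∉ F → A x = A j := by
    intro x hx hxF j hj hjF
    have hj' := mem_nb.1 hj
    have hne : ({x, j} : Finset V) ≠ X := by
      intro he
      have h1 := h.poly.finrank_van2 hx hj'.1 hj'.2.1.symm
      rw [he, h.poly.van_self, h.fr] at h1
      simp at h1; omega
    obtain ⟨G, hsub, hG⟩ := h.poly.exists_facet hj'.2.2 hne
    have hxG : x ∈ G := hsub (by simp)
    have hjG : j ∈ G := hsub (by simp)
    have hGF : G ≠ F := by rintro rfl; exact hxF hxG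
    have hI := h.ind_facet hG hGF
    refine skew_glue hG.2 (hA x) (hA j) (fun i hi => ?_)
    have key : ∀ v ∈ G, i ∈ insert v (nb W X v) := by
      intro v hv
      by_cases hiv : i = v
      · simp [hiv]
      · refine Finset.mem_insert_of_mem ?_
        have : i ∈ G ∩ nb W X v := by
          rw [ind_nb h.poly hG.1 hI hv]; exact Finset.mem_erase.2 ⟨hiv, hi⟩
        exact (Finset.mem_inter.1 this).2
    rw [← hAr x hx hxF i (key x hxG), ← hAr j hj'.1 hjF i (key j hjG)]
  obtain ⟨x0, hx0, hx0F⟩ : ∃ x ∈ X, x ∉ F := by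
    by_contra hcon; push Not at hcon
    exact hFX (Finset.Subset.antisymm h.fF.1.1 hcon)
  have hall : ∀ x ∈ X, x ∉ F → A x = A x0 := by
    intro x hx hxF
    have := h.poly.conn h.fF.1 (fun y => A y = A x0) (fun y hy hyF j hj hjF => by
      rw [hadj y hy hyF j hj hjF]) x hx hxF x0 hx0 hx0F
    exact this.2 rfl
  rw [mem_Sk]
  refine ⟨hQ.1, A x0, hA x0, fun i hi => ?_⟩
  by_cases hiF : i ∈ F
  · obtain ⟨j, hj, hjF⟩ := h.poly.nb_outside h.fF.1 hFX hiF
    rw [hAr j (nb_sub hj) hjF i (Finset.mem_insert_of_mem (nb_symm hj)), hall j (nb_sub hj) hjF]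
  · rw [hAr i hi hiF i (by simp), hall i hi hiF]

theorem Smp.rigid : ∀ (d : ℕ) {W : Submodule ℝ (V → ℝ)} {X : Finset V}, 3 ≤ d → Smp d W X → Rigid W X := by
  intro d
  induction d with
  | zero => intro W X h; omega
  | succ d ih =>
    intro W X hd h
    by_cases h3 : d = 2
    · subst h3
      exact h.poly.rigid3 h.fr h.simp
    · obtain ⟨F, hF, -⟩ := h.asp
      exact hF.rigid_of (by omega) (fun v hv hvF => ih (by omega) (hF.link_out hv hvF))

theorem Asp.rigid (h : Asp d W X F) (hd : 4 ≤ d) : Rigid W X := by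
  obtain ⟨d, rfl⟩ : ∃ e, d = e + 1 := ⟨d - 1, by omega⟩
  exact h.rigid_of hd (fun v hv hvF => Smp.rigid d (by omega) (h.link_out hv hvF))

/-- excess -/
def exc (d : ℕ) (W : Submodule ℝ (V → ℝ)) (X : Finset V) : ℤ :=
  ((fs W X 2).card : ℤ) - d * X.card + ((d + 1).choose 2 : ℕ)

theorem rigid_exc (hP : Poly W X) (hfr : Module.finrank ℝ W = d + 1) (hr : Rigid W X) :
    (Module.finrank ℝ (Kc W (cells W X)) : ℤ) + (cells W X).card
      = Fintype.card V * (d + 1) + exc d W X := by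
  have h1 : Kc W (cells W X) = Sk W X := le_antisymm hr (Sk_le_Kc (fun A hA => cells_sub hA))
  have h2 := finrank_Sk (W := W) (Y := X) hP.inj
  have h3 := card_cells hP
  rw [h1, exc, h3]
  rw [hfr] at h2
  have h2' := congrArg (Nat.cast : ℕ → ℤ) h2
  push_cast at h2' ⊢
  linarith

theorem exc_nonneg (hP : Poly W X) (hfr : Module.finrank ℝ W = d + 1) (hr : Rigid W X) :
    0 ≤ exc d W X := by
  have h1 := rigid_exc hP hfr hr
  have h2 := finrank_Kc_le (W := W) (C := cells W X) (C' := ∅) (by simp)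
  rw [finrank_Kc_empty, hfr] at h2
  zify at h2
  simp at h2
  linarith

theorem Asp.exc_link (h : Asp (d + 1) W X F) (hd : 4 ≤ d) {v : V} (hv : v ∈ X) :
    exc d (van W {v}) (nb W X v) ≤ exc (d + 1) W X := by
  have hrl : Rigid (van W {v}) (nb W X v) := by
    by_cases hvF : v ∈ F
    · exact (h.link_in hvF).rigid hd
    · exact Smp.rigid d (by omega) (h.link_out hv hvF)
  have hst := cone h.poly hv hrl
  have h1 := rigid_exc h.poly h.fr (h.rigid (by omega))
  have h2 := finrank_Kc_le (W := W) (h.stc_sub (by omega) hv)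
  have h3 : Kc W (stc W X v) = Sk W (insert v (nb W X v)) := by
    refine le_antisymm hst (Sk_le_Kc (fun A hA => ?_))
    rw [stc, Finset.mem_union] at hA
    rcases hA with hA | hA
    · exact (cells_sub hA).trans (Finset.subset_insert _ _)
    · rw [cells_at h.poly hv, Finset.mem_insert, Finset.mem_image] at hA
      rcases hA with rfl | ⟨j, hj, rfl⟩
      · simp
      · intro x hx; simp at hx; rcases hx with rfl | rfl
        · simp
        · exact Finset.mem_insert_of_mem hj
  have h4 := finrank_Sk (W := W) (Y := insert v (nb W X v)) (fun w hw h0 => by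
    apply h.poly.inj w hw
    exact h.poly.neighbor_zero Fc.self hv hw (h0 v (by simp))
      (fun j hj _ => h0 j (Finset.mem_insert_of_mem hj)))
  have h5 := card_stc h.poly hv
  rw [Finset.card_insert_of_notMem notMem_nb, h.fr, Nat.choose_succ_succ' (d + 1) 1,
    Nat.choose_one_right] at h4
  rw [h3] at h2
  simp only [exc] at h1 ⊢
  rw [Nat.choose_succ_succ' (d + 1) 1, Nat.choose_one_right] at h1 ⊢
  zify at h2 h4 h5
  rw [h5] at h2
  push_cast at *
  linarith

end Core7

section Core8
open scoped Classical
set_option linter.all false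
variable {V : Type} [Fintype V]
variable {d : ℕ} {W : Submodule ℝ (V → ℝ)} {X F B : Finset V}

theorem finrank_map_ker {M N : Type} [AddCommGroup M] [Module ℝ M] [AddCommGroup N] [Module ℝ N]
    [FiniteDimensional ℝ M] (f : M →ₗ[ℝ] N) (p : Submodule ℝ M) :
    Module.finrank ℝ (p.map f) + Module.finrank ℝ (p ⊓ LinearMap.ker f : Submodule ℝ M)
      = Module.finrank ℝ p := by
  have h := LinearMap.finrank_range_add_finrank_ker (f ∘ₗ p.subtype)
  have h1 : LinearMap.range (f ∘ₗ p.subtype) = p.map f := by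
    rw [LinearMap.range_comp, Submodule.range_subtype]
  have h2 : (LinearMap.ker (f ∘ₗ p.subtype)).map p.subtype = p ⊓ LinearMap.ker f := by
    rw [LinearMap.ker_comp, Submodule.map_comap_subtype]
  rw [h1] at h
  rw [← h2, Submodule.finrank_map_subtype_eq] 
  exact h
  
theorem van_res (hB : B ⊆ F) : (van W B).map (resA F) = van (W.map (resA F)) B := by
  ext w
  constructor
  · rintro ⟨u, hu, rfl⟩
    exact ⟨Submodule.mem_map_of_mem hu.1, fun x hx => by rw [resA_apply F u (hB hx)]; exact hu.2 x hx⟩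
  · rintro ⟨⟨u, hu, rfl⟩, h⟩
    exact Submodule.mem_map_of_mem ⟨hu, fun x hx => by rw [← resA_apply F u (hB hx)]; exact h x hx⟩

theorem mem_ker_resA {w : V → ℝ} : w ∈ LinearMap.ker (resA F) ↔ ∀ x ∈ F, w x = 0 := by
  rw [LinearMap.mem_ker]
  constructor
  · intro h x hx; rw [← resA_apply F w hx, h]; rfl
  · intro h; ext x; by_cases hx : x ∈ F
    · rw [resA_apply F w hx, h x hx]; rfl
    · simp [resA, hx]

theorem van_ker (hB : B ⊆ F) : van W B ⊓ LinearMap.ker (resA F) = van W F := by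
  ext w
  rw [Submodule.mem_inf, mem_ker_resA]
  exact ⟨fun h => ⟨h.1.1, h.2⟩, fun h => ⟨van_anti hB h, h.2⟩⟩

theorem W_ker : W ⊓ LinearMap.ker (resA F) = van W F := by
  ext w
  rw [Submodule.mem_inf, mem_ker_resA]; rfl

theorem finrank_res (hF : Fct W X F) :
    Module.finrank ℝ (W.map (resA F)) + 1 = Module.finrank ℝ W := by
  rw [← finrank_map_ker (resA F) W, W_ker, hF.2]

theorem finrank_van_res (hF : Fct W X F) (hB : B ⊆ F) :
    Module.finrank ℝ (van (W.map (resA F)) B) + 1 = Module.finrank ℝ (van W B) := by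
  rw [← finrank_map_ker (resA F) (van W B), van_ker hB, hF.2, van_res hB]

theorem fc_res_iff (hF : Fc W X F) (hB : B ⊆ F) : Fc (W.map (resA F)) F B ↔ Fc W X B := by
  constructor
  · intro h
    obtain ⟨l, ⟨w, hw, rfl⟩, l0, l1, l2⟩ := h.pos
    refine hF.sub hB w hw (fun x hx => ?_) (fun x hx hxB => ?_)
    · rw [← resA_apply F w (hB hx)]; exact l1 x hx
    · rw [← resA_apply F w hx]; exact l2 x hx hxB
  · intro h
    have := h.res hF.1
    rwa [Finset.inter_eq_left.2 hB] at this

theorem fs_res (hF : Fct W X F) (k : ℕ) :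
    fs (W.map (resA F)) F k = (fs W X k).filter (fun A => A ⊆ F) := by
  ext B
  rw [Finset.mem_filter, mem_fs, mem_fs]
  have h1 := finrank_res hF
  constructor
  · rintro ⟨h, h'⟩
    have h2 := finrank_van_res hF h.1
    exact ⟨⟨(fc_res_iff hF.1 h.1).1 h, by omega⟩, h.1⟩
  · rintro ⟨⟨h, h'⟩, hs⟩
    have h2 := finrank_van_res hF hs
    exact ⟨(fc_res_iff hF.1 hs).2 h, by omega⟩

theorem nb_res (hF : Fct W X F) {v : V} (hv : v ∈ F) :
    nb (W.map (resA F)) F v = F ∩ nb W X v := by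
  ext x
  rw [Finset.mem_inter, mem_nb, mem_nb]
  constructor
  · rintro ⟨h1, h2, h3⟩
    exact ⟨h1, hF.1.1 h1, h2, (fc_res_iff hF.1 h3.1).1 h3⟩
  · rintro ⟨h1, h2, h3, h4⟩
    refine ⟨h1, h3, (fc_res_iff hF.1 ?_).2 h4⟩
    intro y hy; simp at hy; rcases hy with rfl | rfl <;> assumption

theorem Asp.facet_smp (h : Asp (d + 1) W X F) : Smp d (W.map (resA F)) F := by
  have h1 := finrank_res h.fF
  have hfr : Module.finrank ℝ (W.map (resA F)) = d + 1 := by have := h.fr; omega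
  refine ⟨h.poly.res h.fF.1.1, hfr, ?_⟩
  intro G hG
  have hG' : G ∈ fs (W.map (resA F)) F d := by rw [fs_facets hfr]; exact mem_facets.2 hG
  rw [fs_res h.fF, Finset.mem_filter] at hG'
  exact (h.ind_fs (by omega) hG'.1).2

theorem Asp.sum_F (h : Asp (d + 1) W X F) :
    ∑ v ∈ F, (F ∩ nb W X v).card = 2 * (fs (W.map (resA F)) F 2).card := by
  rw [← h.facet_smp.poly.sum_deg]
  exact Finset.sum_congr rfl (fun v hv => by rw [nb_res h.fF hv])

theorem Kc_res (C : Finset (Finset V)) (hC : ∀ A ∈ C, A ⊆ F) :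
    Module.finrank ℝ (Kc (W.map (resA F)) C) + Fintype.card V * Module.finrank ℝ (van W F)
      = Module.finrank ℝ (Kc W C) := by
  let T : (V → V → ℝ) →ₗ[ℝ] (V → V → ℝ) := LinearMap.pi (fun i => resA F ∘ₗ LinearMap.proj i)
  have hT : ∀ Q i, T Q i = resA F (Q i) := fun Q i => rfl
  have hcf : ∀ Q, ∀ A ∈ C, cf A (T Q) = cf A Q := by
    intro Q A hA
    rw [cf_apply, cf_apply]
    refine Finset.sum_congr rfl (fun i _ => Finset.sum_congr rfl (fun j hj => ?_))
    rw [hT, resA_apply F _ (hC A hA hj)]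
  have h1 : (Kc W C).map T = Kc (W.map (resA F)) C := by
    ext Q
    constructor
    · rintro ⟨R, hR, rfl⟩
      exact ⟨fun i => Submodule.mem_map_of_mem (hR.1 i), fun A hA => by rw [hcf R A hA]; exact hR.2 A hA⟩
    · rintro ⟨hQ, hQ'⟩
      choose R hR hR' using hQ
      have hTR : T R = Q := by ext i j; rw [hT, hR']
      exact ⟨R, ⟨hR, fun A hA => by rw [← hcf R A hA, hTR]; exact hQ' A hA⟩, hTR⟩
  have h2 : Kc W C ⊓ LinearMap.ker T = Kc (van W F) ∅ := by
    ext Q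
    have hk : Q ∈ LinearMap.ker T ↔ ∀ i, Q i ∈ LinearMap.ker (resA F) := by
      rw [LinearMap.mem_ker]
      constructor
      · intro h i; rw [LinearMap.mem_ker, ← hT, h]; rfl
      · intro h; funext i; rw [hT]; exact h i
    rw [Submodule.mem_inf, hk]
    constructor
    · rintro ⟨h, h'⟩
      exact ⟨fun i => ⟨h.1 i, mem_ker_resA.1 (h' i)⟩, by simp⟩
    · rintro ⟨h, -⟩
      refine ⟨⟨fun i => (h i).1, fun A hA => ?_⟩, fun i => mem_ker_resA.2 (h i).2⟩
      rw [cf_apply]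
      exact Finset.sum_eq_zero (fun i _ => Finset.sum_eq_zero (fun j hj => (h i).2 j (hC A hA hj)))
  have h3 := finrank_map_ker T (Kc W C)
  rw [h1, h2, finrank_Kc_empty] at h3
  exact h3

theorem Asp.exc_facet (h : Asp (d + 1) W X F) (hd : 3 ≤ d) :
    0 ≤ exc d (W.map (resA F)) F ∧ exc d (W.map (resA F)) F ≤ exc (d + 1) W X := by
  have hS := h.facet_smp
  have hr := Smp.rigid d hd hS
  refine ⟨exc_nonneg hS.poly hS.fr hr, ?_⟩
  have h1 := rigid_exc hS.poly hS.fr hr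
  have h2 := rigid_exc h.poly h.fr (h.rigid (by omega))
  have hsub : cells (W.map (resA F)) F ⊆ cells W X := by
    rw [cells, cells, fs_res h.fF, fs_res h.fF]
    exact Finset.union_subset_union (Finset.filter_subset _ _) (Finset.filter_subset _ _)
  have h3 := finrank_Kc_le (W := W) hsub
  rw [← Kc_res (F := F) _ (fun A hA => cells_sub hA), h.fF.2] at h3
  zify at h3
  push_cast at h2
  linarith

end Core8

section Core9
open scoped Classical
set_option linter.all false
variable {V : Type} [Fintype V]
variable {d : ℕ} {W : Submodule ℝ (V → ℝ)} {X F B : Finset V}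

def phiZ (d : ℕ) (n s : ℤ) (i : ℕ) : ℤ :=
  if i = 0 then n
  else if i ≤ d - 3 then (d.choose i : ℤ) * n - ((d + 1).choose (i + 1) : ℤ) * i
  else if i = d - 2 then
    (d.choose (d - 2) : ℤ) * n - ((d + 1).choose (d - 1) : ℤ) * ((d : ℤ) - 2) - s
  else ((d : ℤ) - 1) * n - ((d : ℤ) + 1) * ((d : ℤ) - 2) - s

def eZ (d : ℕ) (W : Submodule ℝ (V → ℝ)) (X : Finset V) (s : ℤ) (i : ℕ) : ℤ :=
  ((fs W X (i + 1)).card : ℤ) - phiZ d X.card s i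

def sv (d : ℕ) (W : Submodule ℝ (V → ℝ)) (X F : Finset V) (v : V) : ℤ :=
  if v ∈ F then ((F ∩ nb W X v).card : ℤ) - d else 0

theorem phiZ_low {n s : ℤ} {i : ℕ} (h1 : 1 ≤ i) (h : i ≤ d - 3) :
    phiZ d n s i = (d.choose i : ℤ) * n - ((d + 1).choose (i + 1) : ℤ) * i := by
  rw [phiZ, if_neg (by omega), if_pos h]

theorem phiZ_mid {n s : ℤ} (h : 1 ≤ d) :
    phiZ (d + 2) n s d = ((d + 2).choose d : ℤ) * n - ((d + 3).choose (d + 1) : ℤ) * d - s := by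
  rw [phiZ, if_neg (by omega), if_neg (by omega), if_pos (by omega)]
  simp

theorem phiZ_top {n s : ℤ} (h : 1 ≤ d) :
    phiZ (d + 2) n s (d + 1) = ((d : ℤ) + 1) * n - ((d : ℤ) + 3) * d - s := by
  rw [phiZ, if_neg (by omega), if_neg (by omega), if_neg (by omega)]
  push_cast; ring

theorem Asp.exc_eq (hd : 4 ≤ d) (s : ℤ) : eZ d W X s 1 = exc d W X := by
  rw [eZ, phiZ_low (le_refl 1) (by omega), exc]
  simp; ring

theorem Poly.sum_link (hP : Poly W X) (k : ℕ) :
    ∑ v ∈ X, (fs (van W {v}) (nb W X v) k).card = ∑ A ∈ fs W X (k + 1), A.card := by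
  have h1 := double_count (fs W X (k + 1)) X (fun g hg => (mem_fs.1 hg).1.1) (fun j _ => True)
  simp only [and_true, Finset.filter_true] at h1
  rw [h1]
  exact Finset.sum_congr rfl (fun v hv => (link_fs' hP hv k).symm)

theorem Asp.sum_low (h : Asp d W X F) {k : ℕ} (hk : k + 1 < d) :
    ∑ v ∈ X, (fs (van W {v}) (nb W X v) k).card = (k + 1) * (fs W X (k + 1)).card := by
  rw [h.poly.sum_link, Finset.sum_congr rfl (fun A hA => (h.ind_fs hk hA).2), Finset.sum_const,
    smul_eq_mul, mul_comm]

theorem Asp.sum_top (h : Asp (d + 1) W X F) :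
    ((∑ v ∈ X, (fs (van W {v}) (nb W X v) d).card : ℕ) : ℤ)
      = (d + 1) * ((fs W X (d + 1)).card - 1) + F.card := by
  rw [h.poly.sum_link, fs_facets h.fr]
  have hm : F ∈ facets W X := mem_facets.2 h.fF
  rw [← Finset.add_sum_erase _ _ hm, Finset.sum_congr rfl (fun A hA =>
    h.simp A (mem_facets.1 (Finset.mem_of_mem_erase hA)) (Finset.ne_of_mem_erase hA)),
    Finset.sum_const, Finset.card_erase_of_mem hm, smul_eq_mul]
  have : 1 ≤ (facets W X).card := Finset.card_pos.2 ⟨F, hm⟩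
  push_cast [this]; ring

theorem Asp.sum_sv (h : Asp (d + 1) W X F) :
    ∑ v ∈ X, sv d W X F v = 2 * exc d (W.map (resA F)) F + d * (F.card - (d + 1)) := by
  have h1 : ∑ v ∈ X, sv d W X F v = ∑ v ∈ F, (((F ∩ nb W X v).card : ℤ) - d) := by
    rw [← Finset.sum_filter_add_sum_filter_not X (fun v => v ∈ F)]
    rw [Finset.sum_congr rfl (g := fun v => ((F ∩ nb W X v).card : ℤ) - d) (fun v hv => by
      rw [sv, if_pos (Finset.mem_filter.1 hv).2])]
    rw [Finset.sum_eq_zero (s := X.filter (fun v => v ∉ F)) (fun v hv => by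
      rw [sv, if_neg (Finset.mem_filter.1 hv).2]), add_zero]
    congr 1
    ext x; simp; exact fun hx => h.fF.1.1 hx
  have h2 := h.sum_F
  rw [h1, Finset.sum_sub_distrib, exc]
  zify at h2
  rw [h2]
  have h3 : (((d + 1).choose 2 : ℕ) : ℤ) * 2 = (d + 1) * d := by
    have := Nat.add_one_mul_choose_eq d 1
    simp at this
    exact_mod_cast this.symm
  simp
  linarith

theorem Poly.sum_degZ (hP : Poly W X) (d : ℕ):
    ∑ v ∈ X, ((nb W X v).card : ℤ)
      = 2 * exc (d + 1) W X + 2 * (d + 1) * X.card - (d + 2) * (d + 1) := by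
  have h1 := hP.sum_deg
  zify at h1
  have h3 : (((d + 1 + 1).choose 2 : ℕ) : ℤ) * 2 = (d + 2) * (d + 1) := by
    have := Nat.add_one_mul_choose_eq (d + 1) 1
    simp at this
    exact_mod_cast this.symm
  rw [h1, exc]
  push_cast
  linarith

theorem Asp.step (h : Asp (d + 1) W X F) (hd : 3 ≤ d) {j : ℕ} (hj : 1 ≤ j) (hj' : j ≤ d - 1) :
    ∃ m c t : ℤ, 0 < m ∧ 0 < c ∧ 0 ≤ t ∧ m * eZ (d + 1) W X (F.card - (d + 1)) (j + 1)
      = ∑ v ∈ X, eZ d (van W {v}) (nb W X v) (sv d W X F v) j + c * exc (d + 1) W X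
        + t * (exc (d + 1) W X - exc d (W.map (resA F)) F) := by
  have hdeg := h.poly.sum_degZ d
  have hsv := h.sum_sv
  have c1 : ((d : ℤ) + 1) * d.choose j = (d + 1).choose (j + 1) * (j + 1) := by
    exact_mod_cast Nat.add_one_mul_choose_eq d j
  have c2 : ((d : ℤ) + 2) * (d + 1).choose (j + 1) = (d + 2).choose (j + 2) * (j + 2) := by
    exact_mod_cast Nat.add_one_mul_choose_eq (d + 1) (j + 1)
  have cpos : (0 : ℤ) < d.choose j := by exact_mod_cast Nat.choose_pos (by omega)
  by_cases h1 : j ≤ d - 3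
  · refine ⟨j + 2, 2 * d.choose j, 0, by omega, by omega, le_refl _, ?_⟩
    have hs := h.sum_low (k := j + 1) (by omega)
    zify at hs
    simp only [eZ, phiZ_low hj h1]
    rw [phiZ_low (by omega) (by omega)]
    simp only [Finset.sum_sub_distrib, ← Finset.mul_sum, Finset.sum_const, nsmul_eq_mul, hs, hdeg]
    push_cast
    have c3 := congrArg (fun z => z * (j + 1 : ℤ)) c2
    have c4 := congrArg (fun z => z * (d + 2 : ℤ)) c1
    have c5 := congrArg (fun z => z * (X.card : ℤ)) c1
    simp only [show j + 1 + 1 = j + 2 from rfl, show d + 1 + 1 = d + 2 from rfl] at *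
    linear_combination -c3 - c4 + 2 * c5
  by_cases h2 : j = d - 2
  · obtain ⟨e, rfl⟩ : ∃ e, d = e + 2 := ⟨d - 2, by omega⟩
    obtain rfl : j = e := by omega
    refine ⟨j + 2, 2 * (j + 2).choose j - 2, 2, by omega, ?_, by omega, ?_⟩
    · have : j + 2 ≤ (j + 2).choose j := by
        rw [Nat.choose_symm_of_eq_add (a := j) (b := 2) rfl]
        have : (j + 2).choose 2 * 2 = (j + 2) * (j + 1) := by
          have := Nat.add_one_mul_choose_eq (j + 1) 1
          simp at this; linarith
        nlinarith
      zify at this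
      omega
    have hs := h.sum_low (k := j + 1) (by omega)
    zify at hs
    simp only [eZ, phiZ_mid hj]
    have e1 : phiZ (j + 2 + 1) (X.card) (F.card - ((j + 2 : ℕ) + 1)) (j + 1) = _ := phiZ_mid (d := j + 1) (by omega)
    rw [e1]
    simp only [Finset.sum_sub_distrib, ← Finset.mul_sum, Finset.sum_const, nsmul_eq_mul, hs, hdeg, hsv]
    push_cast at *
    have c3 := congrArg (fun z => z * (j + 1 : ℤ)) c2
    have c4 := congrArg (fun z => z * (j + 4 : ℤ)) c1
    have c5 := congrArg (fun z => z * (X.card : ℤ)) c1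
    simp only [show j + 1 + 1 = j + 2 from rfl, show j + 2 + 1 = j + 3 from rfl, show j + 2 + 2 = j + 4 from rfl, show j + 1 + 2 = j + 3 from rfl, show j + 1 + 3 = j + 4 from rfl] at *
    linear_combination -c3 - c4 + 2 * c5
  · obtain ⟨e, rfl⟩ : ∃ e, d = e + 2 := ⟨d - 2, by omega⟩
    obtain rfl : j = e + 1 := by omega
    refine ⟨e + 3, 2 * e, 2, by omega, by omega, by omega, ?_⟩
    have hs := h.sum_top
    rw [Nat.cast_sum] at hs
    simp only [eZ, phiZ_top (d := e) (by omega)]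
    have e1 : phiZ (e + 2 + 1) (X.card) (F.card - ((e + 2 : ℕ) + 1)) (e + 1 + 1) = _ := phiZ_top (d := e + 1) (by omega)
    rw [e1]
    simp only [show e + 1 + 1 = e + 2 from rfl, show e + 2 + 1 = e + 3 from rfl] at *
    simp only [Finset.sum_sub_distrib, ← Finset.mul_sum, Finset.sum_const, nsmul_eq_mul, hs, hdeg, hsv]
    push_cast
    ring

theorem Asp.base3 (h : Asp 3 W X F) {i : ℕ} (h1 : 1 ≤ i) (h2 : i ≤ 2) :
    eZ 3 W X (F.card - 3) i = 0 := by
  have hm : F ∈ facets W X := mem_facets.2 h.fF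
  have a1 := h.poly.sum_facets4 h.fr
  have a2 := h.poly.sweep h.fr
  have a3 : ∑ f ∈ facets W X, f.card + 3 = 3 * (facets W X).card + F.card := by
    rw [← Finset.add_sum_erase _ _ hm, Finset.sum_congr rfl (fun A hA =>
      h.simp A (mem_facets.1 (Finset.mem_of_mem_erase hA)) (Finset.ne_of_mem_erase hA)),
      Finset.sum_const, Finset.card_erase_of_mem hm, smul_eq_mul]
    have : 1 ≤ (facets W X).card := Finset.card_pos.2 ⟨F, hm⟩
    omega
  have hc : (4 : ℕ).choose 2 = 6 := rfl
  interval_cases i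
  · rw [eZ, phiZ_mid (le_refl 1)]
    simp [hc]
    omega
  · rw [eZ, phiZ_top (le_refl 1), fs_facets h.fr]
    omega

theorem Asp.main : ∀ (d : ℕ), 3 ≤ d → ∀ {W : Submodule ℝ (V → ℝ)} {X F : Finset V}, Asp d W X F →
    (∀ i, 1 ≤ i → i ≤ d - 1 → 0 ≤ eZ d W X (F.card - d) i ∧
      (4 ≤ d → eZ d W X (F.card - d) i = 0 → exc d W X = 0) ∧
      ((4 ≤ d → exc d W X = 0) → eZ d W X (F.card - d) i = 0)) := by
  intro d hd
  induction d, hd using Nat.le_induction with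
  | base =>
    intro W X F h i h1 h2
    have := h.base3 h1 h2
    refine ⟨this.ge, by omega, fun _ => this⟩
  | succ d hd ih =>
    intro W X F h i h1 h2
    have hl : ∀ v ∈ X, ∀ j, 1 ≤ j → j ≤ d - 1 →
        0 ≤ eZ d (van W {v}) (nb W X v) (sv d W X F v) j ∧
        ((4 ≤ d → exc d (van W {v}) (nb W X v) = 0) →
          eZ d (van W {v}) (nb W X v) (sv d W X F v) j = 0) := by
      intro v hv j hj hj'
      by_cases hvF : v ∈ F
      · rw [sv, if_pos hvF]
        have := ih (h.link_in hvF) j hj hj'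
        exact ⟨this.1, this.2.2⟩
      · rw [sv, if_neg hvF]
        obtain ⟨F', hF', hc⟩ := (h.link_out hv hvF).asp
        have := ih hF' j hj hj'
        rw [hc, sub_self] at this
        exact ⟨this.1, this.2.2⟩
    have hex := exc_nonneg h.poly h.fr (h.rigid (by omega))
    obtain ⟨hf0, hf1⟩ := h.exc_facet hd
    rcases Nat.eq_or_lt_of_le h1 with rfl | h1'
    · rw [Asp.exc_eq (by omega)]
      exact ⟨hex, fun _ h => h, fun h => h (by omega)⟩
    · obtain ⟨j, rfl⟩ : ∃ j, i = j + 1 := ⟨i - 1, by omega⟩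
      obtain ⟨m, c, t, hm, hc, ht, he⟩ := h.step hd (j := j) (by omega) (by omega)
      have hsum : 0 ≤ ∑ v ∈ X, eZ d (van W {v}) (nb W X v) (sv d W X F v) j :=
        Finset.sum_nonneg (fun v hv => (hl v hv j (by omega) (by omega)).1)
      have ht' : 0 ≤ t * (exc (d + 1) W X - exc d (W.map (resA F)) F) :=
        mul_nonneg ht (by linarith)
      have hc' : 0 ≤ c * exc (d + 1) W X := mul_nonneg hc.le hex
      push_cast
      refine ⟨?_, ?_, ?_⟩
      · refine nonneg_of_mul_nonneg_right (a := m) ?_ hm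
        linarith
      · intro _ h0
        rw [h0] at he
        have : c * exc (d + 1) W X = 0 := by linarith
        rcases mul_eq_zero.1 this with h | h
        · omega
        · exact h
      · intro h0
        have h0 := h0 (by omega)
        have hz : ∑ v ∈ X, eZ d (van W {v}) (nb W X v) (sv d W X F v) j = 0 := by
          refine Finset.sum_eq_zero (fun v hv => (hl v hv j (by omega) (by omega)).2 (fun h4 => ?_))
          have q1 := h.exc_link h4 hv
          have q2 : Rigid (van W {v}) (nb W X v) := by
            by_cases hvF : v ∈ F
            · exact (h.link_in hvF).rigid h4
            · exact Smp.rigid d (by omega) (h.link_out hv hvF)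
          have q3 : Module.finrank ℝ (van W {v}) = d + 1 := by
            have := h.poly.finrank_van1 hv; have := h.fr; omega
          have := exc_nonneg (h.poly.link hv) q3 q2
          omega
        have hF0 : exc d (W.map (resA F)) F = 0 := by omega
        rw [hz, h0, hF0] at he
        simp at he
        rcases he with h | h
        · omega
        · exact h

theorem Asp.prop (h : Asp d W X F) (hd : 4 ≤ d) {i : ℕ} (h1 : 1 ≤ i) (h2 : i ≤ d - 1)
    (h0 : eZ d W X (F.card - d) i = 0) {k : ℕ} (hk : k ≤ d - 1) :
    eZ d W X (F.card - d) k = 0 := by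
  have he := ((Asp.main d (by omega) h) i h1 h2).2.1 hd h0
  rcases Nat.eq_zero_or_pos k with rfl | hk'
  · rw [eZ, phiZ, if_pos rfl, zero_add, h.poly.fs1, sub_self]
  · exact ((Asp.main d (by omega) h) k hk' hk).2.2 (fun _ => he)

end Core9

section Core10
open scoped Classical
set_option linter.all false
variable {d : ℕ} {P G : Set (Fin d → ℝ)}

theorem verts_finite (hP : IsPolytope P) : (verts P).Finite := by
  obtain ⟨S, rfl⟩ := hP
  exact S.finite_toSet.subset extremePoints_convexHull_subset

theorem poly_compact (hP : IsPolytope P) : IsCompact P := by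
  obtain ⟨S, rfl⟩ := hP
  exact S.finite_toSet.isCompact_convexHull ℝ

theorem poly_convex (hP : IsPolytope P) : Convex ℝ P := by
  obtain ⟨S, rfl⟩ := hP
  exact convex_convexHull ℝ _

theorem hull_verts (hc : IsCompact G) (hx : Convex ℝ G) (hf : (verts G).Finite) :
    convexHull ℝ (verts G) = G := by
  have : closure (convexHull ℝ (verts G)) = G := closure_convexHull_extremePoints hc hx
  rwa [(hf.isClosed_convexHull ℝ).closure_eq] at this

theorem dotp_eq (b x : Fin d → ℝ) : dotp b x = dotProductEquiv ℝ (Fin d) b x := rfl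

theorem face_data (hP : IsPolytope P) (hG : IsFaceOf P G) :
    verts G = G ∩ verts P ∧ convexHull ℝ (verts G) = G := by
  rcases hG with rfl | rfl | ⟨b, c, hb, hle, rfl⟩
  · simp [verts]
  · exact ⟨(Set.inter_eq_right.2 (extremePoints_subset)).symm,
      hull_verts (poly_compact hP) (poly_convex hP) (verts_finite hP)⟩
  · set l := dotProductEquiv ℝ (Fin d) b with hl
    have hcont : Continuous l := LinearMap.continuous_of_finiteDimensional l
    have hE : IsExtreme ℝ P {x ∈ P | dotp b x = c} := by
      refine ⟨fun x hx => hx.1, ?_⟩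
      rintro x hx y hy z ⟨hz, hzc⟩ ⟨α, β, hα, hβ, hab, rfl⟩
      refine ⟨hx, ?_⟩
      have h1 := hle x hx
      have h2 := hle y hy
      rw [dotp_eq, ← hl] at *
      rw [map_add, map_smul, map_smul, smul_eq_mul, smul_eq_mul] at hzc
      have e1 := mul_le_mul_of_nonneg_left h2 hβ.le
      have e2 : α * l x + β * c ≥ α * c + β * c := by
        rw [← add_mul, hab]; linarith
      have e3 : α * c ≤ α * l x := by linarith
      exact le_antisymm h1 (le_of_mul_le_mul_left e3 hα)
    have hv : verts {x ∈ P | dotp b x = c} = {x ∈ P | dotp b x = c} ∩ verts P := hE.extremePoints_eq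
    refine ⟨hv, hull_verts ?_ ?_ ?_⟩
    · have : {x ∈ P | dotp b x = c} = P ∩ l ⁻¹' {c} := by ext x; rfl
      rw [this]
      exact (poly_compact hP).inter_right (isClosed_singleton.preimage hcont)
    · have : {x ∈ P | dotp b x = c} = P ∩ l ⁻¹' {c} := by ext x; rfl
      rw [this]
      exact (poly_convex hP).inter ((convex_singleton c).linear_preimage l)
    · rw [hv]; exact (verts_finite hP).subset Set.inter_subset_right

/-- affine functions on the vertex set -/
def Lm (P : Set (Fin d → ℝ)) : (Module.Dual ℝ (Fin d → ℝ) × ℝ) →ₗ[ℝ] (↥(verts P) → ℝ) where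
  toFun q := fun x => q.2 - q.1 x.1
  map_add' := fun a b => by ext x; simp; ring
  map_smul' := fun c a => by ext x; simp; ring

def WP (P : Set (Fin d → ℝ)) : Submodule ℝ (↥(verts P) → ℝ) := LinearMap.range (Lm P)

theorem mem_WP {w : ↥(verts P) → ℝ} : w ∈ WP P ↔
    ∃ (b : Fin d → ℝ) (c : ℝ), ∀ x, w x = c - dotp b x.1 := by
  constructor
  · rintro ⟨⟨l, c⟩, rfl⟩
    refine ⟨(dotProductEquiv ℝ (Fin d)).symm l, c, fun x => ?_⟩
    rw [dotp_eq, LinearEquiv.apply_symm_apply]; rfl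
  · rintro ⟨b, c, h⟩
    exact ⟨(dotProductEquiv ℝ (Fin d) b, c), by ext x; rw [h x]; rfl⟩

theorem polyDim_hull (S : Set (Fin d → ℝ)) : polyDim (convexHull ℝ S) = polyDim S := by
  rw [polyDim, polyDim, affineSpan_convexHull]

theorem polyDim_eq (S : Set (Fin d → ℝ)) : polyDim S = Module.finrank ℝ (vectorSpan ℝ S) := by
  rw [polyDim, direction_affineSpan]

variable [Fintype ↥(verts P)]

def Sup (P : Set (Fin d → ℝ)) [Fintype ↥(verts P)] (G : Set (Fin d → ℝ)) : Finset ↥(verts P) :=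
  Finset.univ.filter (fun x => x.1 ∈ G)

theorem mem_Sup {x : ↥(verts P)} : x ∈ Sup P G ↔ x.1 ∈ G := by simp [Sup]

theorem span_top (hP : IsPolytope P) (hdim : polyDim P = d) : vectorSpan ℝ (verts P) = ⊤ := by
  apply Submodule.eq_top_of_finrank_eq
  rw [← polyDim_eq, ← polyDim_hull, hull_verts (poly_compact hP) (poly_convex hP) (verts_finite hP),
    hdim]
  simp

theorem ann_iff {S : Set (Fin d → ℝ)} {a : Fin d → ℝ} (ha : a ∈ S)
    (l : Module.Dual ℝ (Fin d → ℝ)) :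
    l ∈ (vectorSpan ℝ S).dualAnnihilator ↔ ∀ x ∈ S, l x = l a := by
  rw [Submodule.mem_dualAnnihilator, vectorSpan_eq_span_vsub_set_right ℝ ha]
  constructor
  · intro h x hx
    have := h (x - a) (Submodule.subset_span ⟨x, hx, rfl⟩)
    rw [map_sub] at this; linarith
  · intro h w hw
    induction hw using Submodule.span_induction with
    | mem y hy => obtain ⟨x, hx, rfl⟩ := hy; simp [h x hx]
    | zero => simp
    | add x y _ _ hx hy => rw [map_add, hx, hy, add_zero]
    | smul c x _ hx => rw [map_smul, hx, smul_zero]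

theorem finrank_vanP (hP : IsPolytope P) (hdim : polyDim P = d) {A : Finset ↥(verts P)}
    (hA : A.Nonempty) :
    Module.finrank ℝ (van (WP P) A) + polyDim (Subtype.val '' (A : Set ↥(verts P))) = d := by
  obtain ⟨a, ha⟩ := hA
  set T := Subtype.val '' (A : Set ↥(verts P)) with hT
  have haT : a.1 ∈ T := ⟨a, ha, rfl⟩
  let g : (vectorSpan ℝ T).dualAnnihilator →ₗ[ℝ] (↥(verts P) → ℝ) :=
    { toFun := fun l x => l.1 a.1 - l.1 x.1
      map_add' := fun l m => by ext x; simp; ring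
      map_smul' := fun c l => by ext x; simp; ring }
  have hg : ∀ l x, g l x = l.1 a.1 - l.1 x.1 := fun l x => rfl
  have hinj : Function.Injective g := by
    intro l m hl
    have h1 : l.1 - m.1 ∈ (vectorSpan ℝ (verts P)).dualAnnihilator := by
      rw [ann_iff a.2]
      intro x hx
      have := congrFun hl ⟨x, hx⟩
      rw [hg, hg] at this
      rw [LinearMap.sub_apply, LinearMap.sub_apply]
      simp only at this
      linarith
    rw [span_top hP hdim, Submodule.dualAnnihilator_top, Submodule.mem_bot, sub_eq_zero] at h1
    exact Subtype.ext h1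
  have hr : LinearMap.range g = van (WP P) A := by
    ext w
    constructor
    · rintro ⟨l, rfl⟩
      refine ⟨⟨(l.1, l.1 a.1), rfl⟩, fun x hx => ?_⟩
      rw [hg, (ann_iff haT l.1).1 l.2 x.1 ⟨x, hx, rfl⟩, sub_self]
    · rintro ⟨⟨⟨l, c⟩, rfl⟩, h⟩
      have hc : ∀ x ∈ A, c - l x.1 = 0 := h
      have hc0 := hc a ha
      refine ⟨⟨l, (ann_iff haT l).2 ?_⟩, ?_⟩
      · rintro _ ⟨x, hx, rfl⟩
        have := hc x hx
        linarith
      · ext x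
        show l a.1 - l x.1 = c - l x.1
        linarith
  rw [← hr, LinearMap.finrank_range_of_inj hinj, polyDim_eq, add_comm,
    Subspace.finrank_add_finrank_dualAnnihilator_eq]
  simp

theorem polyP (hP : IsPolytope P) : Poly (WP P) (Finset.univ) := by
  refine ⟨?_, ?_, ?_⟩
  · refine Fc.mk' (by simp) (fun _ => 1) (mem_WP.2 ⟨0, 1, fun x => by simp [dotp]⟩) (by simp) (by simp)
  · intro v _
    have hv : v.1 ∈ Set.extremePoints ℝ P := v.2
    rw [(poly_convex hP).mem_extremePoints_iff_mem_sdiff_convexHull_sdiff] at hv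
    have hn : v.1 ∉ convexHull ℝ (verts P \ {v.1}) := fun h => hv.2
      (convexHull_mono (Set.sdiff_subset_sdiff_left extremePoints_subset) h)
    have hfin : (verts P \ {v.1}).Finite := (verts_finite hP).subset Set.sdiff_subset
    obtain ⟨f, u, h1, h2⟩ := geometric_hahn_banach_closed_point (convex_convexHull ℝ _)
      (hfin.isClosed_convexHull ℝ) hn
    refine Fc.mk' (by simp) (fun x => f v.1 - f x.1) ⟨(f.toLinearMap, f v.1), rfl⟩ (by simp) ?_
    intro x _ hx
    have hx' : x.1 ∈ verts P \ {v.1} := ⟨x.2, fun h => hx (by simpa using Subtype.ext h)⟩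
    have := h1 x.1 (subset_convexHull ℝ _ hx')
    linarith
  · intro w _ h; ext x; exact h x (Finset.mem_univ _)

theorem finrank_WP (hP : IsPolytope P) (hdim : polyDim P = d) (hne : (verts P).Nonempty) :
    Module.finrank ℝ (WP P) = d + 1 := by
  obtain ⟨v, hv⟩ := hne
  have h1 := (polyP hP).finrank_van1 (Finset.mem_univ ⟨v, hv⟩)
  have h2 := finrank_vanP hP hdim (A := {⟨v, hv⟩}) (by simp)
  rw [polyDim_eq, Finset.coe_singleton, Set.image_singleton, vectorSpan_singleton, finrank_bot] at h2
  omega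

theorem val_Sup : Subtype.val '' (Sup P G : Set ↥(verts P)) = G ∩ verts P := by
  ext x
  constructor
  · rintro ⟨y, hy, rfl⟩
    exact ⟨mem_Sup.1 hy, y.2⟩
  · rintro ⟨h1, h2⟩
    exact ⟨⟨x, h2⟩, mem_Sup.2 h1, rfl⟩

theorem face_Sup (hP : IsPolytope P) (hG : IsFaceOf P G) (hne : G.Nonempty) :
    Fc (WP P) Finset.univ (Sup P G) := by
  rcases hG with rfl | rfl | ⟨b, c, hb, hle, rfl⟩
  · simp at hne
  · have : Sup G G = Finset.univ := by
      ext x; simp [mem_Sup]; exact extremePoints_subset x.2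
    rw [this]; exact Fc.self
  · refine ⟨by simp, fun x => c - dotp b x.1, mem_WP.2 ⟨b, c, fun x => rfl⟩, fun x _ => ?_, fun x _ => ?_⟩
    · have := hle x.1 (extremePoints_subset x.2)
      linarith
    · rw [mem_Sup]
      constructor
      · intro h; exact ⟨extremePoints_subset x.2, by linarith⟩
      · rintro ⟨_, h⟩; simp only; linarith

theorem face_of_Fc (hP : IsPolytope P) {A : Finset ↥(verts P)} (hA : A.Nonempty)
    (h : Fc (WP P) Finset.univ A) : ∃ G, IsFaceOf P G ∧ G.Nonempty ∧ Sup P G = A := by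
  obtain ⟨_, w, hw, h0, h1⟩ := h
  obtain ⟨a, ha⟩ := hA
  obtain ⟨b, c, hbc⟩ := mem_WP.1 hw
  by_cases hb : b = 0
  · refine ⟨P, Or.inr (Or.inl rfl), ⟨a.1, extremePoints_subset a.2⟩, ?_⟩
    ext x
    rw [mem_Sup]
    have hwx : w x = 0 := by
      have := (h1 a (Finset.mem_univ _)).2 ha
      rw [hbc, hb] at this ⊢
      simpa [dotp] using this
    exact ⟨fun _ => (h1 x (Finset.mem_univ _)).1 hwx, fun _ => extremePoints_subset x.2⟩
  · have hle : ∀ x ∈ P, dotp b x ≤ c := by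
      have hsub : P ⊆ {x | dotProductEquiv ℝ (Fin d) b x ≤ c} := by
        rw [← hull_verts (poly_compact hP) (poly_convex hP) (verts_finite hP)]
        apply convexHull_min
        · intro x hx
          have := h0 ⟨x, hx⟩ (Finset.mem_univ _)
          rw [hbc] at this
          show dotp b x ≤ c
          simp only at this
          linarith
        · exact convex_halfSpace_le (LinearMap.isLinear _) c
      exact hsub
    have hS : Sup P {x ∈ P | dotp b x = c} = A := by
      ext x
      rw [mem_Sup, ← h1 x (Finset.mem_univ _), hbc]
      constructor
      · rintro ⟨_, h⟩; linarith
      · intro h; exact ⟨extremePoints_subset x.2, by linarith⟩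
    refine ⟨_, Or.inr (Or.inr ⟨b, c, hb, hle, rfl⟩), ⟨a.1, ?_⟩, hS⟩
    rw [← hS] at ha
    exact mem_Sup.1 ha

theorem face_dim (hP : IsPolytope P) (hdim : polyDim P = d) (hG : IsFaceOf P G) (hne : G.Nonempty) :
    (Sup P G).Nonempty ∧ Module.finrank ℝ (van (WP P) (Sup P G)) + polyDim G = d ∧
      (verts G).ncard = (Sup P G).card := by
  obtain ⟨h1, h2⟩ := face_data hP hG
  have h3 : Subtype.val '' (Sup P G : Set ↥(verts P)) = verts G := by rw [val_Sup, h1]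
  have h4 : (Sup P G).Nonempty := by
    by_contra hcon
    rw [Finset.not_nonempty_iff_eq_empty] at hcon
    rw [hcon] at h3
    rw [← h3] at h2
    simp at h2
    rw [← h2] at hne
    simp at hne
  refine ⟨h4, ?_, ?_⟩
  · have := finrank_vanP hP hdim h4
    rwa [h3, ← polyDim_hull, h2] at this
  · rw [← h3, Set.ncard_image_of_injective _ Subtype.val_injective, Set.ncard_coe_finset]

theorem Sup_inj (hP : IsPolytope P) {G' : Set (Fin d → ℝ)} (hG : IsFaceOf P G) (hG' : IsFaceOf P G')
    (h : Sup P G = Sup P G') : G = G' := by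
  rw [← (face_data hP hG).2, ← (face_data hP hG').2, (face_data hP hG).1, (face_data hP hG').1,
    ← val_Sup, ← val_Sup, h]

theorem fVec_eq (hP : IsPolytope P) (hdim : polyDim P = d) (hne : (verts P).Nonempty) (i : ℕ) :
    fVec P i = (fs (WP P) Finset.univ (i + 1)).card := by
  have hfr := finrank_WP hP hdim hne
  rw [fVec, ← Set.ncard_coe_finset]
  refine Set.ncard_congr (fun G _ => Sup P G) ?_ ?_ ?_
  · rintro G ⟨hG, hn, hi⟩
    have := (face_dim hP hdim hG hn).2.1
    exact Finset.mem_coe.2 (mem_fs.2 ⟨face_Sup hP hG hn, by omega⟩)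
  · rintro G G' ⟨hG, -⟩ ⟨hG', -⟩ h
    exact Sup_inj hP hG hG' h
  · intro A hA
    obtain ⟨hA1, hA2⟩ := mem_fs.1 (Finset.mem_coe.1 hA)
    have hAn : A.Nonempty := by
      by_contra hcon
      rw [Finset.not_nonempty_iff_eq_empty] at hcon
      subst hcon
      have : van (WP P) ∅ = WP P := by ext w; simp [mem_van]
      rw [this] at hA2
      omega
    obtain ⟨G, hG, hn, rfl⟩ := face_of_Fc hP hAn hA1
    have := (face_dim hP hdim hG hn).2.1
    exact ⟨G, ⟨hG, hn, by omega⟩, rfl⟩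

theorem aspP {F : Set (Fin d → ℝ)} (h : IsASPPair P F) (hd : 1 ≤ d) :
    Asp d (WP P) Finset.univ (Sup P F) := by
  obtain ⟨hP, hdim, ⟨hF, hFn, hFd⟩, hs⟩ := h
  have hF3 := face_dim hP hdim hF hFn
  have hne : (verts P).Nonempty := by
    obtain ⟨x, _⟩ := hF3.1
    exact ⟨x.1, x.2⟩
  refine ⟨polyP hP, finrank_WP hP hdim hne, ⟨face_Sup hP hF hFn, by omega⟩, ?_⟩
  intro A hA hAF
  have hAn : A.Nonempty := by
    by_contra hcon
    rw [Finset.not_nonempty_iff_eq_empty] at hcon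
    subst hcon
    have : van (WP P) ∅ = WP P := by ext w; simp [mem_van]
    have h2 := hA.2
    rw [this, finrank_WP hP hdim hne] at h2
    omega
  obtain ⟨G, hG, hGn, rfl⟩ := face_of_Fc hP hAn hA.1
  have h3 := face_dim hP hdim hG hGn
  have h4 := hA.2
  rw [← h3.2.2]
  exact hs G ⟨hG, hGn, by omega⟩ (fun h => hAF (by rw [h]))

end Core10

/-- **Equality propagation in the LBT for `d > 4`.** If `P ∈ 𝒫(d,n,s)` with `d > 4` attains
the lower bound `φ_i(d,n,s)` for some `1 ≤ i ≤ d−1`, then it attains it for all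
`0 ≤ i ≤ d−1`. -/
theorem lbt_asp_equality_propagation (d n s : ℕ) (hd : 4 < d) (hn : d + s + 1 ≤ n)
    (P : Set (Fin d → ℝ)) (hP : MemASP d n s P)
    (hEq : ∃ i : ℕ, 1 ≤ i ∧ i ≤ d - 1 ∧ (fVec P i : ℤ) = phi d n s i) :
    ∀ i : ℕ, i ≤ d - 1 → (fVec P i : ℤ) = phi d n s i := by
  obtain ⟨hnP, F, hA, hF⟩ := hP
  obtain ⟨i, h1, h2, h3⟩ := hEq
  have hPP := hA.1
  have : Fintype ↥(verts P) := (verts_finite hPP).fintype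
  have hasp := aspP hA (by omega)
  have hfd := face_dim hPP hA.2.1 hA.2.2.1.1 hA.2.2.1.2.1
  have hne : (verts P).Nonempty := by
    obtain ⟨x, _⟩ := hfd.1
    exact ⟨x.1, x.2⟩
  have hcard : (Finset.univ : Finset ↥(verts P)).card = n := by
    rw [← hnP, ← Nat.card_coe_set_eq, Nat.card_eq_fintype_card, Finset.card_univ]
  have hs : ((Sup P F).card : ℤ) - d = s := by
    rw [← hfd.2.2, hF]; push_cast; ring
  have key : ∀ k, eZ d (WP P) Finset.univ ((Sup P F).card - d) k = (fVec P k : ℤ) - phi d n s k := by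
    intro k
    rw [eZ, hs, hcard, fVec_eq hPP hA.2.1 hne k]
    rfl
  intro k hk
  have h0 : eZ d (WP P) Finset.univ ((Sup P F).card - d) i = 0 := by rw [key, h3, sub_self]
  have := hasp.prop (by omega) h1 h2 h0 hk
  rw [key] at this
  linarith


end

end ASP
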